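/- There is a universal constant C with the following property. Let Λ ∈ M_n(ℝ) be a nonzero diagonal matrix with tr Λ = 0, let U be a Haar-distributed random matrix in the unitary group U(n), and define A = U Λ U*. Let B be the upper-left k×k submatrix of A (k ≥ 2), set M = (√(n²−1)/‖Λ‖_HS)·B, let μ_{k^{-1/2}M} be the empirical spectral measure of k^{-1/2}M, and let ρ_sc be the semicircle law with density (1/2π)√(4−t²) on [−2,2]. Then for every t > 0, P[ W₁(μ_{k^{-1/2}M}, ρ_sc) ≥ 18 k² √n (‖Λ‖_op²/‖Λ‖_HS²) + C √(log k)/k + t ] ≤ exp[ − (n t²/12) · ( 2 (√(n²−1)/k)(‖Λ‖_op/‖Λ‖_HS) )^{−2} ]. -/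

import Mathlib

open MeasureTheory ProbabilityTheory Matrix
open scoped Matrix ENNReal

universe u

/-- Entrywise (Borel product) measurable structure on matrices. -/
instance matrixMeasurableSpace {m n α : Type*} [MeasurableSpace α] :
    MeasurableSpace (Matrix m n α) :=
  inferInstanceAs (MeasurableSpace (m → n → α))

/-- Hilbert–Schmidt norm of a real square matrix. -/
noncomputable def hsNormR {n : ℕ} (M : Matrix (Fin n) (Fin n) ℝ) : ℝ :=
  Real.sqrt ((M * Mᵀ).trace)

/-- Operator (ℓ²→ℓ²) norm of a real square matrix. -/
noncomputable def opNormR {n : ℕ} (M : Matrix (Fin n) (Fin n) ℝ) : ℝ :=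
  ‖Matrix.toEuclideanCLM (𝕜 := ℝ) M‖

/-- L¹-Wasserstein (Kantorovich) distance between measures on ℝ, in dual form. -/
noncomputable def W1m (μ ν : Measure ℝ) : ℝ :=
  ⨆ f : {f : ℝ → ℝ // LipschitzWith 1 f}, |(∫ x, f.1 x ∂μ) - ∫ x, f.1 x ∂ν|

open scoped Classical in
/-- Empirical spectral measure of a (Hermitian) matrix. -/
noncomputable def esd {k : ℕ} (M : Matrix (Fin k) (Fin k) ℂ) : Measure ℝ :=
  if h : M.IsHermitian then
    (k : ℝ≥0∞)⁻¹ • ∑ i : Fin k, Measure.dirac (h.eigenvalues i)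
  else 0

/-- The semicircle law, with density √(4−t²)/(2π) on [−2,2]. -/
noncomputable def semicircle : Measure ℝ :=
  MeasureTheory.volume.withDensity fun t =>
    ENNReal.ofReal (Real.sqrt (4 - t ^ 2) / (2 * Real.pi))


open MeasureTheory ProbabilityTheory Matrix
open scoped Matrix ENNReal
set_option linter.unusedSectionVars false

section HaarCore
open scoped Matrix.Norms.Frobenius

variable {N : Type} [Fintype N] [DecidableEq N]

instance matrixBorel {m n : Type} [Fintype m] [Fintype n] : BorelSpace (Matrix m n ℂ) :=
  inferInstanceAs (BorelSpace (m → n → ℂ))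

instance matrixSCT {m n : Type} [Fintype m] [Fintype n] :
    SecondCountableTopology (Matrix m n ℂ) :=
  inferInstanceAs (SecondCountableTopology (m → n → ℂ))

/-- A left-invariant probability measure carried by the unitary group. -/
structure IsHaarU (ν : Measure (Matrix N N ℂ)) : Prop where
  prob : IsProbabilityMeasure ν
  unit : ∀ᵐ W ∂ν, W ∈ Matrix.unitaryGroup N ℂ
  inv : ∀ V ∈ Matrix.unitaryGroup N ℂ, Measure.map (fun W => V * W) ν = ν

lemma isCompact_unitaryGroup :
    IsCompact (Matrix.unitaryGroup N ℂ : Set (Matrix N N ℂ)) := by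
  apply Metric.isCompact_of_isClosed_isBounded
  · have : (Matrix.unitaryGroup N ℂ : Set (Matrix N N ℂ)) = {W | W * star W = 1} := by
      ext W; simp [Matrix.mem_unitaryGroup_iff]
    rw [this]
    exact isClosed_eq (by fun_prop) continuous_const
  · rw [isBounded_iff_forall_norm_le]
    refine ⟨Real.sqrt (∑ i : N, ∑ j : N, 1), fun W hW => ?_⟩
    rw [Matrix.frobenius_norm_def, ← Real.sqrt_eq_rpow]
    apply Real.sqrt_le_sqrt
    refine Finset.sum_le_sum fun i _ => Finset.sum_le_sum fun j _ => ?_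
    have := entry_norm_bound_of_unitary hW i j
    have h0 := norm_nonneg (W i j)
    simp only [Real.rpow_two]
    nlinarith

lemma bounded_on_unitary {E : Type*} [NormedAddCommGroup E] {f : Matrix N N ℂ → E}
    (hf : Continuous f) : ∃ M : ℝ, ∀ W ∈ Matrix.unitaryGroup N ℂ, ‖f W‖ ≤ M := by
  obtain ⟨M, hM⟩ := (isCompact_unitaryGroup (N := N)).exists_bound_of_continuousOn hf.continuousOn
  exact ⟨M, hM⟩

namespace IsHaarU
variable {ν : Measure (Matrix N N ℂ)}

lemma integrable (h : IsHaarU ν) {E : Type*} [NormedAddCommGroup E]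
    {f : Matrix N N ℂ → E} (hf : Continuous f) : Integrable f ν := by
  have := h.prob
  obtain ⟨M, hM⟩ := bounded_on_unitary hf
  refine Integrable.of_bound hf.aestronglyMeasurable M ?_
  filter_upwards [h.unit] with W hW using hM W hW

lemma integral_mul_left (h : IsHaarU ν) {E : Type*} [NormedAddCommGroup E] [NormedSpace ℝ E]
    {f : Matrix N N ℂ → E} (hf : Continuous f) {V : Matrix N N ℂ}
    (hV : V ∈ Matrix.unitaryGroup N ℂ) : ∫ W, f (V * W) ∂ν = ∫ W, f W ∂ν := by
  conv_rhs => rw [← h.inv V hV]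
  rw [integral_map]
  · exact (by fun_prop : Continuous fun W : Matrix N N ℂ => V * W).measurable.aemeasurable
  · exact hf.aestronglyMeasurable

lemma exp_smul_mem {X : Matrix N N ℂ} (hX : Xᴴ = -X) (t : ℝ) :
    NormedSpace.exp (t • X) ∈ Matrix.unitaryGroup N ℂ := by
  apply NormedSpace.exp_mem_unitary_of_mem_skewAdjoint
  rw [skewAdjoint.mem_iff]
  simp only [star_smul, star_trivial, Matrix.star_eq_conjTranspose, hX, smul_neg]

lemma ibp (h : IsHaarU ν) {E : Type*} [NormedAddCommGroup E] [NormedSpace ℝ E]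
    {f g : Matrix N N ℂ → E} (hf : Continuous f) (hg : Continuous g)
    {X : Matrix N N ℂ} (hX : Xᴴ = -X)
    (hd : ∀ W ∈ Matrix.unitaryGroup N ℂ,
      HasDerivAt (fun t : ℝ => f (NormedSpace.exp (t • X) * W)) (g W) 0) :
    ∫ W, g W ∂ν = 0 := by
  have := h.prob
  obtain ⟨M, hM⟩ := bounded_on_unitary hg
  have hd' : ∀ W ∈ Matrix.unitaryGroup N ℂ, ∀ t : ℝ,
      HasDerivAt (fun t : ℝ => f (NormedSpace.exp (t • X) * W))
        (g (NormedSpace.exp (t • X) * W)) t := by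
    intro W hW t
    have h1 := hd _ (mul_mem (exp_smul_mem hX t) hW)
    have h2 : HasDerivAt (fun s : ℝ => f (NormedSpace.exp ((s - t) • X) *
      (NormedSpace.exp (t • X) * W))) (g (NormedSpace.exp (t • X) * W)) t := by
      have h3 : HasDerivAt (fun s : ℝ => s - t) 1 t := (hasDerivAt_id t).sub_const t
      have h1' : HasDerivAt (fun s : ℝ => f (NormedSpace.exp (s • X) *
        (NormedSpace.exp (t • X) * W))) (g (NormedSpace.exp (t • X) * W)) (t - t) := by
        simpa using h1
      simpa [Function.comp_def] using HasDerivAt.scomp (h := fun s : ℝ => s - t) t h1' h3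
    convert h2 using 2 with s
    rw [← mul_assoc, ← Matrix.exp_add_of_commute]
    · rw [← add_smul]; simp
    · exact (Commute.refl X).smul_left _ |>.smul_right _
  have key := hasDerivAt_integral_of_dominated_loc_of_deriv_le (μ := ν)
    (F := fun (t : ℝ) W => f (NormedSpace.exp (t • X) * W))
    (F' := fun (t : ℝ) W => g (NormedSpace.exp (t • X) * W))
    (bound := fun _ => M) (x₀ := (0:ℝ)) (s := Set.univ) Filter.univ_mem
    (Filter.Eventually.of_forall fun t =>
      (hf.comp (by fun_prop : Continuous fun W : Matrix N N ℂ =>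
        NormedSpace.exp (t • X) * W)).aestronglyMeasurable)
    (h.integrable (hf.comp (by fun_prop : Continuous fun W : Matrix N N ℂ =>
        NormedSpace.exp ((0:ℝ) • X) * W)))
    ((hg.comp (by fun_prop : Continuous fun W : Matrix N N ℂ =>
        NormedSpace.exp ((0:ℝ) • X) * W)).aestronglyMeasurable)
    (by
      filter_upwards [h.unit] with W hW t _
      exact hM _ (mul_mem (exp_smul_mem hX t) hW))
    (integrable_const M)
    (by
      filter_upwards [h.unit] with W hW t _
      exact hd' W hW t)
  have hc : (fun t : ℝ => ∫ W, f (NormedSpace.exp (t • X) * W) ∂ν) =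
      fun _ => ∫ W, f W ∂ν := by
    funext t
    exact h.integral_mul_left hf (exp_smul_mem hX t)
  have k2 := key.2
  rw [hc] at k2
  have := k2.unique (hasDerivAt_const (0:ℝ) (∫ W, f W ∂ν))
  simpa using this

lemma exp_row_eq {X : Matrix N N ℂ} {p : N} (hp : ∀ q, X p q = 0) (t : ℝ) (q : N) :
    NormedSpace.exp (t • X) p q = (1 : Matrix N N ℂ) p q := by
  have hd : ∀ s : ℝ, HasDerivAt (fun s : ℝ => NormedSpace.exp (s • X) p q) 0 s := by
    intro s
    have h1 := hasDerivAt_exp_smul_const' (𝕂 := ℝ) X s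
    have h2 := ((Matrix.entryLinearMap ℝ ℂ p q).toContinuousLinearMap.hasFDerivAt.comp_hasDerivAt s h1)
    have h3 : (Matrix.entryLinearMap ℝ ℂ p q).toContinuousLinearMap
      (X * NormedSpace.exp (s • X)) = 0 := by
      simp [Matrix.mul_apply, hp]
    have h4 := h2.congr_deriv h3
    exact h4
  have := is_const_of_deriv_eq_zero (f := fun s : ℝ => NormedSpace.exp (s • X) p q)
    (fun s => (hd s).differentiableAt) (fun s => (hd s).deriv) t 0
  simpa using this

lemma exp_mul_row_eq {X : Matrix N N ℂ} {p : N} (hp : ∀ q, X p q = 0) (t : ℝ)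
    (W : Matrix N N ℂ) (q : N) :
    (NormedSpace.exp (t • X) * W) p q = W p q := by
  rw [Matrix.mul_apply]
  simp only [exp_row_eq hp]
  simp [Matrix.one_apply]

lemma hasDerivAt_exp_mul (X W : Matrix N N ℂ) (t : ℝ) :
    HasDerivAt (fun t : ℝ => NormedSpace.exp (t • X) * W) (X * (NormedSpace.exp (t • X) * W)) t := by
  have h1 := (hasDerivAt_exp_smul_const' (𝕂 := ℝ) X t).mul_const W
  rw [mul_assoc] at h1
  exact h1

end IsHaarU
end HaarCore

open MeasureTheory ProbabilityTheory Matrix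
open scoped Matrix ENNReal
set_option linter.unusedSectionVars false

section LinSG
open scoped Matrix.Norms.Frobenius

variable {N : Type} [Fintype N] [DecidableEq N]

/-- real part of the trace as a real linear map -/
noncomputable def reTrL : Matrix N N ℂ →L[ℝ] ℝ :=
  LinearMap.toContinuousLinearMap
    { toFun := fun V => V.trace.re
      map_add' := by intro a b; simp
      map_smul' := by intro a b; simp [Matrix.trace_smul] }

lemma reTrL_apply (V : Matrix N N ℂ) : reTrL V = V.trace.re := rfl

lemma hasDerivAt_reTr {c : ℝ → Matrix N N ℂ} {c' : Matrix N N ℂ} {t : ℝ}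
    (h : HasDerivAt c c' t) (M K : Matrix N N ℂ) :
    HasDerivAt (fun t => (M * c t * K).trace.re) ((M * c' * K).trace.re) t := by
  have h1 := (h.const_mul M).mul_const K
  exact (reTrL (N := N)).hasFDerivAt.comp_hasDerivAt t h1

lemma sg_ibp {ν : Measure (Matrix N N ℂ)} (hν : IsHaarU ν)
    {Y : Matrix N N ℂ → Matrix N N ℂ} (hYc : Continuous Y) (J : Finset N)
    (hYi : ∀ W W', (∀ p ∉ J, ∀ q, W p q = W' p q) → Y W = Y W')
    (s : ℝ) {X : Matrix N N ℂ} (hX : Xᴴ = -X) (hXJ : ∀ p ∉ J, ∀ q, X p q = 0) :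
    ∫ W, (Xᴴ * X * (W * (Y W)ᴴ)).trace.re * Real.exp (s * (W * (Y W)ᴴ).trace.re) ∂ν =
    s * ∫ W, ((Xᴴ * (W * (Y W)ᴴ)).trace.re)^2 * Real.exp (s * (W * (Y W)ᴴ).trace.re) ∂ν := by
  have hc : ∀ M : Matrix N N ℂ, Continuous fun W => (M * (W * (Y W)ᴴ)).trace.re := fun M =>
    Complex.continuous_re.comp (by fun_prop)
  have hc1 : Continuous fun W => (W * (Y W)ᴴ).trace.re :=
    Complex.continuous_re.comp (by fun_prop)
  have h1 := hν.ibp (f := fun W => (Xᴴ * (W * (Y W)ᴴ)).trace.re *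
      Real.exp (s * (W * (Y W)ᴴ).trace.re))
    (g := fun W => (Xᴴ * X * (W * (Y W)ᴴ)).trace.re * Real.exp (s * (W * (Y W)ᴴ).trace.re)
      - s * (((Xᴴ * (W * (Y W)ᴴ)).trace.re)^2 * Real.exp (s * (W * (Y W)ᴴ).trace.re)))
    (by have := hc Xᴴ; fun_prop) (by have := hc Xᴴ; have := hc (Xᴴ * X); fun_prop) hX (by
      intro W hW
      have hY : ∀ t : ℝ, Y (NormedSpace.exp (t • X) * W) = Y W := fun t =>
        hYi _ _ fun p hp q => IsHaarU.exp_mul_row_eq (hXJ p hp) t W q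
      simp only [hY]
      have hd := IsHaarU.hasDerivAt_exp_mul X W 0
      have d1 := hasDerivAt_reTr hd Xᴴ (Y W)ᴴ
      have d2 := hasDerivAt_reTr hd 1 (Y W)ᴴ
      have d3 := d1.mul ((d2.const_mul s).exp)
      simp only [zero_smul, NormedSpace.exp_zero, one_mul] at d3
      refine HasDerivAt.congr_deriv (HasDerivAt.congr_of_eventuallyEq d3
        (Filter.Eventually.of_forall fun t => ?_)) ?_
      · simp [Matrix.mul_assoc]
      · simp only [Matrix.mul_assoc, hX, Matrix.neg_mul, Matrix.trace_neg, Complex.neg_re]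
        ring)
  have i1 : Integrable (fun W => (Xᴴ * X * (W * (Y W)ᴴ)).trace.re *
      Real.exp (s * (W * (Y W)ᴴ).trace.re)) ν :=
    hν.integrable (by have := hc (Xᴴ * X); fun_prop)
  have i2 : Integrable (fun W => s * (((Xᴴ * (W * (Y W)ᴴ)).trace.re)^2 *
      Real.exp (s * (W * (Y W)ᴴ).trace.re))) ν :=
    hν.integrable (by have := hc Xᴴ; fun_prop)
  rw [integral_sub i1 i2, integral_const_mul] at h1
  linarith

lemma sg_pq {ν : Measure (Matrix N N ℂ)} (hν : IsHaarU ν)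
    {Y : Matrix N N ℂ → Matrix N N ℂ} (hYc : Continuous Y) (J : Finset N)
    (hYi : ∀ W W', (∀ p ∉ J, ∀ q, W p q = W' p q) → Y W = Y W')
    (s : ℝ) {p q : N} (hp : p ∈ J) (hq : q ∈ J) :
    ∫ W, (2 * ((W * (Y W)ᴴ) p p).re + 2 * ((W * (Y W)ᴴ) q q).re) *
        Real.exp (s * (W * (Y W)ᴴ).trace.re) ∂ν =
    s * ∫ W, ‖(W * (Y W)ᴴ) p q - star ((W * (Y W)ᴴ) q p)‖^2 *
        Real.exp (s * (W * (Y W)ᴴ).trace.re) ∂ν := by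
  have hc : ∀ M : Matrix N N ℂ, Continuous fun W => (M * (W * (Y W)ᴴ)).trace.re := fun M =>
    Complex.continuous_re.comp (by fun_prop)
  have hc1 : Continuous fun W => (W * (Y W)ᴴ).trace.re :=
    Complex.continuous_re.comp (by fun_prop)
  set E : Matrix N N ℂ := Matrix.single p q 1 with hE
  set F : Matrix N N ℂ := Matrix.single q p 1 with hF
  have hEF : Eᴴ = F := by simp [hE, hF]
  have hFE : Fᴴ = E := by simp [hE, hF]
  have hEz : ∀ r ∉ J, ∀ c, E r c = 0 := by
    intro r hr c
    simp only [hE, Matrix.single_apply]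
    rw [if_neg]; rintro ⟨rfl, -⟩; exact hr hp
  have hFz : ∀ r ∉ J, ∀ c, F r c = 0 := by
    intro r hr c
    simp only [hF, Matrix.single_apply]
    rw [if_neg]; rintro ⟨rfl, -⟩; exact hr hq
  have h1 := sg_ibp hν hYc J hYi s (X := E - F) (by rw [conjTranspose_sub, hEF, hFE]; abel)
    (by intro r hr c; simp [hEz r hr c, hFz r hr c])
  have h2 := sg_ibp hν hYc J hYi s (X := Complex.I • (E + F))
    (by rw [conjTranspose_smul, conjTranspose_add, hEF, hFE]; simp [add_comm])
    (by intro r hr c; simp [hEz r hr c, hFz r hr c])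
  have i1 : ∀ M : Matrix N N ℂ, Integrable (fun W => (M * (W * (Y W)ᴴ)).trace.re *
      Real.exp (s * (W * (Y W)ᴴ).trace.re)) ν := fun M =>
    hν.integrable (by have := hc M; fun_prop)
  have i2 : ∀ M : Matrix N N ℂ, Integrable (fun W => ((M * (W * (Y W)ᴴ)).trace.re)^2 *
      Real.exp (s * (W * (Y W)ᴴ).trace.re)) ν := fun M =>
    hν.integrable (by have := hc M; fun_prop)
  have h3 := congrArg₂ (· + ·) h1 h2
  beta_reduce at h3
  rw [← integral_add (i1 _) (i1 _), ← mul_add, ← integral_add (i2 _) (i2 _)] at h3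
  have hEFm : E * F = Matrix.single p p 1 := by simp [hE, hF]
  have hFEm : F * E = Matrix.single q q 1 := by simp [hE, hF]
  refine Eq.trans (integral_congr_ae (Filter.Eventually.of_forall fun W => ?_)) (h3.trans
    (congrArg (s * ·) (integral_congr_ae (Filter.Eventually.of_forall fun W => ?_))))
  · beta_reduce
    rw [← add_mul, ← Complex.add_re, ← Matrix.trace_add, ← Matrix.add_mul]
    congr 1
    have : (E - F)ᴴ * (E - F) + (Complex.I • (E + F))ᴴ * (Complex.I • (E + F)) =
      (2:ℂ) • (E * F) + (2:ℂ) • (F * E) := by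
      rw [conjTranspose_sub, conjTranspose_smul, conjTranspose_add, hEF, hFE]
      rw [Matrix.smul_mul, Matrix.mul_smul, smul_smul]
      have : star Complex.I * Complex.I = 1 := by simp
      rw [this, one_smul, two_smul, two_smul]
      noncomm_ring
    rw [this, hEFm, hFEm, Matrix.add_mul, Matrix.trace_add, Matrix.smul_mul, Matrix.smul_mul,
      Matrix.trace_smul, Matrix.trace_smul, Matrix.trace_single_mul, Matrix.trace_single_mul]
    simp
  · beta_reduce
    rw [← add_mul]
    congr 1
    rw [conjTranspose_sub, conjTranspose_smul, conjTranspose_add, hEF, hFE, Matrix.sub_mul,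
      Matrix.smul_mul, Matrix.add_mul, Matrix.trace_sub, Matrix.trace_smul, Matrix.trace_add,
      hE, hF, Matrix.trace_single_mul, Matrix.trace_single_mul]
    rw [← Complex.normSq_eq_norm_sq, Complex.normSq_apply]
    simp
    ring

lemma sg_J {ν : Measure (Matrix N N ℂ)} (hν : IsHaarU ν)
    {Y : Matrix N N ℂ → Matrix N N ℂ} (hYc : Continuous Y) (J : Finset N)
    (hYi : ∀ W W', (∀ p ∉ J, ∀ q, W p q = W' p q) → Y W = Y W')
    (hYs : ∀ W, ∀ p ∉ J, ∀ q, Y W p q = 0) (s : ℝ) :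
    4 * J.card * ∫ W, (W * (Y W)ᴴ).trace.re * Real.exp (s * (W * (Y W)ᴴ).trace.re) ∂ν =
    s * ∫ W, (∑ p ∈ J, ∑ q ∈ J, ‖(W * (Y W)ᴴ) p q - star ((W * (Y W)ᴴ) q p)‖^2) *
        Real.exp (s * (W * (Y W)ᴴ).trace.re) ∂ν := by
  have hc1 : Continuous fun W => (W * (Y W)ᴴ).trace.re :=
    Complex.continuous_re.comp (by fun_prop)
  have hcp : ∀ p q, Continuous fun W => (W * (Y W)ᴴ) p q := fun p q => by
    have : Continuous fun W => (W * (Y W)ᴴ) := by fun_prop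
    exact this.matrix_elem p q
  have h := Finset.sum_congr rfl fun p (hp : p ∈ J) => Finset.sum_congr rfl fun q (hq : q ∈ J) =>
    sg_pq hν hYc J hYi s hp hq
  have i1 : ∀ p q, Integrable (fun W => (2 * ((W * (Y W)ᴴ) p p).re + 2 * ((W * (Y W)ᴴ) q q).re) *
        Real.exp (s * (W * (Y W)ᴴ).trace.re)) ν := fun p q => hν.integrable (by
      have := hcp p p
      have := hcp q q
      fun_prop)
  have i2 : ∀ p q, Integrable (fun W => ‖(W * (Y W)ᴴ) p q - star ((W * (Y W)ᴴ) q p)‖^2 *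
        Real.exp (s * (W * (Y W)ᴴ).trace.re)) ν := fun p q => hν.integrable (by
      have := hcp p q
      have := hcp q p
      fun_prop)
  simp only [← Finset.mul_sum] at h
  have e1 : ∀ p, ∑ q ∈ J, ∫ W, (2 * ((W * (Y W)ᴴ) p p).re + 2 * ((W * (Y W)ᴴ) q q).re) *
        Real.exp (s * (W * (Y W)ᴴ).trace.re) ∂ν = ∫ W, ∑ q ∈ J, (2 * ((W * (Y W)ᴴ) p p).re + 2 * ((W * (Y W)ᴴ) q q).re) *
        Real.exp (s * (W * (Y W)ᴴ).trace.re) ∂ν := fun p =>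
    (integral_finsetSum _ fun q _ => i1 p q).symm
  have e2 : ∀ p, ∑ q ∈ J, ∫ W, ‖(W * (Y W)ᴴ) p q - star ((W * (Y W)ᴴ) q p)‖^2 *
        Real.exp (s * (W * (Y W)ᴴ).trace.re) ∂ν = ∫ W, ∑ q ∈ J, ‖(W * (Y W)ᴴ) p q - star ((W * (Y W)ᴴ) q p)‖^2 *
        Real.exp (s * (W * (Y W)ᴴ).trace.re) ∂ν := fun p =>
    (integral_finsetSum _ fun q _ => i2 p q).symm
  simp only [e1, e2] at h
  rw [← integral_finsetSum _ fun p _ => integrable_finsetSum _ fun q _ => i1 p q,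
    ← integral_finsetSum _ fun p _ => integrable_finsetSum _ fun q _ => i2 p q] at h
  rw [← integral_const_mul]
  refine Eq.trans (integral_congr_ae (Filter.Eventually.of_forall fun W => ?_)) (h.trans
    (congrArg (s * ·) (integral_congr_ae (Filter.Eventually.of_forall fun W => ?_))))
  · beta_reduce
    have ht : (W * (Y W)ᴴ).trace.re = ∑ p ∈ J, ((W * (Y W)ᴴ) p p).re := by
      rw [Matrix.trace, Complex.re_sum]
      symm
      apply Finset.sum_subset (Finset.subset_univ _)
      intro p _ hp
      simp [Matrix.mul_apply, hYs W p hp]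
    simp only [← Finset.sum_mul]
    rw [← mul_assoc]
    congr 1
    rw [ht]
    simp only [Finset.sum_add_distrib, Finset.sum_const, nsmul_eq_mul, ← Finset.mul_sum]
    ring
  · simp only [← Finset.sum_mul]
end LinSG

open MeasureTheory ProbabilityTheory Matrix
open scoped Matrix ENNReal
set_option linter.unusedSectionVars false

section LinSG2
open scoped Matrix.Norms.Frobenius

lemma frob_sq {m n : Type} [Fintype m] [Fintype n] (M : Matrix m n ℂ) :
    ‖M‖ ^ 2 = ∑ i, ∑ j, ‖M i j‖ ^ 2 := by
  rw [Matrix.frobenius_norm_def, ← Real.sqrt_eq_rpow, Real.sq_sqrt]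
  · simp
  · positivity

lemma frob_sq_trace {m n : Type} [Fintype m] [Fintype n] (M : Matrix m n ℂ) :
    ‖M‖ ^ 2 = (M * Mᴴ).trace.re := by
  rw [frob_sq, Matrix.trace, Complex.re_sum]
  refine Finset.sum_congr rfl fun i _ => ?_
  rw [Matrix.diag_apply, Matrix.mul_apply, Complex.re_sum]
  refine Finset.sum_congr rfl fun j _ => ?_
  rw [Matrix.conjTranspose_apply, Complex.star_def, Complex.mul_conj, Complex.normSq_eq_norm_sq,
    Complex.ofReal_re]

variable {N : Type} [Fintype N] [DecidableEq N]

lemma frob_unitary_mul {m : Type} [Fintype m] {W : Matrix N N ℂ} (hW : W ∈ Matrix.unitaryGroup N ℂ)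
    (M : Matrix N m ℂ) : ‖W * M‖ = ‖M‖ := by
  have h : ‖W * M‖ ^ 2 = ‖M‖ ^ 2 := by
    rw [frob_sq_trace, frob_sq_trace, conjTranspose_mul, ← Matrix.mul_assoc, Matrix.trace_mul_comm,
      Matrix.mul_assoc W, ← Matrix.mul_assoc, ← star_eq_conjTranspose W,
      (Matrix.mem_unitaryGroup_iff').1 hW, Matrix.one_mul]
  exact (pow_left_inj₀ (norm_nonneg _) (norm_nonneg _) two_ne_zero).1 h

lemma sg_deriv_bound {ν : Measure (Matrix N N ℂ)} (hν : IsHaarU ν)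
    {Y : Matrix N N ℂ → Matrix N N ℂ} (hYc : Continuous Y) (B J : Finset N) (hBJ : B ⊆ J)
    (hYi : ∀ W W', (∀ p ∉ J, ∀ q, W p q = W' p q) → Y W = Y W')
    (hYs : ∀ W, ∀ p ∉ B, ∀ q, Y W p q = 0) {L : ℝ}
    (hL : ∀ W ∈ Matrix.unitaryGroup N ℂ, ‖Y W‖ ≤ L) {s : ℝ} (hs : 0 ≤ s) :
    (2 * J.card - B.card : ℝ) *
      ∫ W, (W * (Y W)ᴴ).trace.re * Real.exp (s * (W * (Y W)ᴴ).trace.re) ∂ν ≤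
    s * (L ^ 2 * ∫ W, Real.exp (s * (W * (Y W)ᴴ).trace.re) ∂ν) := by
  have hYs' : ∀ W, ∀ p ∉ J, ∀ q, Y W p q = 0 := fun W p hp q => hYs W p (fun h => hp (hBJ h)) q
  have hYi' : ∀ W W', (∀ p ∉ B, ∀ q, W p q = W' p q) → Y W = Y W' := fun W W' h =>
    hYi W W' fun p hp q => h p (fun h => hp (hBJ h)) q
  have hJ := sg_J hν hYc J hYi hYs' s
  have hB := sg_J hν hYc B hYi' hYs s
  have hc1 : Continuous fun W => (W * (Y W)ᴴ).trace.re :=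
    Complex.continuous_re.comp (by fun_prop)
  have hcp : ∀ p q, Continuous fun W => (W * (Y W)ᴴ) p q := fun p q => by
    have : Continuous fun W => (W * (Y W)ᴴ) := by fun_prop
    exact this.matrix_elem p q
  have i2 : ∀ J : Finset N, Integrable (fun W => (∑ p ∈ J, ∑ q ∈ J, ‖(W * (Y W)ᴴ) p q - star ((W * (Y W)ᴴ) q p)‖^2) *
        Real.exp (s * (W * (Y W)ᴴ).trace.re)) ν := fun J => hν.integrable (by
      fun_prop)
  have key : 2 * ∫ W, (∑ p ∈ J, ∑ q ∈ J, ‖(W * (Y W)ᴴ) p q - star ((W * (Y W)ᴴ) q p)‖^2) *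
        Real.exp (s * (W * (Y W)ᴴ).trace.re) ∂ν - ∫ W, (∑ p ∈ B, ∑ q ∈ B, ‖(W * (Y W)ᴴ) p q - star ((W * (Y W)ᴴ) q p)‖^2) *
        Real.exp (s * (W * (Y W)ᴴ).trace.re) ∂ν ≤ 4 * L ^ 2 * ∫ W, Real.exp (s * (W * (Y W)ᴴ).trace.re) ∂ν := by
    rw [← integral_const_mul, ← integral_const_mul, ← integral_sub ((i2 J).const_mul 2) (i2 B)]
    refine integral_mono_ae (((i2 J).const_mul 2).sub (i2 B))
      ((hν.integrable (by fun_prop)).const_mul _) ?_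
    filter_upwards [hν.unit] with W hW
    rw [← mul_assoc, ← sub_mul]
    refine mul_le_mul_of_nonneg_right ?_ (Real.exp_pos _).le
    set Z := W * (Y W)ᴴ with hZ
    have hZ0 : ∀ q ∉ B, ∀ p, Z p q = 0 := by
      intro q hq p
      simp [hZ, Matrix.mul_apply, hYs W q hq]
    have hn : ∑ p, ∑ q, ‖Z p q‖^2 ≤ L^2 := by
      rw [← frob_sq, hZ, frob_unitary_mul hW, Matrix.frobenius_norm_conjTranspose]
      exact pow_le_pow_left₀ (norm_nonneg _) (hL W hW) 2
    have hn' : ∑ p, ∑ q, ‖Z q p‖^2 ≤ L^2 := by rw [Finset.sum_comm]; exact hn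
    have ext : ∀ K : Finset N, ∑ p ∈ K, ∑ q ∈ K, ‖Z p q - star (Z q p)‖^2 =
        ∑ p, ∑ q, if p ∈ K ∧ q ∈ K then ‖Z p q - star (Z q p)‖^2 else 0 := by
      intro K
      rw [← Finset.sum_subset (Finset.subset_univ K)]
      · refine Finset.sum_congr rfl fun p hp => ?_
        rw [← Finset.sum_subset (Finset.subset_univ K)]
        · refine Finset.sum_congr rfl fun q hq => ?_
          rw [if_pos ⟨hp, hq⟩]
        · intro q _ hq
          rw [if_neg (fun h => hq h.2)]
      · intro p _ hp
        refine Finset.sum_eq_zero fun q _ => ?_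
        rw [if_neg (fun h => hp h.1)]
    rw [ext J, ext B]
    have hpt : ∀ p q, 2 * (if p ∈ J ∧ q ∈ J then ‖Z p q - star (Z q p)‖^2 else 0) -
        (if p ∈ B ∧ q ∈ B then ‖Z p q - star (Z q p)‖^2 else 0) ≤ 2 * ‖Z p q‖^2 + 2 * ‖Z q p‖^2 := by
      intro p q
      have tri : ‖Z p q - star (Z q p)‖^2 ≤ 2 * ‖Z p q‖^2 + 2 * ‖Z q p‖^2 := by
        have h1 : ‖Z p q - star (Z q p)‖ ≤ ‖Z p q‖ + ‖Z q p‖ := by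
          have := norm_sub_le (Z p q) (star (Z q p))
          rwa [norm_star] at this
        have h2 := norm_nonneg (Z p q - star (Z q p))
        nlinarith [sq_nonneg (‖Z p q‖ - ‖Z q p‖), norm_nonneg (Z p q), norm_nonneg (Z q p)]
      by_cases hp : p ∈ B <;> by_cases hq : q ∈ B
      · simp only [hp, hq, hBJ hp, hBJ hq, and_self, if_true]
        linarith
      · simp only [hp, hq, hZ0 q hq, and_false, if_false, zero_sub, norm_neg, norm_star, norm_zero]
        split_ifs <;> nlinarith [norm_nonneg (Z q p)]
      · simp only [hp, hq, hZ0 p hp, false_and, if_false, star_zero, sub_zero, norm_zero]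
        split_ifs <;> nlinarith [norm_nonneg (Z p q)]
      · simp only [hp, hq, hZ0 p hp, hZ0 q hq, false_and, if_false, star_zero, sub_zero, norm_zero]
        split_ifs <;> norm_num
    have := Finset.sum_le_sum fun p (_ : p ∈ Finset.univ) => Finset.sum_le_sum fun q (_ : q ∈ Finset.univ) => hpt p q
    simp only [Finset.sum_sub_distrib, Finset.sum_add_distrib, ← Finset.mul_sum] at this
    linarith
  have := mul_le_mul_of_nonneg_left key hs
  nlinarith [this, hJ, hB]

lemma sg_mgf {ν : Measure (Matrix N N ℂ)} (hν : IsHaarU ν)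
    {Y : Matrix N N ℂ → Matrix N N ℂ} (hYc : Continuous Y) (B J : Finset N) (hBJ : B ⊆ J)
    (hcard : (0:ℝ) < 2 * J.card - B.card)
    (hYi : ∀ W W', (∀ p ∉ J, ∀ q, W p q = W' p q) → Y W = Y W')
    (hYs : ∀ W, ∀ p ∉ B, ∀ q, Y W p q = 0) {L : ℝ}
    (hL : ∀ W ∈ Matrix.unitaryGroup N ℂ, ‖Y W‖ ≤ L) {s : ℝ} (hs : 0 ≤ s) :
    ∫ W, Real.exp (s * (W * (Y W)ᴴ).trace.re) ∂ν ≤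
      Real.exp (s ^ 2 * (L ^ 2 / (2 * (2 * J.card - B.card)))) := by
  have := hν.prob
  set c : ℝ := L ^ 2 / (2 * J.card - B.card) with hc
  set f : Matrix N N ℂ → ℝ := fun W => (W * (Y W)ᴴ).trace.re with hf
  have hfc : Continuous f := Complex.continuous_re.comp (by fun_prop)
  have hset : ∀ t : ℝ, t ∈ interior (integrableExpSet f ν) := by
    have : integrableExpSet f ν = Set.univ := by
      ext t; simp only [integrableExpSet, Set.mem_ofPred_eq, Set.mem_univ, iff_true]
      exact hν.integrable (by fun_prop)
    simp [this]
  have hd : ∀ t : ℝ, HasDerivAt (fun t => mgf f ν t * Real.exp (-(c * t ^ 2 / 2)))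
      ((∫ W, f W * Real.exp (t * f W) ∂ν) * Real.exp (-(c * t ^ 2 / 2)) +
        mgf f ν t * (Real.exp (-(c * t ^ 2 / 2)) * (-(c * t)))) t := by
    intro t
    have h1 := hasDerivAt_mgf (hset t)
    have h2 : HasDerivAt (fun t : ℝ => -(c * t ^ 2 / 2)) (-(c * t)) t := by
      have := (((hasDerivAt_pow 2 t).const_mul c).div_const 2).neg
      refine this.congr_deriv ?_
      simp; ring
    exact h1.mul h2.exp
  have hanti : AntitoneOn (fun t => mgf f ν t * Real.exp (-(c * t ^ 2 / 2))) (Set.Ici 0) := by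
    refine antitoneOn_of_deriv_nonpos (convex_Ici 0)
      (fun t _ => (hd t).continuousAt.continuousWithinAt)
      (fun t _ => (hd t).differentiableAt.differentiableWithinAt) ?_
    intro t ht
    rw [interior_Ici, Set.mem_Ioi] at ht
    rw [(hd t).deriv]
    have h3 := sg_deriv_bound hν hYc B J hBJ hYi hYs hL ht.le
    have h4 : ∫ W, f W * Real.exp (t * f W) ∂ν ≤ c * t * mgf f ν t := by
      rw [mgf, hc, div_mul_eq_mul_div, div_mul_eq_mul_div, le_div_iff₀ hcard]
      calc _ = _ := mul_comm _ _
        _ ≤ _ := h3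
        _ = _ := by ring
    have h5 : 0 < Real.exp (-(c * t ^ 2 / 2)) := Real.exp_pos _
    nlinarith
  have h0 := hanti (Set.mem_Ici.2 le_rfl) (Set.mem_Ici.2 hs) hs
  simp only [mgf_zero] at h0
  have h6 : mgf f ν s * Real.exp (-(c * s ^ 2 / 2)) ≤ 1 := by simpa using h0
  have h7 : mgf f ν s ≤ Real.exp (c * s ^ 2 / 2) := by
    rw [Real.exp_neg] at h6
    rwa [mul_inv_le_iff₀ (Real.exp_pos _), one_mul] at h6
  have h8 : s ^ 2 * (L ^ 2 / (2 * (2 * J.card - B.card))) = c * s ^ 2 / 2 := by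
    rw [hc]; field_simp
  rw [h8]; exact h7
end LinSG2

open MeasureTheory ProbabilityTheory Matrix
open scoped Matrix ENNReal
set_option linter.unusedSectionVars false

section Path
open scoped Matrix.Norms.Frobenius

variable {N κ : Type} [Fintype N] [DecidableEq N] [Fintype κ] [DecidableEq κ]

/-- selection matrix: `(selM a * W)` is the matrix of rows `a i` of `W`. -/
def selM (a : κ → N) : Matrix κ N ℂ := Matrix.of fun i p => if p = a i then 1 else 0

lemma selM_mul (a : κ → N) (W : Matrix N N ℂ) : selM a * W = W.submatrix a id := by
  ext i j
  simp [selM, Matrix.mul_apply]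

lemma selM_mul_selMT {a : κ → N} (ha : Function.Injective a) : selM a * (selM a)ᴴ = 1 := by
  ext i j
  simp [selM, Matrix.mul_apply, Matrix.one_apply, ha.eq_iff, eq_comm]

lemma selM_mul_selMT' {a b : κ → N} (hab : ∀ i j, a i ≠ b j) : selM a * (selM b)ᴴ = 0 := by
  ext i j
  simp [selM, Matrix.mul_apply, (hab i j).symm]

/-- gradient matrix of a real functional -/
noncomputable def gradM (l : Matrix κ N ℂ →L[ℝ] ℝ) : Matrix κ N ℂ :=
  Matrix.of fun i j => ⟨l (Matrix.single i j 1), l (Matrix.single i j Complex.I)⟩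

lemma gradM_spec (l : Matrix κ N ℂ →L[ℝ] ℝ) (M : Matrix κ N ℂ) :
    l M = (M * (gradM l)ᴴ).trace.re := by
  conv_lhs => rw [Matrix.matrix_eq_sum_single M]
  rw [map_sum, Matrix.trace, Complex.re_sum]
  refine Finset.sum_congr rfl fun i _ => ?_
  rw [map_sum, Matrix.diag_apply, Matrix.mul_apply, Complex.re_sum]
  refine Finset.sum_congr rfl fun j _ => ?_
  have : Matrix.single i j (M i j) = (M i j).re • Matrix.single i j (1:ℂ) +
      (M i j).im • Matrix.single i j Complex.I := by
    rw [Matrix.smul_single, Matrix.smul_single, ← Matrix.single_add]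
    congr 1
    apply Complex.ext <;> simp
  rw [this, map_add, map_smul, map_smul]
  simp [gradM]

lemma gradM_norm {l : Matrix κ N ℂ →L[ℝ] ℝ} {L : ℝ} (hl : ∀ M, |l M| ≤ L * ‖M‖) (hL : 0 ≤ L) :
    ‖gradM l‖ ≤ L := by
  have h1 := gradM_spec l (gradM l)
  rw [← frob_sq_trace] at h1
  have h2 := hl (gradM l)
  rw [h1, abs_of_nonneg (sq_nonneg _)] at h2
  by_contra h
  push Not at h
  nlinarith

/-- rotation generator -/
def rotX (a b : κ → N) : Matrix N N ℂ :=
  (selM a)ᴴ * selM b - (selM b)ᴴ * selM a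

lemma rotX_skew (a b : κ → N) : (rotX a b)ᴴ = - rotX a b := by
  simp [rotX, conjTranspose_mul]

variable {a b : κ → N}

lemma selM_a_rotX (ha : Function.Injective a) (hab : ∀ i j, a i ≠ b j) :
    selM a * rotX a b = selM b := by
  rw [rotX, Matrix.mul_sub, ← Matrix.mul_assoc, ← Matrix.mul_assoc, selM_mul_selMT ha,
    selM_mul_selMT' hab]
  simp

lemma selM_b_rotX (hb : Function.Injective b) (hab : ∀ i j, a i ≠ b j) :
    selM b * rotX a b = - selM a := by
  rw [rotX, Matrix.mul_sub, ← Matrix.mul_assoc, ← Matrix.mul_assoc, selM_mul_selMT hb,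
    selM_mul_selMT' (fun i j => (hab j i).symm)]
  simp

lemma rot_end (ha : Function.Injective a) (hb : Function.Injective b) (hab : ∀ i j, a i ≠ b j)
    (W : Matrix N N ℂ) :
    selM a * (NormedSpace.exp ((Real.pi / 2) • rotX a b) * W) = selM b * W := by
  set S : ℝ → Matrix N N ℂ := fun t => NormedSpace.exp (t • rotX a b) * W with hS
  have hd : ∀ t, HasDerivAt S (rotX a b * S t) t := fun t => IsHaarU.hasDerivAt_exp_mul _ _ t
  ext i j
  have ht : ∀ (M : Matrix κ N ℂ) t, HasDerivAt (fun t => (M * S t) i j) ((M * (rotX a b * S t)) i j) t := by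
    intro M t
    have hl : ∀ V : Matrix N N ℂ, (M * V) i j = ∑ p, M i p * V p j := fun V => Matrix.mul_apply
    simp only [hl]
    refine HasDerivAt.fun_sum fun p _ => HasDerivAt.const_mul _ ?_
    exact ((Matrix.entryLinearMap ℝ ℂ p j).toContinuousLinearMap.hasFDerivAt.comp_hasDerivAt t (hd t))
  have hA := ht (selM a)
  have hB := ht (selM b)
  simp only [← Matrix.mul_assoc, selM_a_rotX ha hab, selM_b_rotX hb hab] at hA hB
  have hU : ∀ t : ℝ, HasDerivAt (fun t : ℝ => (Real.sin t) • (selM a * S t) i j + (Real.cos t) • (selM b * S t) i j)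
      0 t := by
    intro t
    have h1 := (Real.hasDerivAt_sin t).smul (hA t)
    have h2 := (Real.hasDerivAt_cos t).smul (hB t)
    refine (h1.add h2).congr_deriv ?_
    simp [Matrix.neg_mul]
  have := is_const_of_deriv_eq_zero (fun s => (hU s).differentiableAt) (fun s => (hU s).deriv)
    (Real.pi / 2) 0
  simpa [hS] using this

lemma cont_exp_mul {X : Matrix N N ℂ} :
    Continuous fun p : ℝ × Matrix N N ℂ => NormedSpace.exp (p.1 • X) * p.2 := by
  have h1 : Continuous fun t : ℝ => NormedSpace.exp (t • X) :=
    continuous_iff_continuousAt.2 fun t => (hasDerivAt_exp_smul_const' (𝕂 := ℝ) X t).continuousAt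
  exact (h1.comp continuous_fst).mul continuous_snd

/-- joint integrability against a Haar measure on the second factor -/
lemma IsHaarU.integrable_prod {ν : Measure (Matrix N N ℂ)} (hν : IsHaarU ν)
    {f : ℝ × Matrix N N ℂ → ℝ} (hf : Continuous f) :
    Integrable f ((volume.restrict (Set.Ioc (0:ℝ) 1)).prod ν) := by
  have := hν.prob
  have hK : IsCompact (Set.Icc (0:ℝ) 1 ×ˢ (Matrix.unitaryGroup N ℂ : Set (Matrix N N ℂ))) :=
    isCompact_Icc.prod isCompact_unitaryGroup
  obtain ⟨M, hM⟩ := hK.exists_bound_of_continuousOn hf.continuousOn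
  refine Integrable.of_bound hf.aestronglyMeasurable M ?_
  have h1 : ∀ᵐ p ∂((volume.restrict (Set.Ioc (0:ℝ) 1)).prod ν), p.1 ∈ Set.Ioc (0:ℝ) 1 :=
    Measure.quasiMeasurePreserving_fst.ae (ae_restrict_mem measurableSet_Ioc)
  have h2 : ∀ᵐ p ∂((volume.restrict (Set.Ioc (0:ℝ) 1)).prod ν), p.2 ∈ Matrix.unitaryGroup N ℂ :=
    Measure.quasiMeasurePreserving_snd.ae hν.unit
  filter_upwards [h1, h2] with p hp1 hp2
  exact hM p ⟨⟨hp1.1.le, hp1.2⟩, hp2⟩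

lemma path_mgf {ν : Measure (Matrix N N ℂ)} (hν : IsHaarU ν)
    {F : Matrix κ N ℂ → ℝ} (hF : ContDiff ℝ 1 F) {L : ℝ} (hL0 : 0 ≤ L)
    (hL : ∀ V M, |fderiv ℝ F V M| ≤ L * ‖M‖)
    (ha : Function.Injective a) (hb : Function.Injective b) (hab : ∀ i j, a i ≠ b j)
    (hcard : (0:ℝ) < 2 * Fintype.card N - 3 * Fintype.card κ) {s : ℝ} (hs : 0 ≤ s) :
    ∫ W, Real.exp (s * (F (selM b * W) - F (selM a * W))) ∂ν ≤
      Real.exp (s ^ 2 * (Real.pi ^ 2 * L ^ 2 / (8 * (2 * Fintype.card N - 3 * Fintype.card κ)))) := by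
  have := hν.prob
  have hF1 : Continuous (fderiv ℝ F) := hF.continuous_fderiv one_ne_zero
  set Y : Matrix N N ℂ → Matrix N N ℂ := fun W => (selM b)ᴴ * gradM (fderiv ℝ F (selM a * W)) with hY
  set X := rotX a b with hX
  -- the directional derivative
  set f : Matrix N N ℂ → ℝ := fun W => (W * (Y W)ᴴ).trace.re with hf
  have hfd : ∀ W, f W = fderiv ℝ F (selM a * W) (selM b * W) := by
    intro W
    rw [gradM_spec, hf]
    simp only [hY, conjTranspose_mul, conjTranspose_conjTranspose]
    rw [← Matrix.mul_assoc, Matrix.trace_mul_comm, Matrix.mul_assoc]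
  have hYc : Continuous Y := by
    have h1 : Continuous fun W : Matrix N N ℂ => gradM (fderiv ℝ F (selM a * W)) := by
      refine continuous_matrix fun i j => ?_
      have h2 : ∀ M : Matrix κ N ℂ, Continuous fun W : Matrix N N ℂ => fderiv ℝ F (selM a * W) M := by
        intro M
        exact (hF1.comp (by fun_prop : Continuous fun W : Matrix N N ℂ => selM a * W)).clm_apply continuous_const
      have h3 : (fun W : Matrix N N ℂ => gradM (fderiv ℝ F (selM a * W)) i j) = fun W =>
        ((fderiv ℝ F (selM a * W) (Matrix.single i j 1) : ℝ) : ℂ) +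
        ((fderiv ℝ F (selM a * W) (Matrix.single i j Complex.I) : ℝ) : ℂ) * Complex.I := by
        funext W
        apply Complex.ext <;> simp [gradM]
      rw [h3]
      exact (Complex.continuous_ofReal.comp (h2 _)).add
        ((Complex.continuous_ofReal.comp (h2 _)).mul continuous_const)
    exact continuous_const.matrix_mul h1
  have hfc : Continuous f := Complex.continuous_re.comp (by fun_prop)
  have hYnorm : ∀ W ∈ Matrix.unitaryGroup N ℂ, ‖Y W‖ ≤ L := by
    intro W _
    have h1 : ‖Y W‖ ^ 2 = ‖gradM (fderiv ℝ F (selM a * W))‖ ^ 2 := by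
      rw [frob_sq_trace, frob_sq_trace, hY]
      simp only [conjTranspose_mul, conjTranspose_conjTranspose]
      rw [Matrix.mul_assoc, Matrix.trace_mul_comm, Matrix.mul_assoc, Matrix.mul_assoc,
        selM_mul_selMT hb, Matrix.mul_one]
    rw [(pow_left_inj₀ (norm_nonneg _) (norm_nonneg _) two_ne_zero).1 h1]
    exact gradM_norm (hL _) hL0
  set B : Finset N := Finset.univ.image b
  set J : Finset N := (Finset.univ.image a)ᶜ
  have hBJ : B ⊆ J := by
    intro p hp
    simp only [B, Finset.mem_image, Finset.mem_univ, true_and] at hp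
    obtain ⟨i, rfl⟩ := hp
    simp [J, hab]
  have hBc : B.card = Fintype.card κ := by
    rw [Finset.card_image_of_injective _ hb]; rfl
  have hAc : (Finset.univ.image a).card = Fintype.card κ := by
    rw [Finset.card_image_of_injective _ ha]; rfl
  have hJc : (J.card : ℝ) = Fintype.card N - Fintype.card κ := by
    rw [Finset.card_compl, hAc, Nat.cast_sub]
    rw [← hAc]; exact Finset.card_le_univ _
  have hmgf : ∀ {s : ℝ}, 0 ≤ s → ∫ W, Real.exp (s * f W) ∂ν ≤
      Real.exp (s ^ 2 * (L ^ 2 / (2 * (2 * Fintype.card N - 3 * Fintype.card κ)))) := by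
    intro s hs
    have h1 := sg_mgf hν hYc B J hBJ (by rw [hJc, hBc]; linarith) (by
      intro W W' h
      have : selM a * W = selM a * W' := by
        rw [selM_mul, selM_mul]
        ext i j
        exact h (a i) (by simp [J]) j
      simp only [hY, this]) (by
      intro W p hp q
      rw [hY]
      simp only [Matrix.mul_apply]
      refine Finset.sum_eq_zero fun i _ => ?_
      have : (selM b)ᴴ p i = 0 := by
        simp only [selM, conjTranspose_apply, Matrix.of_apply]
        rw [if_neg, star_zero]
        rintro rfl
        exact hp (by simp [B])
      rw [this, zero_mul]) hYnorm hs
    rw [hJc, hBc] at h1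
    refine h1.trans (le_of_eq ?_)
    congr 4
    ring
  -- path
  set c : ℝ := Real.pi / 2 with hc
  set S : ℝ → Matrix N N ℂ → Matrix N N ℂ := fun u W => NormedSpace.exp ((u * c) • X) * W with hS
  have hSm : ∀ u, NormedSpace.exp ((u * c) • X) ∈ Matrix.unitaryGroup N ℂ := fun u =>
    IsHaarU.exp_smul_mem (rotX_skew a b) _
  have hScont : Continuous fun p : ℝ × Matrix N N ℂ => S p.1 p.2 := by
    exact cont_exp_mul.comp (by fun_prop : Continuous fun p : ℝ × Matrix N N ℂ => (p.1 * c, p.2))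
  have hder : ∀ W u, HasDerivAt (fun u => F (selM a * S u W)) (c * f (S u W)) u := by
    intro W u
    have h1 : HasDerivAt (fun u : ℝ => S u W) (c • (X * S u W)) u := by
      have h2 := IsHaarU.hasDerivAt_exp_mul X W (u * c)
      have h3 : HasDerivAt (fun u : ℝ => u * c) c u := hasDerivAt_mul_const c
      exact h2.scomp u h3
    have hlin : HasDerivAt (fun u : ℝ => selM a * S u W) (selM a * (c • (X * S u W))) u := by
      let l : Matrix N N ℂ →L[ℝ] Matrix κ N ℂ := LinearMap.toContinuousLinearMap
        { toFun := fun V => selM a * V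
          map_add' := fun x y => Matrix.mul_add _ _ _
          map_smul' := fun r x => by simp }
      exact l.hasFDerivAt.comp_hasDerivAt u h1
    have h4 := ((hF.differentiable one_ne_zero) (selM a * S u W)).hasFDerivAt.comp_hasDerivAt u hlin
    refine h4.congr_deriv ?_
    have h5 : selM a * (c • (X * S u W)) = c • (selM b * S u W) := by
      rw [Matrix.mul_smul, ← Matrix.mul_assoc, hX, selM_a_rotX ha hab]
    rw [hfd, h5, map_smul, smul_eq_mul]
    rfl
  have hftc : ∀ W, F (selM b * W) - F (selM a * W) = ∫ u in Set.Ioc (0:ℝ) 1, c * f (S u W) := by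
    intro W
    have hcont : Continuous fun u => c * f (S u W) :=
      continuous_const.mul (hfc.comp (hScont.comp (by fun_prop : Continuous fun u : ℝ => (u, W))))
    have h1 := intervalIntegral.integral_eq_sub_of_hasDerivAt (a := 0) (b := 1)
      (fun u _ => hder W u) (hcont.intervalIntegrable _ _)
    rw [intervalIntegral.integral_of_le zero_le_one] at h1
    rw [h1]
    congr 2
    · simp only [hS, one_mul]
      exact (rot_end ha hb hab W).symm
    · simp [hS]
  have hprob : IsProbabilityMeasure (volume.restrict (Set.Ioc (0:ℝ) 1)) := ⟨by simp⟩
  have hjc : Continuous fun p : ℝ × Matrix N N ℂ => Real.exp (s * (c * f (S p.1 p.2))) := by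
    have := hfc.comp hScont
    simp only [Function.comp_def] at this
    fun_prop
  have hjen : ∀ W ∈ Matrix.unitaryGroup N ℂ, Real.exp (s * (F (selM b * W) - F (selM a * W))) ≤
      ∫ u in Set.Ioc (0:ℝ) 1, Real.exp (s * (c * f (S u W))) := by
    intro W _
    rw [hftc, ← integral_const_mul]
    have hcont : Continuous fun u => s * (c * f (S u W)) :=
      continuous_const.mul (continuous_const.mul (hfc.comp (hScont.comp (by fun_prop : Continuous fun u : ℝ => (u, W)))))
    refine (convexOn_exp).map_integral_le Real.continuous_exp.continuousOn isClosed_univ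
      (by simp) ?_ ?_
    · exact (hcont.integrableOn_Icc).mono_set Set.Ioc_subset_Icc_self
    · exact ((Real.continuous_exp.comp hcont).integrableOn_Icc).mono_set Set.Ioc_subset_Icc_self
  have hFc := hF.continuous
  calc ∫ W, Real.exp (s * (F (selM b * W) - F (selM a * W))) ∂ν
      ≤ ∫ W, (∫ u in Set.Ioc (0:ℝ) 1, Real.exp (s * (c * f (S u W)))) ∂ν := by
        refine integral_mono_ae (hν.integrable (by fun_prop)) ?_ ?_
        · exact (hν.integrable_prod hjc).integral_prod_right
        · filter_upwards [hν.unit] with W hW using hjen W hW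
    _ = ∫ u in Set.Ioc (0:ℝ) 1, (∫ W, Real.exp (s * (c * f (S u W))) ∂ν) :=
        (integral_integral_swap (f := fun u W => Real.exp (s * (c * f (S u W)))) (hν.integrable_prod hjc)).symm
    _ = ∫ u in Set.Ioc (0:ℝ) 1, (∫ W, Real.exp ((s * c) * f W) ∂ν) := by
        refine integral_congr_ae (Filter.Eventually.of_forall fun u => ?_)
        have := hν.integral_mul_left (f := fun W => Real.exp ((s * c) * f W)) (by fun_prop) (hSm u)
        simp only [mul_assoc] at this ⊢
        exact this
    _ = ∫ W, Real.exp ((s * c) * f W) ∂ν := by simp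
    _ ≤ _ := hmgf (by positivity)
    _ = _ := by
        congr 1
        rw [hc]
        field_simp
        ring
end Path

open MeasureTheory ProbabilityTheory Matrix
open scoped Matrix ENNReal
set_option linter.unusedSectionVars false

section Conc
open scoped Matrix.Norms.Frobenius

variable {N κ : Type} [Fintype N] [DecidableEq N] [Fintype κ] [DecidableEq κ]

lemma inner_row {m m' : Type} (V : Matrix m N ℂ) (V' : Matrix m' N ℂ) (i : m) (j : m') :
    inner ℂ (WithLp.toLp 2 (V i) : EuclideanSpace ℂ N) (WithLp.toLp 2 (V' j)) = (V' * Vᴴ) j i := by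
  simp [PiLp.inner_apply, Matrix.mul_apply]

/-- completion of a partial family of orthonormal rows to a unitary matrix -/
lemma exists_unitary_rows {V1 V2 : Matrix κ N ℂ} (h1 : V1 * V1ᴴ = 1) (h2 : V2 * V2ᴴ = 1)
    (h12 : V1 * V2ᴴ = 0) {a b : κ → N} (ha : Function.Injective a) (hb : Function.Injective b)
    (hab : ∀ i j, a i ≠ b j) :
    ∃ R ∈ Matrix.unitaryGroup N ℂ, selM a * R = V1 ∧ selM b * R = V2 := by
  classical
  have h21 : V2 * V1ᴴ = 0 := by
    have := congrArg conjTranspose h12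
    simpa [conjTranspose_mul] using this
  let v : N → EuclideanSpace ℂ N := fun p =>
    if h : ∃ i, a i = p then WithLp.toLp 2 (V1 h.choose)
    else if h : ∃ i, b i = p then WithLp.toLp 2 (V2 h.choose) else 0
  have va : ∀ i, v (a i) = WithLp.toLp 2 (V1 i) := by
    intro i
    have h : ∃ j, a j = a i := ⟨i, rfl⟩
    simp only [v, dif_pos h, ha h.choose_spec]
  have vb : ∀ i, v (b i) = WithLp.toLp 2 (V2 i) := by
    intro i
    have h : ∃ j, b j = b i := ⟨i, rfl⟩
    have h' : ¬ ∃ j, a j = b i := fun ⟨j, hj⟩ => hab j i hj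
    simp only [v, dif_neg h', dif_pos h, hb h.choose_spec]
  have hv : Orthonormal ℂ ((Set.range a ∪ Set.range b).domRestrict v) := by
    rw [orthonormal_iff_ite]
    rintro ⟨p, hp⟩ ⟨q, hq⟩
    simp only [Set.domRestrict_apply, Subtype.mk.injEq]
    change inner ℂ (v p) (v q) = if p = q then 1 else 0
    rcases hp with ⟨i, rfl⟩ | ⟨i, rfl⟩ <;> rcases hq with ⟨j, rfl⟩ | ⟨j, rfl⟩
    · rw [va, va, inner_row, h1, Matrix.one_apply]; simp [ha.eq_iff, eq_comm]
    · rw [va, vb, inner_row, h21]; simp [hab i j]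
    · rw [vb, va, inner_row, h12]; simp [(hab j i).symm]
    · rw [vb, vb, inner_row, h2, Matrix.one_apply]; simp [hb.eq_iff, eq_comm]
  obtain ⟨w, hw⟩ := hv.exists_orthonormalBasis_extension_of_card_eq (by simp)
  refine ⟨Matrix.of fun p q => w p q, ?_, ?_, ?_⟩
  · rw [Matrix.mem_unitaryGroup_iff]
    ext p q
    have := (orthonormal_iff_ite.1 w.orthonormal) q p
    rw [Matrix.one_apply, star_eq_conjTranspose, ← inner_row]
    refine Eq.trans this ?_
    simp [eq_comm]
  · rw [selM_mul]; ext i j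
    have := hw (a i) (Or.inl ⟨i, rfl⟩)
    simp [this, va]
  · rw [selM_mul]; ext i j
    have := hw (b i) (Or.inr ⟨i, rfl⟩)
    simp [this, vb]

lemma exists_orth_rows (V1 V2 : Matrix κ N ℂ) (hc : 3 * Fintype.card κ ≤ Fintype.card N) :
    ∃ V3 : Matrix κ N ℂ, V3 * V3ᴴ = 1 ∧ V3 * V1ᴴ = 0 ∧ V3 * V2ᴴ = 0 := by
  classical
  let u : κ ⊕ κ → EuclideanSpace ℂ N := Sum.elim (fun i => WithLp.toLp 2 (V1 i)) (fun i => WithLp.toLp 2 (V2 i))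
  let E := Submodule.span ℂ (Set.range u)
  have hE : Module.finrank ℂ E ≤ 2 * Fintype.card κ := by
    have := finrank_range_le_card (R := ℂ) u
    simp only [Fintype.card_sum] at this
    simp only [Set.finrank] at this
    change Module.finrank ℂ (Submodule.span ℂ (Set.range u)) ≤ _
    omega
  have hE2 : Fintype.card κ ≤ Module.finrank ℂ Eᗮ := by
    have := Submodule.finrank_add_finrank_orthogonal E
    rw [finrank_euclideanSpace] at this
    omega
  let bb := stdOrthonormalBasis ℂ Eᗮ
  let e : κ → Fin (Module.finrank ℂ Eᗮ) := fun i => Fin.castLE hE2 (Fintype.equivFin κ i)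
  have he : Function.Injective e := fun i j h => by
    have := Fin.castLE_injective hE2 h
    exact (Fintype.equivFin κ).injective this
  refine ⟨Matrix.of fun i q => (bb (e i) : EuclideanSpace ℂ N) q, ?_, ?_, ?_⟩
  · ext i j
    rw [← inner_row]
    have := (orthonormal_iff_ite.1 bb.orthonormal) (e j) (e i)
    rw [Submodule.coe_inner] at this
    refine Eq.trans this ?_
    simp [he.eq_iff, Matrix.one_apply, eq_comm]
  · ext i j
    rw [← inner_row]
    have h1 : u (Sum.inl j) ∈ E := Submodule.subset_span ⟨_, rfl⟩
    exact Submodule.inner_right_of_mem_orthogonal h1 (bb (e i)).2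
  · ext i j
    rw [← inner_row]
    have h1 : u (Sum.inr j) ∈ E := Submodule.subset_span ⟨_, rfl⟩
    exact Submodule.inner_right_of_mem_orthogonal h1 (bb (e i)).2

lemma exists_disjoint_emb {a : κ → N} (ha : Function.Injective a)
    (hc : 3 * Fintype.card κ ≤ Fintype.card N) :
    ∃ b : κ → N, Function.Injective b ∧ ∀ i j, a i ≠ b j := by
  classical
  have h1 : Fintype.card κ ≤ Fintype.card ((Finset.univ.image a)ᶜ : Finset N) := by
    rw [Fintype.card_coe, Finset.card_compl, Finset.card_image_of_injective _ ha, Finset.card_univ]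
    omega
  obtain ⟨f⟩ := Function.Embedding.nonempty_of_card_le h1
  refine ⟨fun i => (f i).1, fun i j h => f.injective (Subtype.ext h), fun i j h => ?_⟩
  have := (f j).2
  simp only [Finset.mem_compl, Finset.mem_image, Finset.mem_univ, true_and, not_exists] at this
  exact this i h

lemma orth_mgf {ν : Measure (Matrix N N ℂ)} (hν : IsHaarU ν)
    {F : Matrix κ N ℂ → ℝ} (hF : ContDiff ℝ 1 F) {L : ℝ} (hL0 : 0 ≤ L)
    (hL : ∀ V M, |fderiv ℝ F V M| ≤ L * ‖M‖) {a : κ → N} (ha : Function.Injective a)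
    (hc : 3 * Fintype.card κ ≤ Fintype.card N)
    (hcard : (0:ℝ) < 2 * Fintype.card N - 3 * Fintype.card κ) {s : ℝ} (hs : 0 ≤ s)
    {V1 V2 : Matrix κ N ℂ} (h1 : V1 * V1ᴴ = 1) (h2 : V2 * V2ᴴ = 1) (h12 : V1 * V2ᴴ = 0) :
    ∫ W, Real.exp (s * (F (V2 * W) - F (V1 * W))) ∂ν ≤
      Real.exp (s ^ 2 * (Real.pi ^ 2 * L ^ 2 / (8 * (2 * Fintype.card N - 3 * Fintype.card κ)))) := by
  obtain ⟨b, hb, hab⟩ := exists_disjoint_emb ha hc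
  obtain ⟨R, hR, hRa, hRb⟩ := exists_unitary_rows h1 h2 h12 ha hb hab
  have hFc := hF.continuous
  have h := hν.integral_mul_left (f := fun W => Real.exp (s * (F (selM b * W) - F (selM a * W))))
    (by fun_prop) hR
  simp only [← Matrix.mul_assoc, hRa, hRb] at h
  rw [h]
  exact path_mgf hν hF hL0 hL ha hb hab hcard hs

lemma two_mgf {ν : Measure (Matrix N N ℂ)} (hν : IsHaarU ν)
    {F : Matrix κ N ℂ → ℝ} (hF : ContDiff ℝ 1 F) {L : ℝ} (hL0 : 0 ≤ L)
    (hL : ∀ V M, |fderiv ℝ F V M| ≤ L * ‖M‖) {a : κ → N} (ha : Function.Injective a)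
    (hc : 9 * Fintype.card κ ≤ Fintype.card N) (hpos : 0 < Fintype.card N) {s : ℝ} (hs : 0 ≤ s)
    {V1 V2 : Matrix κ N ℂ} (h1 : V1 * V1ᴴ = 1) (h2 : V2 * V2ᴴ = 1) :
    ∫ W, Real.exp (s * (F (V1 * W) - F (V2 * W))) ∂ν ≤
      Real.exp (3 * s ^ 2 * L ^ 2 / Fintype.card N) := by
  have hcR : (9:ℝ) * Fintype.card κ ≤ Fintype.card N := by exact_mod_cast hc
  have hposR : (0:ℝ) < Fintype.card N := by exact_mod_cast hpos
  have hcard : (0:ℝ) < 2 * Fintype.card N - 3 * Fintype.card κ := by linarith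
  obtain ⟨V3, h3, h31, h32⟩ := exists_orth_rows V1 V2 (by omega)
  have h23 : V2 * V3ᴴ = 0 := by
    have := congrArg conjTranspose h32
    simpa [conjTranspose_mul] using this
  have hs2 : 0 ≤ 2 * s := by linarith
  have e1 := orth_mgf hν hF hL0 hL ha (by omega) hcard hs2 h3 h1 h31
  have e2 := orth_mgf hν hF hL0 hL ha (by omega) hcard hs2 h2 h3 h23
  have hFc := hF.continuous
  have i1 : Integrable (fun W => Real.exp (2 * s * (F (V1 * W) - F (V3 * W)))) ν :=
    hν.integrable (by fun_prop)
  have i2 : Integrable (fun W => Real.exp (2 * s * (F (V3 * W) - F (V2 * W)))) ν :=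
    hν.integrable (by fun_prop)
  have hm : ∫ W, Real.exp (s * (F (V1 * W) - F (V2 * W))) ∂ν ≤
      ∫ W, (1/2 * Real.exp (2 * s * (F (V1 * W) - F (V3 * W))) +
        1/2 * Real.exp (2 * s * (F (V3 * W) - F (V2 * W)))) ∂ν := by
    refine integral_mono (hν.integrable (by fun_prop)) ((i1.const_mul _).add (i2.const_mul _)) ?_
    intro W
    have p1 : Real.exp (s * (F (V1 * W) - F (V2 * W))) =
      Real.exp (s * (F (V1 * W) - F (V3 * W))) * Real.exp (s * (F (V3 * W) - F (V2 * W))) := by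
      rw [← Real.exp_add]; ring_nf
    have p2 : ∀ x : ℝ, Real.exp (2 * s * x) = Real.exp (s * x) ^ 2 := by
      intro x; rw [← Real.exp_nat_mul]; push_cast; ring_nf
    simp only [p1, p2]
    nlinarith [sq_nonneg (Real.exp (s * (F (V1 * W) - F (V3 * W))) - Real.exp (s * (F (V3 * W) - F (V2 * W))))]
  rw [integral_add (i1.const_mul _) (i2.const_mul _), integral_const_mul, integral_const_mul] at hm
  refine (hm.trans (by linarith : _ ≤ Real.exp ((2 * s) ^ 2 * (Real.pi ^ 2 * L ^ 2 / (8 * (2 * Fintype.card N - 3 * Fintype.card κ)))))).trans ?_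
  apply Real.exp_le_exp.2
  have hpi : Real.pi ^ 2 ≤ 10 := by
    have := Real.pi_lt_d2
    nlinarith [Real.pi_pos]
  rw [← mul_div_assoc, div_le_div_iff₀ (by linarith) hposR]
  have hA : 0 ≤ s ^ 2 * L ^ 2 := by positivity
  have hB : (Fintype.card N : ℝ) * Real.pi ^ 2 ≤ 10 * Fintype.card N := by nlinarith
  have hC : (Fintype.card N : ℝ) * 10 ≤ 6 * (2 * Fintype.card N - 3 * Fintype.card κ) := by nlinarith
  nlinarith [mul_le_mul_of_nonneg_left (show (Fintype.card N : ℝ) * Real.pi ^ 2 ≤ 6 * (2 * Fintype.card N - 3 * Fintype.card κ) by linarith) hA]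

/-- joint integrability for two Haar measures -/
lemma IsHaarU.integrable_prod2 {ν : Measure (Matrix N N ℂ)} (hν : IsHaarU ν)
    {f : Matrix N N ℂ × Matrix N N ℂ → ℝ} (hf : Continuous f) :
    Integrable f (ν.prod ν) := by
  have := hν.prob
  have hK : IsCompact ((Matrix.unitaryGroup N ℂ : Set (Matrix N N ℂ)) ×ˢ (Matrix.unitaryGroup N ℂ : Set (Matrix N N ℂ))) :=
    isCompact_unitaryGroup.prod isCompact_unitaryGroup
  obtain ⟨M, hM⟩ := hK.exists_bound_of_continuousOn hf.continuousOn
  refine Integrable.of_bound hf.aestronglyMeasurable M ?_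
  have h1 : ∀ᵐ p ∂(ν.prod ν), p.1 ∈ Matrix.unitaryGroup N ℂ :=
    Measure.quasiMeasurePreserving_fst.ae hν.unit
  have h2 : ∀ᵐ p ∂(ν.prod ν), p.2 ∈ Matrix.unitaryGroup N ℂ :=
    Measure.quasiMeasurePreserving_snd.ae hν.unit
  filter_upwards [h1, h2] with p hp1 hp2
  exact hM p ⟨hp1, hp2⟩

lemma conc_smooth {ν : Measure (Matrix N N ℂ)} (hν : IsHaarU ν)
    {F : Matrix κ N ℂ → ℝ} (hF : ContDiff ℝ 1 F) {L : ℝ} (hL0 : 0 ≤ L)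
    (hL : ∀ V M, |fderiv ℝ F V M| ≤ L * ‖M‖) {a : κ → N} (ha : Function.Injective a)
    (hc : 9 * Fintype.card κ ≤ Fintype.card N) (hpos : 0 < Fintype.card N) {s : ℝ} (hs : 0 ≤ s) :
    ∫ W, Real.exp (s * (F (selM a * W) - ∫ W', F (selM a * W') ∂ν)) ∂ν ≤
      Real.exp (3 * s ^ 2 * L ^ 2 / Fintype.card N) := by
  have := hν.prob
  have hFc := hF.continuous
  set E0 := ∫ W', F (selM a * W') ∂ν with hE0
  have hst : Continuous fun p : Matrix N N ℂ × Matrix N N ℂ => F (selM a * (p.1ᴴ * p.2)) := by fun_prop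
  have hstar : ∀ W ∈ Matrix.unitaryGroup N ℂ, Wᴴ ∈ Matrix.unitaryGroup N ℂ := fun W hW =>
    Unitary.star_mem hW
  set c := ∫ W', F (selM a * W'ᴴ) ∂ν with hcdef
  have hcW : ∀ W ∈ Matrix.unitaryGroup N ℂ, ∫ W', F (selM a * (W'ᴴ * W)) ∂ν = c := by
    intro W hW
    have h := hν.integral_mul_left (f := fun W' => F (selM a * (W'ᴴ * W))) (by fun_prop) hW
    rw [← h]
    refine integral_congr_ae (Filter.Eventually.of_forall fun W' => ?_)
    simp only [conjTranspose_mul, Matrix.mul_assoc]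
    rw [← star_eq_conjTranspose W, (Matrix.mem_unitaryGroup_iff').1 hW, Matrix.mul_one]
  have hcE : c = E0 := by
    have h1 : ∫ W, (∫ W', F (selM a * (W'ᴴ * W)) ∂ν) ∂ν = c := by
      rw [integral_congr_ae (g := fun _ => c)]
      · simp
      · filter_upwards [hν.unit] with W hW using hcW W hW
    have h2 : ∫ W', (∫ W, F (selM a * (W'ᴴ * W)) ∂ν) ∂ν = E0 := by
      rw [integral_congr_ae (g := fun _ => E0)]
      · simp
      · filter_upwards [hν.unit] with W' hW'
        exact hν.integral_mul_left (f := fun W => F (selM a * W)) (by fun_prop) (hstar W' hW')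
    rw [← h1, ← h2]
    exact (integral_integral_swap (f := fun W' W => F (selM a * (W'ᴴ * W))) (hν.integrable_prod2 hst)).symm
  have hjc : Continuous fun p : Matrix N N ℂ × Matrix N N ℂ =>
      Real.exp (s * (F (selM a * p.2) - F (selM a * (p.1ᴴ * p.2)))) := by fun_prop
  have hjen : ∀ W ∈ Matrix.unitaryGroup N ℂ, Real.exp (s * (F (selM a * W) - E0)) ≤
      ∫ W', Real.exp (s * (F (selM a * W) - F (selM a * (W'ᴴ * W)))) ∂ν := by
    intro W hW
    have h1 : s * (F (selM a * W) - E0) = ∫ W', s * (F (selM a * W) - F (selM a * (W'ᴴ * W))) ∂ν := by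
      rw [integral_const_mul, integral_sub (integrable_const _) (hν.integrable (by fun_prop)),
        hcW W hW, hcE]
      simp
    rw [h1]
    exact (convexOn_exp).map_integral_le Real.continuous_exp.continuousOn isClosed_univ
      (by simp) (hν.integrable (by fun_prop)) (hν.integrable (by simp only [Function.comp_def]; fun_prop))
  calc ∫ W, Real.exp (s * (F (selM a * W) - E0)) ∂ν
      ≤ ∫ W, (∫ W', Real.exp (s * (F (selM a * W) - F (selM a * (W'ᴴ * W)))) ∂ν) ∂ν := by
        refine integral_mono_ae (hν.integrable (by fun_prop)) ?_ ?_
        · exact (hν.integrable_prod2 hjc).integral_prod_right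
        · filter_upwards [hν.unit] with W hW using hjen W hW
    _ = ∫ W', (∫ W, Real.exp (s * (F (selM a * W) - F (selM a * (W'ᴴ * W)))) ∂ν) ∂ν :=
        (integral_integral_swap (f := fun W' W => Real.exp (s * (F (selM a * W) - F (selM a * (W'ᴴ * W))))) (hν.integrable_prod2 hjc)).symm
    _ ≤ ∫ W' : Matrix N N ℂ, Real.exp (3 * s ^ 2 * L ^ 2 / Fintype.card N) ∂ν := by
        refine integral_mono_ae ?_ (integrable_const _) ?_
        · exact (hν.integrable_prod2 hjc).integral_prod_left
        · filter_upwards [hν.unit] with W' hW'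
          have h1 : (selM a * W'ᴴ) * (selM a * W'ᴴ)ᴴ = (1 : Matrix κ κ ℂ) := by
            rw [conjTranspose_mul, conjTranspose_conjTranspose, Matrix.mul_assoc, ← Matrix.mul_assoc W'ᴴ,
              ← star_eq_conjTranspose W', (Matrix.mem_unitaryGroup_iff').1 hW', Matrix.one_mul,
              selM_mul_selMT ha]
          have := two_mgf hν hF hL0 hL ha hc hpos hs (selM_mul_selMT ha) h1
          simp only [Matrix.mul_assoc] at this
          exact this
    _ = _ := by simp
end Conc

open MeasureTheory ProbabilityTheory Matrix
open scoped Matrix ENNReal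
set_option linter.unusedSectionVars false

section Molly
open scoped Convolution NNReal

lemma exists_smooth_approx {E : Type*} [NormedAddCommGroup E] [NormedSpace ℝ E]
    [FiniteDimensional ℝ E] [MeasurableSpace E] [BorelSpace E] {F : E → ℝ} {L : ℝ≥0}
    (hF : LipschitzWith L F) {δ : ℝ} (hδ : 0 < δ) :
    ∃ G : E → ℝ, ContDiff ℝ 1 G ∧ LipschitzWith L G ∧ ∀ x, |G x - F x| ≤ L * δ := by
  let μ : Measure E := Measure.addHaar
  let φ : ContDiffBump (0 : E) := ⟨δ / 2, δ, by linarith, by linarith⟩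
  have hloc : LocallyIntegrable F μ := hF.continuous.locallyIntegrable
  refine ⟨(φ.normed μ ⋆[ContinuousLinearMap.lsmul ℝ ℝ, μ] F), ?_, ?_, ?_⟩
  · exact φ.hasCompactSupport_normed.contDiff_convolution_left _ φ.contDiff_normed hloc
  · refine LipschitzWith.of_dist_le_mul fun x y => ?_
    have hIntg : ∀ x, Integrable (fun t => φ.normed μ t * F (x - t)) μ := fun x =>
      ((φ.contDiff_normed (n := 0)).continuous.mul (hF.continuous.comp (by fun_prop))).integrable_of_hasCompactSupport
        (φ.hasCompactSupport_normed.mul_right)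
    have e : ∀ x, (φ.normed μ ⋆[ContinuousLinearMap.lsmul ℝ ℝ, μ] F) x = ∫ t, φ.normed μ t * F (x - t) ∂μ := by
      intro x; rfl
    rw [e, e, Real.dist_eq, ← integral_sub (hIntg x) (hIntg y)]
    calc |∫ t, (φ.normed μ t * F (x - t) - φ.normed μ t * F (y - t)) ∂μ|
        ≤ ∫ t, |φ.normed μ t * F (x - t) - φ.normed μ t * F (y - t)| ∂μ := abs_integral_le_integral_abs
      _ ≤ ∫ t, φ.normed μ t * (L * dist x y) ∂μ := by
          refine integral_mono ((hIntg x).sub (hIntg y)).abs (φ.integrable_normed.mul_const _) fun t => ?_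
          beta_reduce
          rw [← mul_sub, abs_mul, abs_of_nonneg (φ.nonneg_normed t)]
          refine mul_le_mul_of_nonneg_left ?_ (φ.nonneg_normed t)
          have := hF.dist_le_mul (x - t) (y - t)
          rwa [Real.dist_eq, dist_sub_right] at this
      _ = L * dist x y := by rw [integral_mul_const, φ.integral_normed, one_mul]
  · intro x
    rw [← Real.dist_eq]
    refine φ.dist_normed_convolution_le hF.continuous.aestronglyMeasurable fun y hy => ?_
    refine (hF.dist_le_mul y x).trans ?_
    have : dist y x ≤ δ := (Metric.mem_ball.1 hy).le
    exact mul_le_mul_of_nonneg_left this L.2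
end Molly

section ConcLip
open scoped Matrix.Norms.Frobenius NNReal
variable {N κ : Type} [Fintype N] [DecidableEq N] [Fintype κ] [DecidableEq κ]

lemma conc_lip {ν : Measure (Matrix N N ℂ)} (hν : IsHaarU ν)
    {F : Matrix κ N ℂ → ℝ} {L : ℝ≥0} (hF : LipschitzWith L F) {a : κ → N}
    (ha : Function.Injective a)
    (hc : 9 * Fintype.card κ ≤ Fintype.card N) (hpos : 0 < Fintype.card N) {s : ℝ} (hs : 0 ≤ s) :
    ∫ W, Real.exp (s * (F (selM a * W) - ∫ W', F (selM a * W') ∂ν)) ∂ν ≤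
      Real.exp (3 * s ^ 2 * L ^ 2 / Fintype.card N) := by
  have := hν.prob
  have hFc := hF.continuous
  set A := ∫ W, Real.exp (s * (F (selM a * W) - ∫ W', F (selM a * W') ∂ν)) ∂ν with hA
  set B := 3 * s ^ 2 * (L:ℝ) ^ 2 / Fintype.card N with hB
  have key : ∀ δ : ℝ, 0 < δ → A ≤ Real.exp (2 * s * L * δ) * Real.exp B := by
    intro δ hδ
    have hbor : @BorelSpace (Matrix κ N ℂ) (PseudoMetricSpace.toUniformSpace.toTopologicalSpace) matrixMeasurableSpace :=
      matrixBorel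
    obtain ⟨G, hG1, hG2, hG3⟩ := @exists_smooth_approx (Matrix κ N ℂ) _ _ _ _ hbor F L hF δ hδ
    have h1 := conc_smooth hν hG1 L.2 (fun V M => by
      have h2 := norm_fderiv_le_of_lipschitz ℝ hG2 (x₀ := V)
      have h3 := (fderiv ℝ G V).le_opNorm M
      rw [Real.norm_eq_abs] at h3
      exact h3.trans (mul_le_mul_of_nonneg_right h2 (norm_nonneg _))) ha hc hpos hs
    have hGc := hG1.continuous
    have hE : ∫ W', G (selM a * W') ∂ν ≤ ∫ W', F (selM a * W') ∂ν + L * δ := by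
      have : ∫ W', G (selM a * W') ∂ν ≤ ∫ W', (F (selM a * W') + L * δ) ∂ν := by
        refine integral_mono (hν.integrable (by fun_prop)) (hν.integrable (by fun_prop)) fun W => ?_
        have := (abs_le.1 (hG3 (selM a * W))).2
        simp only; linarith
      rwa [integral_add (hν.integrable (by fun_prop)) (integrable_const _), integral_const,
        probReal_univ, one_smul] at this
    calc A ≤ ∫ W, Real.exp (2 * s * L * δ) * Real.exp (s * (G (selM a * W) - ∫ W', G (selM a * W') ∂ν)) ∂ν := by
          refine integral_mono (hν.integrable (by fun_prop)) (hν.integrable (by fun_prop)) fun W => ?_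
          beta_reduce
          rw [← Real.exp_add]
          apply Real.exp_le_exp.2
          have := (abs_le.1 (hG3 (selM a * W))).1
          nlinarith
      _ ≤ _ := by
          rw [integral_const_mul]
          exact mul_le_mul_of_nonneg_left h1 (Real.exp_pos _).le
  have hlim : Filter.Tendsto (fun δ : ℝ => Real.exp (2 * s * L * δ) * Real.exp B) (nhdsWithin 0 (Set.Ioi 0))
      (nhds (Real.exp B)) := by
    have : Continuous fun δ : ℝ => Real.exp (2 * s * L * δ) * Real.exp B := by fun_prop
    have h := this.tendsto 0
    simp only [mul_zero, Real.exp_zero, one_mul] at h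
    exact h.mono_left nhdsWithin_le_nhds
  refine ge_of_tendsto hlim ?_
  filter_upwards [self_mem_nhdsWithin] with δ hδ using key δ hδ

lemma conc_tail {ν : Measure (Matrix N N ℂ)} (hν : IsHaarU ν)
    {F : Matrix κ N ℂ → ℝ} {L : ℝ≥0} (hLpos : 0 < L) (hF : LipschitzWith L F) {a : κ → N}
    (ha : Function.Injective a)
    (hc : 9 * Fintype.card κ ≤ Fintype.card N) (hpos : 0 < Fintype.card N) {t : ℝ} (ht : 0 < t) :
    ν {W | (∫ W', F (selM a * W') ∂ν) + t ≤ F (selM a * W)} ≤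
      ENNReal.ofReal (Real.exp (-(Fintype.card N * t ^ 2 / 12) / (L:ℝ) ^ 2)) := by
  have := hν.prob
  have hFc := hF.continuous
  set E0 := ∫ W', F (selM a * W') ∂ν
  have hL : (0:ℝ) < L := hLpos
  have hn : (0:ℝ) < Fintype.card N := by exact_mod_cast hpos
  set s : ℝ := Fintype.card N * t / (6 * (L:ℝ)^2) with hs
  have hs0 : 0 < s := by positivity
  have h1 := conc_lip hν hF ha hc hpos hs0.le
  have h2 := measure_ge_le_exp_mul_mgf (μ := ν) (X := fun W => F (selM a * W) - E0) t hs0.le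
    (hν.integrable (by fun_prop))
  have h3 : {W : Matrix N N ℂ | E0 + t ≤ F (selM a * W)} = {W : Matrix N N ℂ | t ≤ F (selM a * W) - E0} := by
    ext W; simp only [Set.mem_ofPred_eq]; constructor <;> intro h <;> linarith
  rw [h3, ← ofReal_measureReal]
  apply ENNReal.ofReal_le_ofReal
  refine h2.trans ?_
  calc _ ≤ Real.exp (-s * t) * Real.exp (3 * s ^ 2 * L ^ 2 / Fintype.card N) :=
        mul_le_mul_of_nonneg_left h1 (Real.exp_pos _).le
    _ = _ := by
        rw [← Real.exp_add]
        congr 1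
        rw [hs]
        field_simp
        ring

lemma conc_moment8 {ν : Measure (Matrix N N ℂ)} (hν : IsHaarU ν)
    {F : Matrix κ N ℂ → ℝ} {L : ℝ≥0} (hLpos : 0 < L) (hF : LipschitzWith L F) {a : κ → N}
    (ha : Function.Injective a)
    (hc : 9 * Fintype.card κ ≤ Fintype.card N) (hpos : 0 < Fintype.card N) :
    ∫ W, (F (selM a * W) - ∫ W', F (selM a * W') ∂ν) ^ 8 ∂ν ≤
      (80640 * Real.exp 3) * ((L:ℝ)^2 / Fintype.card N) ^ 4 := by
  have := hν.prob
  have hFc := hF.continuous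
  set E0 := ∫ W', F (selM a * W') ∂ν with hE0
  have hL : (0:ℝ) < L := hLpos
  have hn : (0:ℝ) < Fintype.card N := by exact_mod_cast hpos
  set s : ℝ := Real.sqrt (Fintype.card N) / L with hs
  have hs0 : 0 < s := by positivity
  have hs2 : s ^ 2 = Fintype.card N / (L:ℝ)^2 := by
    rw [hs, div_pow, Real.sq_sqrt hn.le]
  have h1 := conc_lip hν hF ha hc hpos hs0.le
  have hFn : LipschitzWith L (fun V => - F V) := hF.neg
  have h2 := conc_lip hν hFn ha hc hpos hs0.le
  have e3 : 3 * s ^ 2 * (L:ℝ) ^ 2 / Fintype.card N = 3 := by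
    rw [hs2]; field_simp
  rw [e3] at h1 h2
  rw [integral_neg] at h2
  have hpt : ∀ W : Matrix N N ℂ, s ^ 8 * (F (selM a * W) - E0) ^ 8 ≤
      40320 * (Real.exp (s * (F (selM a * W) - E0)) + Real.exp (s * (-F (selM a * W) - -E0))) := by
    intro W
    set x := s * (F (selM a * W) - E0) with hx
    have e1 : s * (-F (selM a * W) - -E0) = -x := by rw [hx]; ring
    have e2 : s ^ 8 * (F (selM a * W) - E0) ^ 8 = |x| ^ 8 := by
      rw [Even.pow_abs (by decide), hx]; ring
    rw [e1, e2]
    have h := Real.pow_div_factorial_le_exp |x| (abs_nonneg x) 8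
    rw [div_le_iff₀ (by positivity)] at h
    have hf : ((Nat.factorial 8 : ℕ) : ℝ) = 40320 := by norm_num [Nat.factorial]
    rw [hf] at h
    have hab : Real.exp |x| ≤ Real.exp x + Real.exp (-x) := by
      rcases abs_cases x with ⟨h, _⟩ | ⟨h, _⟩ <;> rw [h] <;>
        linarith [Real.exp_pos x, Real.exp_pos (-x)]
    linarith
  have hm := integral_mono (μ := ν) (hν.integrable (by fun_prop)) (hν.integrable (by fun_prop)) hpt
  rw [integral_const_mul, integral_const_mul, integral_add (hν.integrable (by fun_prop)) (hν.integrable (by fun_prop))] at hm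
  have h3 : s ^ 8 * ∫ W, (F (selM a * W) - E0) ^ 8 ∂ν ≤ 80640 * Real.exp 3 := by linarith
  have h4 : ((L:ℝ)^2 / Fintype.card N) ^ 4 = (s ^ 8)⁻¹ := by
    rw [show s ^ 8 = (s ^ 2) ^ 4 by ring, hs2, ← inv_pow, inv_div]
  rw [h4, ← div_eq_mul_inv, le_div_iff₀ (by positivity)]
  linarith
end ConcLip

open MeasureTheory ProbabilityTheory Matrix
open scoped Matrix ENNReal
set_option linter.unusedSectionVars false

section HW
open scoped Matrix.Norms.Frobenius
variable {κ : Type} [Fintype κ] [DecidableEq κ]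

lemma unitary_row_sum {Q : Matrix κ κ ℂ} (hQ : Q ∈ unitaryGroup κ ℂ) (i : κ) :
    ∑ j, ‖Q i j‖ ^ 2 = 1 := by
  have h := congrFun (congrFun (mem_unitaryGroup_iff.1 hQ) i) i
  rw [Matrix.mul_apply, Matrix.one_apply_eq] at h
  have h2 := congrArg Complex.re h
  rw [Complex.re_sum] at h2
  rw [← Complex.one_re, ← h2]
  refine Finset.sum_congr rfl fun j _ => ?_
  rw [Matrix.star_apply, Complex.star_def, Complex.mul_conj, Complex.ofReal_re, Complex.normSq_eq_norm_sq]

lemma unitary_col_sum {Q : Matrix κ κ ℂ} (hQ : Q ∈ unitaryGroup κ ℂ) (j : κ) :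
    ∑ i, ‖Q i j‖ ^ 2 = 1 := by
  have h : star Q ∈ unitaryGroup κ ℂ := Unitary.star_mem hQ
  have := unitary_row_sum h j
  rw [← this]
  refine Finset.sum_congr rfl fun i _ => ?_
  rw [Matrix.star_apply, norm_star]

lemma hoffman_wielandt {X Y : Matrix κ κ ℂ} (hX : X.IsHermitian) (hY : Y.IsHermitian)
    {f : ℝ → ℝ} (hf : ∀ s t, |f s - f t| ≤ |s - t|) :
    |∑ i, f (hX.eigenvalues i) - ∑ i, f (hY.eigenvalues i)| ≤
      Real.sqrt (Fintype.card κ) * ‖X - Y‖ := by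
  set U : Matrix κ κ ℂ := (hX.eigenvectorUnitary : Matrix κ κ ℂ) with hU
  set V : Matrix κ κ ℂ := (hY.eigenvectorUnitary : Matrix κ κ ℂ) with hV
  have hUm : U ∈ unitaryGroup κ ℂ := hX.eigenvectorUnitary.2
  have hVm : V ∈ unitaryGroup κ ℂ := hY.eigenvectorUnitary.2
  set Q := star U * V with hQ
  have hQm : Q ∈ unitaryGroup κ ℂ := mul_mem (Unitary.star_mem hUm) hVm
  have hXs : X = U * diagonal (fun i => (hX.eigenvalues i : ℂ)) * star U := by
    have := hX.spectral_theorem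
    rw [Unitary.conjStarAlgAut_apply] at this
    exact this
  have hYs : Y = V * diagonal (fun i => (hY.eigenvalues i : ℂ)) * star V := by
    have := hY.spectral_theorem
    rw [Unitary.conjStarAlgAut_apply] at this
    exact this
  have hUU : star U * U = 1 := mem_unitaryGroup_iff'.1 hUm
  have hVV : star V * V = 1 := mem_unitaryGroup_iff'.1 hVm
  have hD : star U * (X - Y) * V = diagonal (fun i => (hX.eigenvalues i : ℂ)) * Q -
      Q * diagonal (fun i => (hY.eigenvalues i : ℂ)) := by
    have e1 : star U * X = diagonal (fun i => (hX.eigenvalues i : ℂ)) * star U := by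
      conv_lhs => rw [hXs]
      rw [← Matrix.mul_assoc, ← Matrix.mul_assoc, hUU, Matrix.one_mul]
    have e2 : Y * V = V * diagonal (fun i => (hY.eigenvalues i : ℂ)) := by
      conv_lhs => rw [hYs]
      rw [Matrix.mul_assoc, hVV, Matrix.mul_one]
    rw [Matrix.mul_sub, Matrix.sub_mul, e1, Matrix.mul_assoc, Matrix.mul_assoc (star U) Y, e2, hQ, Matrix.mul_assoc]
  have hmul_r : ∀ M : Matrix κ κ ℂ, ‖M * V‖ ^ 2 = ‖M‖ ^ 2 := by
    intro M
    rw [frob_sq_trace, frob_sq_trace, conjTranspose_mul, Matrix.mul_assoc, ← Matrix.mul_assoc V,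
      show V * Vᴴ = 1 from mem_unitaryGroup_iff.1 hVm, Matrix.one_mul]
  have hmul_l : ∀ M : Matrix κ κ ℂ, ‖star U * M‖ ^ 2 = ‖M‖ ^ 2 := by
    intro M
    rw [frob_sq_trace, frob_sq_trace, conjTranspose_mul, Matrix.trace_mul_comm, Matrix.mul_assoc,
      ← Matrix.mul_assoc _ (star U), star_eq_conjTranspose, conjTranspose_conjTranspose,
      show U * Uᴴ = 1 from mem_unitaryGroup_iff.1 hUm, Matrix.one_mul, Matrix.trace_mul_comm]
  have hN : ‖X - Y‖ ^ 2 = ∑ i, ∑ j, ‖Q i j‖ ^ 2 * |hX.eigenvalues i - hY.eigenvalues j| ^ 2 := by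
    rw [← hmul_l, ← hmul_r, hD, frob_sq]
    refine Finset.sum_congr rfl fun i _ => Finset.sum_congr rfl fun j _ => ?_
    rw [Matrix.sub_apply, diagonal_mul, mul_diagonal,
      show (hX.eigenvalues i : ℂ) * Q i j - Q i j * (hY.eigenvalues j : ℂ)
        = Q i j * ((hX.eigenvalues i - hY.eigenvalues j : ℝ) : ℂ) by push_cast; ring,
      norm_mul, Complex.norm_real, Real.norm_eq_abs, mul_pow]
  have hS : ∑ i, f (hX.eigenvalues i) - ∑ i, f (hY.eigenvalues i) =
      ∑ i, ∑ j, ‖Q i j‖ ^ 2 * (f (hX.eigenvalues i) - f (hY.eigenvalues j)) := by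
    simp only [mul_sub, Finset.sum_sub_distrib]
    congr 1
    · refine Finset.sum_congr rfl fun i _ => ?_
      rw [← Finset.sum_mul, unitary_row_sum hQm, one_mul]
    · rw [Finset.sum_comm]
      refine Finset.sum_congr rfl fun i _ => ?_
      rw [← Finset.sum_mul, unitary_col_sum hQm, one_mul]
  have hA : |∑ i, f (hX.eigenvalues i) - ∑ i, f (hY.eigenvalues i)| ≤
      ∑ p : κ × κ, ‖Q p.1 p.2‖ * (‖Q p.1 p.2‖ * |hX.eigenvalues p.1 - hY.eigenvalues p.2|) := by
    rw [hS, Fintype.sum_prod_type]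
    refine (Finset.abs_sum_le_sum_abs _ _).trans (Finset.sum_le_sum fun i _ => ?_)
    refine (Finset.abs_sum_le_sum_abs _ _).trans (Finset.sum_le_sum fun j _ => ?_)
    rw [abs_mul, abs_of_nonneg (by positivity)]
    have := hf (hX.eigenvalues i) (hY.eigenvalues j)
    calc _ ≤ ‖Q i j‖ ^ 2 * |hX.eigenvalues i - hY.eigenvalues j| :=
          mul_le_mul_of_nonneg_left this (by positivity)
      _ = _ := by ring
  refine hA.trans ((Real.sum_mul_le_sqrt_mul_sqrt _ _ _).trans ?_)
  rw [Fintype.sum_prod_type, Fintype.sum_prod_type]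
  simp only [mul_pow]
  rw [← hN, Real.sqrt_sq (norm_nonneg _)]
  simp only [unitary_row_sum hQm]
  simp
end HW

lemma integral_esd {k : ℕ} {X : Matrix (Fin k) (Fin k) ℂ} (hX : X.IsHermitian)
    (f : ℝ → ℝ) : ∫ x, f x ∂(esd X) = (k:ℝ)⁻¹ * ∑ i, f (hX.eigenvalues i) := by
  rw [esd, dif_pos hX, integral_smul_measure, integral_finsetSum_measure]
  · simp [integral_dirac]
  · intro i _
    exact integrable_dirac (by simp)

open MeasureTheory ProbabilityTheory Matrix
open scoped Matrix ENNReal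
set_option linter.unusedSectionVars false

section SC
open Real intervalIntegral

lemma sc_dens_nonneg (t : ℝ) : 0 ≤ √(4 - t ^ 2) / (2 * π) := by positivity

lemma sc_integral {E : Type*} [NormedAddCommGroup E] [NormedSpace ℝ E] (f : ℝ → E) :
    ∫ x, f x ∂semicircle = ∫ t in (-2:ℝ)..2, (√(4 - t ^ 2) / (2 * π)) • f t := by
  rw [semicircle, integral_withDensity_eq_integral_toReal_smul (by fun_prop) (by simp)]
  rw [intervalIntegral.integral_of_le (by norm_num), ← integral_Icc_eq_integral_Ioc]
  symm
  simp only [ENNReal.toReal_ofReal (sc_dens_nonneg _)]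
  apply setIntegral_eq_integral_of_forall_compl_eq_zero
  intro t ht
  have : 4 - t ^ 2 ≤ 0 := by
    by_contra h
    push Not at h
    apply ht
    constructor <;> nlinarith
  rw [Real.sqrt_eq_zero_of_nonpos this]
  simp

/-- integral in angular form -/
lemma sc_integral_cos {E : Type*} [NormedAddCommGroup E] [NormedSpace ℝ E] {f : ℝ → E}
    (hf : Continuous f) :
    ∫ x, f x ∂semicircle = ∫ θ in (0:ℝ)..π, (2 * sin θ ^ 2 / π) • f (2 * cos θ) := by
  rw [sc_integral]
  have h := intervalIntegral.integral_deriv_smul_comp (a := (0:ℝ)) (b := π) (f := fun θ => 2 * cos θ)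
    (f' := fun θ => 2 * (- sin θ)) (g := fun t => (√(4 - t ^ 2) / (2 * π)) • f t)
    (fun x _ => (hasDerivAt_cos x).const_mul 2) (by fun_prop) (by fun_prop)
  simp only [cos_zero, cos_pi, mul_one, mul_neg] at h
  rw [intervalIntegral.integral_symm, ← h, ← intervalIntegral.integral_neg]
  refine intervalIntegral.integral_congr fun θ hθ => ?_
  rw [Set.uIcc_of_le pi_pos.le] at hθ
  have hs := sin_nonneg_of_mem_Icc hθ
  have : √(4 - (2 * cos θ) ^ 2) = 2 * sin θ := by
    rw [show 4 - (2 * cos θ)^2 = (2 * sin θ)^2 by nlinarith [sin_sq_add_cos_sq θ]]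
    exact sqrt_sq (by positivity)
  simp only [Function.comp, this, ← neg_smul, smul_smul]
  congr 1
  field_simp

instance sc_prob : IsProbabilityMeasure semicircle := by
  have h := sc_integral_cos (f := fun _ => (1:ℝ)) continuous_const
  have h2 : ∫ θ in (0:ℝ)..π, (2 * sin θ ^ 2 / π) • (1:ℝ) = 1 := by
    simp only [smul_eq_mul, mul_one]
    rw [intervalIntegral.integral_div, intervalIntegral.integral_const_mul, integral_sin_sq]
    simp
    field_simp
  rw [h2] at h
  rw [MeasureTheory.integral_const, smul_eq_mul, mul_one] at h
  constructor
  have := congrArg ENNReal.ofReal h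
  rw [measureReal_def, ENNReal.ofReal_toReal] at this
  · simpa using this
  · intro hh
    rw [measureReal_def, hh] at h
    simp at h

lemma sc_supp : ∀ᵐ x ∂semicircle, x ∈ Set.Icc (-2:ℝ) 2 := by
  rw [ae_iff]
  have : MeasurableSet {a : ℝ | a ∉ Set.Icc (-2:ℝ) 2} := measurableSet_Icc.compl
  rw [semicircle, withDensity_apply _ this]
  refine (setLIntegral_congr_fun this (g := fun _ => 0) fun t ht => ?_).trans (by simp)
  have : 4 - t ^ 2 ≤ 0 := by
    by_contra h
    push Not at h
    apply ht
    constructor <;> nlinarith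
  beta_reduce
  rw [Real.sqrt_eq_zero_of_nonpos this]
  simp

lemma sc_integrable {E : Type*} [NormedAddCommGroup E] [NormedSpace ℝ E] {f : ℝ → E}
    (hf : Continuous f) : Integrable f semicircle := by
  obtain ⟨C, hC⟩ := isCompact_Icc.exists_bound_of_continuousOn (hf.continuousOn (s := Set.Icc (-2:ℝ) 2))
  refine Integrable.of_bound hf.aestronglyMeasurable C ?_
  filter_upwards [sc_supp] with x hx using hC x hx

lemma sc_sq : ∫ x, x ^ 2 ∂semicircle = 1 := by
  rw [sc_integral_cos (by fun_prop)]
  have : ∀ θ : ℝ, (2 * sin θ ^ 2 / π) • (2 * cos θ)^2 = (8 / π) * (sin θ ^ 2 * cos θ ^ 2) := by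
    intro θ; rw [smul_eq_mul]; ring
  simp only [this]
  rw [intervalIntegral.integral_const_mul, integral_sin_sq_mul_cos_sq]
  have : sin (4 * π) = 0 := by
    have := sin_nat_mul_pi 4
    exact_mod_cast this
  simp [this]

/-- Stieltjes transform of a measure -/
noncomputable def stj (σ : Measure ℝ) (z : ℂ) : ℂ := ∫ a, ((a:ℂ) - z)⁻¹ ∂σ

lemma sub_ne_of_im {z : ℂ} (hz : 0 < z.im) (a : ℝ) : (a:ℂ) - z ≠ 0 := by
  intro h
  have := congrArg Complex.im h
  simp at this
  exact hz.ne' this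

lemma exists_joukowski {z : ℂ} (hz : 0 < z.im) : ∃ w : ℂ, w ≠ 0 ∧ ‖w‖ < 1 ∧ z = w + w⁻¹ := by
  obtain ⟨s, hs⟩ := IsSquare.exists_sq (a := z^2-4) (IsAlgClosed.exists_pow_nat_eq (z^2-4) (n := 2) (by norm_num) |>.imp (fun a h => by rw [← h, sq]))
  have hw : ((z + s)/2) * ((z - s)/2) = 1 := by linear_combination (-1/4) * (-hs)
  set w := (z+s)/2 with hwd
  have hw0 : w ≠ 0 := left_ne_zero_of_mul_eq_one hw
  have hwi : w⁻¹ = (z-s)/2 := inv_eq_of_mul_eq_one_right hw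
  have hz2 : z = w + w⁻¹ := by rw [hwi, hwd]; ring
  rcases lt_trichotomy ‖w‖ 1 with h | h | h
  · exact ⟨w, hw0, h, hz2⟩
  · exfalso
    have : w⁻¹ = (starRingEnd ℂ) w := by
      rw [Complex.inv_def, Complex.normSq_eq_norm_sq, h]; simp
    rw [hz2, this] at hz
    simp at hz
  · refine ⟨w⁻¹, inv_ne_zero hw0, ?_, by rw [inv_inv, add_comm]; exact hz2⟩
    rw [norm_inv]
    exact inv_lt_one_of_one_lt₀ h

lemma poisson_int {z w : ℂ} (hz : 0 < z.im) (hw0 : w ≠ 0) (hw : ‖w‖ < 1) (hzw : z = w + w⁻¹) :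
    ∫ θ in (0:ℝ)..2*π, (((2 * cos θ : ℝ):ℂ) - z)⁻¹ = 2 * π * (w - w⁻¹)⁻¹ := by
  have hwi : 1 < ‖w⁻¹‖ := by rw [norm_inv]; exact one_lt_inv_iff₀.2 ⟨norm_pos_iff.2 hw0, hw⟩
  have hd : DiffContOnCl ℂ (fun ζ : ℂ => (ζ - w⁻¹)⁻¹) (Metric.ball 0 1) := by
    refine DifferentiableOn.diffContOnCl ?_
    rw [closure_ball _ (by norm_num)]
    intro ζ hζ
    refine DifferentiableAt.differentiableWithinAt ?_
    refine DifferentiableAt.inv (by fun_prop) ?_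
    intro h
    rw [sub_eq_zero] at h
    rw [← h] at hwi
    simp at hζ
    linarith
  have h := hd.circleIntegral_sub_inv_smul (w := w) (by simpa using hw)
  rw [circleIntegral] at h
  have h2 : ∫ θ in (0:ℝ)..2*π, deriv (circleMap 0 1) θ • (circleMap 0 1 θ - w)⁻¹ • (circleMap 0 1 θ - w⁻¹)⁻¹
      = Complex.I * ∫ θ in (0:ℝ)..2*π, (((2 * cos θ : ℝ):ℂ) - z)⁻¹ := by
    rw [← intervalIntegral.integral_const_mul]
    refine intervalIntegral.integral_congr fun θ _ => ?_
    simp only [deriv_circleMap, smul_eq_mul]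
    set ζ := circleMap 0 1 θ with hζ
    have hζn : ‖ζ‖ = 1 := by rw [hζ]; simp
    have hζ0 : ζ ≠ 0 := by rw [← norm_ne_zero_iff, hζn]; norm_num
    have hc : ((2 * cos θ : ℝ):ℂ) = ζ + ζ⁻¹ := by
      rw [hζ, circleMap]
      push_cast
      rw [Complex.two_cos, zero_add, one_mul, ← Complex.exp_neg, neg_mul]
    rw [hc]
    have e : ζ + ζ⁻¹ - z = ζ⁻¹ * ((ζ - w) * (ζ - w⁻¹)) := by
      rw [hzw]; field_simp; ring
    rw [e, mul_inv, mul_inv, inv_inv]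
    ring
  rw [h2] at h
  have := mul_left_cancel₀ Complex.I_ne_zero (h.trans (show _ = Complex.I * (2 * π * (w - w⁻¹)⁻¹) by rw [smul_eq_mul]; ring))
  exact this

lemma stj_sc_eq {z w : ℂ} (hz : 0 < z.im) (hw0 : w ≠ 0) (hw : ‖w‖ < 1) (hzw : z = w + w⁻¹) :
    stj semicircle z = - w := by
  have hne : ∀ θ : ℝ, (((2 * cos θ : ℝ):ℂ) - z) ≠ 0 := fun θ => sub_ne_of_im hz _
  have hcont : Continuous fun a : ℝ => ((a:ℂ) - z)⁻¹ :=
    Continuous.inv₀ (by fun_prop) (sub_ne_of_im hz)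
  rw [stj, sc_integral_cos hcont]
  have hcos : Continuous fun θ : ℝ => (((2 * cos θ : ℝ):ℂ) - z)⁻¹ :=
    Continuous.inv₀ (by fun_prop) hne
  have hsym : ∫ θ in (0:ℝ)..2*π, (((2 * cos θ : ℝ):ℂ) - z)⁻¹ = 2 * ∫ θ in (0:ℝ)..π, (((2 * cos θ : ℝ):ℂ) - z)⁻¹ := by
    rw [← intervalIntegral.integral_add_adjacent_intervals (b := π) (hcos.intervalIntegrable _ _) (hcos.intervalIntegrable _ _),
      two_mul (∫ θ in (0:ℝ)..π, (((2 * cos θ : ℝ):ℂ) - z)⁻¹)]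
    congr 1
    have := intervalIntegral.integral_comp_sub_left (a := 0) (b := π) (fun θ => (((2 * cos θ : ℝ):ℂ) - z)⁻¹) (2*π)
    rw [show 2 * π - π = π by ring, sub_zero] at this
    rw [← this]
    refine intervalIntegral.integral_congr fun θ _ => ?_
    simp only [Real.cos_two_pi_sub]
  rw [poisson_int hz hw0 hw hzw] at hsym
  have hpt : ∀ θ : ℝ, (2 * sin θ ^ 2 / π) • (((2 * cos θ : ℝ):ℂ) - z)⁻¹ =
      (2 * π : ℂ)⁻¹ * ((4 - z^2) * (((2 * cos θ : ℝ):ℂ) - z)⁻¹ - z - ((2 * cos θ : ℝ):ℂ)) := by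
    intro θ
    have h1 : (sin θ : ℂ)^2 = 1 - (cos θ:ℂ)^2 := by
      have := sin_sq_add_cos_sq θ
      have h := congrArg (fun x : ℝ => (x:ℂ)) this
      push_cast at h ⊢
      linear_combination h
    have hh := hne θ
    have hpi : (π:ℂ) ≠ 0 := by exact_mod_cast pi_ne_zero
    rw [Complex.real_smul]
    push_cast at hh h1 ⊢
    field_simp
    rw [h1]
    ring
  simp only [hpt]
  rw [intervalIntegral.integral_const_mul, intervalIntegral.integral_sub, intervalIntegral.integral_sub,
    intervalIntegral.integral_const_mul]
  · have hc0 : ∫ θ in (0:ℝ)..π, ((2 * cos θ : ℝ):ℂ) = 0 := by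
      rw [intervalIntegral.integral_ofReal, intervalIntegral.integral_const_mul, integral_cos]; simp
    rw [hc0, intervalIntegral.integral_const]
    have hI : ∫ θ in (0:ℝ)..π, (((2 * cos θ : ℝ):ℂ) - z)⁻¹ = π * (w - w⁻¹)⁻¹ := by
      have := hsym
      linear_combination (-1/2) * this
    rw [hI, Complex.real_smul]
    have hpi : (π:ℂ) ≠ 0 := by exact_mod_cast pi_ne_zero
    have hww : w - w⁻¹ ≠ 0 := by
      intro h
      have : w * w = 1 := by
        rw [sub_eq_zero] at h; nth_rw 2 [h]; exact mul_inv_cancel₀ hw0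
      have := congrArg norm this
      rw [norm_mul, norm_one] at this
      nlinarith [norm_nonneg w]
    have hz4 : 4 - z^2 = -(w - w⁻¹)^2 := by rw [hzw]; field_simp; ring
    rw [hz4, hzw]
    push_cast
    have : (w - w⁻¹)^2 * (π * (w - w⁻¹)⁻¹) = π * (w - w⁻¹) := by field_simp
    rw [neg_mul, this]
    field_simp
    ring
  · exact (hcos.const_mul _ ).intervalIntegrable _ _
  · exact continuous_const.intervalIntegrable _ _
  · exact ((hcos.const_mul _).sub continuous_const).intervalIntegrable _ _
  · exact Continuous.intervalIntegrable (by fun_prop) _ _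

lemma stj_sc {z : ℂ} (hz : 0 < z.im) :
    stj semicircle z ^ 2 + z * stj semicircle z + 1 = 0 ∧ 0 < (stj semicircle z).im := by
  obtain ⟨w, h0, h1, h2⟩ := exists_joukowski hz
  rw [stj_sc_eq hz h0 h1 h2]
  constructor
  · rw [h2]; field_simp; ring
  · have hn : 0 < Complex.normSq w := Complex.normSq_pos.2 h0
    have hn1 : Complex.normSq w < 1 := by
      rw [Complex.normSq_eq_norm_sq]; nlinarith [norm_nonneg w]
    have h3 : z.im = w.im - w.im / Complex.normSq w := by
      rw [h2, Complex.add_im, Complex.inv_im]; ring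
    rw [h3] at hz
    have : w.im - w.im / Complex.normSq w = (-w.im) * ((1 - Complex.normSq w) / Complex.normSq w) := by
      field_simp; ring
    rw [this] at hz
    rw [Complex.neg_im]
    exact pos_of_mul_pos_left hz (by apply div_nonneg <;> linarith)
end SC

open MeasureTheory ProbabilityTheory Matrix
open scoped Matrix ENNReal
set_option linter.unusedSectionVars false

section Pot
open Real

/-- arctan potential -/
noncomputable def vP (σ : Measure ℝ) (x y : ℝ) : ℝ := ∫ a, arctan ((x - a) / y) ∂σ

lemma norm_inv_sub_le {z : ℂ} {c : ℝ} (hc : 0 < c) (hz : c ≤ z.im) (a : ℝ) : ‖((a:ℂ) - z)⁻¹‖ ≤ c⁻¹ := by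
  rw [norm_inv]
  apply inv_anti₀ hc
  have := Complex.abs_im_le_norm ((a:ℂ) - z)
  simp at this
  exact (hz.trans (le_abs_self _)).trans this

lemma cont_inv_sub {z : ℂ} (hz : 0 < z.im) : Continuous fun a : ℝ => ((a:ℂ) - z)⁻¹ :=
  Continuous.inv₀ (by fun_prop) (sub_ne_of_im hz)

variable {σ : Measure ℝ} [IsProbabilityMeasure σ]

lemma integrable_inv_sub {z : ℂ} (hz : 0 < z.im) : Integrable (fun a : ℝ => ((a:ℂ) - z)⁻¹) σ :=
  Integrable.of_bound (cont_inv_sub hz).aestronglyMeasurable _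
    (Filter.Eventually.of_forall fun a => norm_inv_sub_le hz le_rfl a)

lemma stj_im {z : ℂ} (hz : 0 < z.im) : (stj σ z).im = ∫ a, (((a:ℝ):ℂ) - z)⁻¹.im ∂σ :=
  (Complex.imCLM.integral_comp_comm (integrable_inv_sub hz)).symm

lemma stj_re {z : ℂ} (hz : 0 < z.im) : (stj σ z).re = ∫ a, (((a:ℝ):ℂ) - z)⁻¹.re ∂σ :=
  (Complex.reCLM.integral_comp_comm (integrable_inv_sub hz)).symm

lemma hasDerivAt_stj {z : ℂ} (hz : 0 < z.im) :
    HasDerivAt (stj σ) (∫ a, (((a:ℝ):ℂ) - z)⁻¹ ^ 2 ∂σ) z := by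
  have hs : {w : ℂ | z.im / 2 < w.im} ∈ nhds z :=
    (isOpen_lt continuous_const Complex.continuous_im).mem_nhds (by simp only [Set.mem_ofPred_eq]; linarith)
  refine (hasDerivAt_integral_of_dominated_loc_of_deriv_le (F := fun w (a:ℝ) => ((a:ℂ) - w)⁻¹)
    (F' := fun w (a:ℝ) => ((a:ℂ) - w)⁻¹ ^ 2)
    (bound := fun _ => ((z.im/2)⁻¹)^2) hs ?_ (integrable_inv_sub hz) ?_ ?_ (integrable_const _) ?_).2
  · filter_upwards [hs] with w hw
    exact (cont_inv_sub (lt_trans (by linarith) hw)).aestronglyMeasurable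
  · exact ((cont_inv_sub hz).pow 2).aestronglyMeasurable
  · refine Filter.Eventually.of_forall fun a w hw => ?_
    rw [norm_pow]
    exact pow_le_pow_left₀ (norm_nonneg _) (norm_inv_sub_le (by linarith) (le_of_lt hw) a) 2
  · refine Filter.Eventually.of_forall fun a w hw => ?_
    have hne := sub_ne_of_im (z := w) (lt_trans (by linarith) hw) a
    have := ((hasDerivAt_id w).const_sub (a:ℂ)).fun_inv hne
    refine this.congr_deriv ?_
    simp only [id]
    rw [neg_neg, inv_pow, one_div]

lemma inv_sub_parts (a x y : ℝ) :
    (((a:ℂ) - ⟨x, y⟩)⁻¹).im = y / ((x - a)^2 + y^2) ∧ (((a:ℂ) - ⟨x, y⟩)⁻¹).re = (a - x) / ((x - a)^2 + y^2) := by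
  constructor
  · rw [Complex.inv_im, Complex.normSq_apply]
    simp
    congr 1; ring
  · rw [Complex.inv_re, Complex.normSq_apply]
    simp
    congr 1; ring

lemma abs_parts_le (a x : ℝ) {y c : ℝ} (hc : 0 < c) (hy : c ≤ y) :
    |y / ((x - a)^2 + y^2)| ≤ c⁻¹ ∧ |(a - x) / ((x - a)^2 + y^2)| ≤ c⁻¹ := by
  obtain ⟨h1, h2⟩ := inv_sub_parts a x y
  rw [← h1, ← h2]
  have := norm_inv_sub_le (z := ⟨x, y⟩) hc hy a
  exact ⟨(Complex.abs_im_le_norm _).trans this, (Complex.abs_re_le_norm _).trans this⟩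

lemma cont_arctan (x : ℝ) {y : ℝ} : Continuous fun a : ℝ => arctan ((x - a) / y) := by
  fun_prop

lemma integrable_arctan (x : ℝ) {y : ℝ} : Integrable (fun a : ℝ => arctan ((x - a) / y)) σ :=
  Integrable.of_bound (cont_arctan x).aestronglyMeasurable (π/2)
    (Filter.Eventually.of_forall fun a => by
      rw [norm_eq_abs, abs_le]; exact ⟨(neg_pi_div_two_lt_arctan _).le, (arctan_lt_pi_div_two _).le⟩)

lemma hasDerivAt_vP_x (x : ℝ) {y : ℝ} (hy : 0 < y) :
    HasDerivAt (fun x => vP σ x y) (stj σ ⟨x, y⟩).im x := by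
  rw [stj_im (z := ⟨x,y⟩) hy]
  simp only [(inv_sub_parts _ x y).1]
  refine (hasDerivAt_integral_of_dominated_loc_of_deriv_le (F := fun x a => arctan ((x - a) / y))
    (F' := fun x a => y / ((x - a)^2 + y^2))
    (bound := fun _ => y⁻¹) Filter.univ_mem ?_ (integrable_arctan x) ?_ ?_ (integrable_const _) ?_).2
  · exact Filter.Eventually.of_forall fun x => (cont_arctan x).aestronglyMeasurable
  · refine Continuous.aestronglyMeasurable ?_
    exact Continuous.div (by fun_prop) (by fun_prop) (fun a => by positivity)
  · refine Filter.Eventually.of_forall fun a x _ => ?_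
    exact (abs_parts_le a x hy le_rfl).1
  · refine Filter.Eventually.of_forall fun a x _ => ?_
    have := (((hasDerivAt_id x).sub_const a).div_const y).arctan
    refine this.congr_deriv ?_
    simp only [id]
    field_simp
    ring

lemma hasDerivAt_vP_y (x : ℝ) {y : ℝ} (hy : 0 < y) :
    HasDerivAt (fun y => vP σ x y) (stj σ ⟨x, y⟩).re y := by
  rw [stj_re (z := ⟨x,y⟩) hy]
  simp only [(inv_sub_parts _ x y).2]
  have hs : Set.Ioi (y/2) ∈ nhds y := Ioi_mem_nhds (by linarith)
  refine (hasDerivAt_integral_of_dominated_loc_of_deriv_le (F := fun y a => arctan ((x - a) / y))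
    (F' := fun y a => (a - x) / ((x - a)^2 + y^2))
    (bound := fun _ => (y/2)⁻¹) hs ?_ (integrable_arctan x) ?_ ?_ (integrable_const _) ?_).2
  · exact Filter.Eventually.of_forall fun x => (cont_arctan _).aestronglyMeasurable
  · refine Continuous.aestronglyMeasurable ?_
    exact Continuous.div (by fun_prop) (by fun_prop) (fun a => by positivity)
  · refine Filter.Eventually.of_forall fun a t ht => ?_
    exact (abs_parts_le a x (by linarith) (le_of_lt ht)).2
  · refine Filter.Eventually.of_forall fun a t ht => ?_
    have ht0 : 0 < t := lt_trans (by linarith) ht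
    have := (((hasDerivAt_id t).fun_inv ht0.ne').const_mul (x - a)).arctan
    simp only [id, ← div_eq_mul_inv] at this
    refine this.congr_deriv ?_
    field_simp
    ring

lemma continuousOn_vP : ContinuousOn (fun p : ℝ × ℝ => vP σ p.1 p.2) {p | 0 < p.2} := by
  refine continuousOn_of_dominated (bound := fun _ => π/2) ?_ ?_ (integrable_const _) ?_
  · intro p _; exact (cont_arctan _).aestronglyMeasurable
  · intro p _
    refine Filter.Eventually.of_forall fun a => ?_
    rw [norm_eq_abs, abs_le]; exact ⟨(neg_pi_div_two_lt_arctan _).le, (arctan_lt_pi_div_two _).le⟩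
  · refine Filter.Eventually.of_forall fun a => ?_
    refine continuous_arctan.comp_continuousOn ?_
    refine ContinuousOn.div (by fun_prop) (by fun_prop) ?_
    intro p hp; exact ne_of_gt hp
end Pot

section Harm
open Real

/-- conjugate-harmonic data on the upper half plane -/
structure HarmPair (v : ℝ → ℝ → ℝ) (S : ℂ → ℂ) : Prop where
  dx : ∀ x y, 0 < y → HasDerivAt (fun x => v x y) (S ⟨x, y⟩).im x
  dy : ∀ x y, 0 < y → HasDerivAt (fun y => v x y) (S ⟨x, y⟩).re y
  diff : DifferentiableOn ℂ S {z | 0 < z.im}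
  cont : ContinuousOn (fun p : ℝ × ℝ => v p.1 p.2) {p | 0 < p.2}

lemma harmPair_vP (μ σ : Measure ℝ) [IsProbabilityMeasure μ] [IsProbabilityMeasure σ] :
    HarmPair (fun x y => vP μ x y - vP σ x y) (fun z => stj μ z - stj σ z) where
  dx x y hy := (hasDerivAt_vP_x x hy).sub (hasDerivAt_vP_x x hy)
  dy x y hy := (hasDerivAt_vP_y x hy).sub (hasDerivAt_vP_y x hy)
  diff z hz := ((hasDerivAt_stj hz).differentiableAt.sub (hasDerivAt_stj hz).differentiableAt).differentiableWithinAt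
  cont := continuousOn_vP.sub continuousOn_vP

variable {v : ℝ → ℝ → ℝ} {S : ℂ → ℂ}

lemma mk_hasDerivAt_x (x y : ℝ) : HasDerivAt (fun x : ℝ => (⟨x, y⟩ : ℂ)) 1 x := by
  have h : HasDerivAt (fun x : ℝ => (x : ℂ) + y * Complex.I) 1 x :=
    ((hasDerivAt_id x).ofReal_comp).add_const _
  refine h.congr_of_eventuallyEq (Filter.Eventually.of_forall fun t => ?_)
  exact Complex.mk_eq_add_mul_I t y

lemma mk_hasDerivAt_y (x y : ℝ) : HasDerivAt (fun y : ℝ => (⟨x, y⟩ : ℂ)) Complex.I y := by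
  have h : HasDerivAt (fun y : ℝ => (x : ℂ) + y * Complex.I) (1 * Complex.I) y :=
    (((hasDerivAt_id y).ofReal_comp).mul_const Complex.I).const_add _
  rw [one_mul] at h
  refine h.congr_of_eventuallyEq (Filter.Eventually.of_forall fun t => ?_)
  exact Complex.mk_eq_add_mul_I x t

lemma HarmPair.ineq (h : HarmPair v S) {b Y : ℝ} (hb : 0 < b) (hbY : b ≤ Y) :
    ∫ x in (-2:ℝ)..2, v x b ^ 2 ≤ (∫ x in (-2:ℝ)..2, v x Y ^ 2) +
      2 * Y * (∫ x in (-2:ℝ)..2, |v x Y * (S ⟨x, Y⟩).re|) +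
      2 * (∫ t in b..Y, t * ∫ x in (-2:ℝ)..2, ‖S ⟨x, t⟩‖ ^ 2) +
      2 * ∫ t in b..Y, t * (|v 2 t * (S ⟨2, t⟩).im| + |v (-2) t * (S ⟨-2, t⟩).im|) := by
  have hY : 0 < Y := hb.trans_le hbY
  have hop : IsOpen {z : ℂ | 0 < z.im} := isOpen_lt continuous_const Complex.continuous_im
  have hSd : ∀ x y, 0 < y → HasDerivAt S (deriv S ⟨x,y⟩) ⟨x, y⟩ := fun x y hy =>
    ((h.diff ⟨x,y⟩ hy).differentiableAt (hop.mem_nhds hy)).hasDerivAt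
  have hSx : ∀ x y, 0 < y → HasDerivAt (fun x : ℝ => S ⟨x, y⟩) (deriv S ⟨x,y⟩) x := by
    intro x y hy
    have := HasDerivAt.comp x (hSd x y hy) (mk_hasDerivAt_x x y)
    exact this.congr_deriv (mul_one _)
  have hSy : ∀ x y, 0 < y → HasDerivAt (fun y : ℝ => S ⟨x, y⟩) (deriv S ⟨x,y⟩ * Complex.I) y := by
    intro x y hy
    exact HasDerivAt.comp y (hSd x y hy) (mk_hasDerivAt_y x y)
  have hIx : ∀ x y, 0 < y → HasDerivAt (fun x : ℝ => (S ⟨x, y⟩).im) (deriv S ⟨x,y⟩).im x := fun x y hy =>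
    Complex.imCLM.hasFDerivAt.comp_hasDerivAt x (hSx x y hy)
  have hRy : ∀ x y, 0 < y → HasDerivAt (fun y : ℝ => (S ⟨x, y⟩).re) (-(deriv S ⟨x,y⟩).im) y := by
    intro x y hy
    have := Complex.reCLM.hasFDerivAt.comp_hasDerivAt y (hSy x y hy)
    refine this.congr_deriv ?_
    simp
  -- clamped joint continuity
  let c : ℝ → ℝ := fun t => max t b
  have hc : Continuous c := continuous_id.max continuous_const
  have hcp : ∀ t, 0 < c t := fun t => hb.trans_le (le_max_right _ _)
  have hce : ∀ t, b ≤ t → c t = t := fun t ht => max_eq_left ht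
  have hmk : Continuous fun p : ℝ × ℝ => (⟨p.1, c p.2⟩ : ℂ) := by
    have : (fun p : ℝ × ℝ => (⟨p.1, c p.2⟩ : ℂ)) = fun p => (p.1 : ℂ) + (c p.2 : ℂ) * Complex.I := by
      ext p; exact Complex.mk_eq_add_mul_I _ _
    rw [this]; fun_prop
  have hvC : Continuous fun p : ℝ × ℝ => v p.1 (c p.2) :=
    h.cont.comp_continuous (f := fun p : ℝ × ℝ => (p.1, c p.2)) (by fun_prop) (fun p => hcp p.2)
  have hSC : Continuous fun p : ℝ × ℝ => S ⟨p.1, c p.2⟩ :=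
    h.diff.continuousOn.comp_continuous hmk (fun p => hcp p.2)
  have hDC : Continuous fun p : ℝ × ℝ => deriv S ⟨p.1, c p.2⟩ :=
    (h.diff.deriv hop).continuousOn.comp_continuous hmk (fun p => hcp p.2)
  have hRC := Complex.continuous_re.comp hSC
  have hIC := Complex.continuous_im.comp hSC
  have hDIC := Complex.continuous_im.comp hDC
  simp only [Function.comp_def] at hRC hIC hDIC
  let q : ℝ → ℝ → ℝ := fun x t => (S ⟨x, c t⟩).re ^ 2 - v x (c t) * (deriv S ⟨x, c t⟩).im
  have hq : Continuous (Function.uncurry fun x t => (t - b) * (2 * q x t)) := by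
    show Continuous fun p : ℝ × ℝ => (p.2 - b) * (2 * ((S ⟨p.1, c p.2⟩).re ^ 2 - v p.1 (c p.2) * (deriv S ⟨p.1, c p.2⟩).im))
    exact (continuous_snd.fun_sub continuous_const).fun_mul (continuous_const.fun_mul ((hRC.fun_pow 2).fun_sub (hvC.fun_mul hDIC)))
  have htaylor : ∀ x, v x b ^ 2 = v x Y ^ 2 - (Y - b) * (2 * (v x Y * (S ⟨x, Y⟩).re)) +
      ∫ t in b..Y, (t - b) * (2 * q x t) := by
    intro x
    have hder : ∀ t ∈ Set.uIcc b Y, HasDerivAt (fun t => v x t ^ 2 - (t - b) * (2 * (v x t * (S ⟨x, t⟩).re)))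
        (-((t - b) * (2 * q x t))) t := by
      intro t ht
      rw [Set.uIcc_of_le hbY] at ht
      have ht0 : 0 < t := hb.trans_le ht.1
      have h1 := (h.dy x t ht0).pow 2
      have h2 := ((hasDerivAt_id t).sub_const b).mul (((h.dy x t ht0).mul (hRy x t ht0)).const_mul 2)
      refine (h1.sub h2).congr_deriv ?_
      simp only [q, hce t ht.1, id]
      simp
      ring
    have := intervalIntegral.integral_eq_sub_of_hasDerivAt hder
      (Continuous.intervalIntegrable (by
        exact (hq.comp (by fun_prop : Continuous fun t : ℝ => (x, t))).neg) _ _)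
    rw [intervalIntegral.integral_neg] at this
    simp only [sub_self, zero_mul, sub_zero] at this
    linarith
  have hparts : ∀ t, b ≤ t → ∫ x in (-2:ℝ)..2, q x t = (∫ x in (-2:ℝ)..2, ‖S ⟨x, t⟩‖^2) -
      (v 2 t * (S ⟨2,t⟩).im - v (-2) t * (S ⟨-2,t⟩).im) := by
    intro t ht
    have ht0 : 0 < t := hb.trans_le ht
    have hcx : Continuous fun x : ℝ => ((x, t) : ℝ × ℝ) := by fun_prop
    have hv' := hvC.comp hcx
    have hS' := hSC.comp hcx
    have hR' := hRC.comp hcx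
    have hI' := hIC.comp hcx
    have hD' := hDIC.comp hcx
    simp only [Function.comp_def, hce t ht] at hv' hS' hR' hI' hD'
    have hder : ∀ x ∈ Set.uIcc (-2:ℝ) 2, HasDerivAt (fun x => v x t * (S ⟨x, t⟩).im)
        ((S ⟨x, t⟩).im * (S ⟨x, t⟩).im + v x t * (deriv S ⟨x, t⟩).im) x := fun x _ =>
      (h.dx x t ht0).mul (hIx x t ht0)
    have hcc := (hI'.fun_mul hI').fun_add (hv'.fun_mul hD')
    have := intervalIntegral.integral_eq_sub_of_hasDerivAt hder
      (hcc.intervalIntegrable _ _)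
    rw [← this, ← intervalIntegral.integral_sub ((hS'.norm.fun_pow 2).intervalIntegrable _ _)
      (hcc.intervalIntegrable _ _)]
    refine intervalIntegral.integral_congr fun x _ => ?_
    simp only [q, hce t ht, Complex.sq_norm, Complex.normSq_apply]
    ring
  have hswap : ∫ x in (-2:ℝ)..2, ∫ t in b..Y, (t - b) * (2 * q x t) =
      ∫ t in b..Y, (t - b) * (2 * ∫ x in (-2:ℝ)..2, q x t) := by
    rw [intervalIntegral_intervalIntegral_swap]
    · refine intervalIntegral.integral_congr fun t _ => ?_
      simp only [intervalIntegral.integral_const_mul]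
    · exact (hq.locallyIntegrable).integrableOn_isCompact (isCompact_uIcc.prod isCompact_uIcc) |>.mono_set
        (Set.prod_mono Set.uIoc_subset_uIcc Set.uIoc_subset_uIcc)
  have hcY : c Y = Y := hce Y hbY
  have hcb : c b = b := hce b le_rfl
  have hcontxY : Continuous fun x : ℝ => v x Y := by
    have := hvC.comp (by fun_prop : Continuous fun x : ℝ => ((x, Y) : ℝ × ℝ))
    simpa only [Function.comp_def, hcY] using this
  have hcontRY : Continuous fun x : ℝ => (S ⟨x, Y⟩).re := by
    have := hRC.comp (by fun_prop : Continuous fun x : ℝ => ((x, Y) : ℝ × ℝ))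
    simpa only [Function.comp_def, hcY] using this
  have hpar : Continuous fun x => ∫ t in b..Y, (t - b) * (2 * q x t) :=
    intervalIntegral.continuous_parametric_intervalIntegral_of_continuous' hq _ _
  have hmain : ∫ x in (-2:ℝ)..2, v x b ^ 2 = (∫ x in (-2:ℝ)..2, v x Y ^ 2) -
      (Y - b) * (2 * ∫ x in (-2:ℝ)..2, (v x Y * (S ⟨x, Y⟩).re)) +
      ∫ t in b..Y, (t - b) * (2 * ∫ x in (-2:ℝ)..2, q x t) := by
    rw [← hswap]
    simp only [htaylor]
    rw [intervalIntegral.integral_add (Continuous.intervalIntegrable (by fun_prop) _ _) (hpar.intervalIntegrable _ _),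
      intervalIntegral.integral_sub (Continuous.intervalIntegrable (by fun_prop) _ _) (Continuous.intervalIntegrable (by fun_prop) _ _),
      intervalIntegral.integral_const_mul, intervalIntegral.integral_const_mul]
  rw [hmain]
  have e1 : - ((Y - b) * (2 * ∫ x in (-2:ℝ)..2, (v x Y * (S ⟨x, Y⟩).re))) ≤
      2 * Y * (∫ x in (-2:ℝ)..2, |v x Y * (S ⟨x, Y⟩).re|) := by
    have := intervalIntegral.abs_integral_le_integral_abs (μ := volume) (f := fun x => v x Y * (S ⟨x, Y⟩).re) (by norm_num : (-2:ℝ) ≤ 2)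
    have h0 := neg_le_of_abs_le this
    have h1 : 0 ≤ ∫ x in (-2:ℝ)..2, |v x Y * (S ⟨x, Y⟩).re| := (abs_nonneg _).trans this
    nlinarith
  -- continuity in t of the pieces
  have hN : Continuous fun t => ∫ x in (-2:ℝ)..2, ‖S ⟨x, c t⟩‖^2 :=
    intervalIntegral.continuous_parametric_intervalIntegral_of_continuous'
      (f := fun t x => ‖S ⟨x, c t⟩‖^2)
      (((hSC.norm.fun_pow 2).comp continuous_swap : Continuous ((fun p : ℝ × ℝ => ‖S ⟨p.1, c p.2⟩‖^2) ∘ Prod.swap))) _ _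
  have hbd : ∀ z : ℝ, Continuous fun t => v z (c t) * (S ⟨z, c t⟩).im := by
    intro z
    exact (hvC.comp (by fun_prop : Continuous fun t : ℝ => ((z, t) : ℝ × ℝ))).mul
      (hIC.comp (by fun_prop : Continuous fun t : ℝ => ((z, t) : ℝ × ℝ)))
  have hqpar : Continuous fun t => ∫ x in (-2:ℝ)..2, q x t := by
    refine intervalIntegral.continuous_parametric_intervalIntegral_of_continuous' (f := fun t x => q x t) ?_ _ _
    show Continuous fun p : ℝ × ℝ => ((S ⟨p.2, c p.1⟩).re ^ 2 - v p.2 (c p.1) * (deriv S ⟨p.2, c p.1⟩).im)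
    have a1 := hRC.comp continuous_swap
    have a2 := hvC.comp continuous_swap
    have a3 := hDIC.comp continuous_swap
    exact (a1.fun_pow 2).fun_sub (a2.fun_mul a3)
  have e2 : ∫ t in b..Y, (t - b) * (2 * ∫ x in (-2:ℝ)..2, q x t) ≤
      2 * (∫ t in b..Y, t * ∫ x in (-2:ℝ)..2, ‖S ⟨x, t⟩‖ ^ 2) +
      2 * ∫ t in b..Y, t * (|v 2 t * (S ⟨2, t⟩).im| + |v (-2) t * (S ⟨-2, t⟩).im|) := by
    have r1 : ∫ t in b..Y, t * ∫ x in (-2:ℝ)..2, ‖S ⟨x, t⟩‖ ^ 2 = ∫ t in b..Y, t * ∫ x in (-2:ℝ)..2, ‖S ⟨x, c t⟩‖ ^ 2 := by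
      refine intervalIntegral.integral_congr fun t ht => ?_
      rw [Set.uIcc_of_le hbY] at ht
      simp only [hce t ht.1]
    have r2 : ∫ t in b..Y, t * (|v 2 t * (S ⟨2, t⟩).im| + |v (-2) t * (S ⟨-2, t⟩).im|) =
        ∫ t in b..Y, t * (|v 2 (c t) * (S ⟨2, c t⟩).im| + |v (-2) (c t) * (S ⟨-2, c t⟩).im|) := by
      refine intervalIntegral.integral_congr fun t ht => ?_
      rw [Set.uIcc_of_le hbY] at ht
      simp only [hce t ht.1]
    rw [r1, r2, ← mul_add, ← intervalIntegral.integral_add ((continuous_id'.fun_mul hN).intervalIntegrable _ _)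
      ((continuous_id'.fun_mul ((hbd 2).abs.fun_add (hbd (-2)).abs)).intervalIntegrable _ _), ← intervalIntegral.integral_const_mul]
    refine intervalIntegral.integral_mono_on hbY
      (((continuous_id'.fun_sub continuous_const).fun_mul (continuous_const.fun_mul hqpar)).intervalIntegrable _ _)
      ((continuous_const.fun_mul ((continuous_id'.fun_mul hN).fun_add (continuous_id'.fun_mul ((hbd 2).abs.fun_add (hbd (-2)).abs)))).intervalIntegrable _ _) fun t ht => ?_
    rw [hparts t ht.1]
    simp only [hce t ht.1, id]
    have hn : 0 ≤ ∫ x in (-2:ℝ)..2, ‖S ⟨x, t⟩‖ ^ 2 :=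
      intervalIntegral.integral_nonneg (by norm_num) fun x _ => by positivity
    set p1 := v 2 t * (S ⟨2, t⟩).im
    set p2 := v (-2) t * (S ⟨-2, t⟩).im
    have := ht.1
    have h1 := neg_abs_le p1
    have h2 := le_abs_self p2
    have h3 : (∫ x in (-2:ℝ)..2, ‖S ⟨x, t⟩‖ ^ 2) - (p1 - p2) ≤ (∫ x in (-2:ℝ)..2, ‖S ⟨x, t⟩‖ ^ 2) + (|p1| + |p2|) := by linarith
    have h4 : 0 ≤ (∫ x in (-2:ℝ)..2, ‖S ⟨x, t⟩‖ ^ 2) + (|p1| + |p2|) := by positivity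
    calc (t - b) * (2 * ((∫ x in (-2:ℝ)..2, ‖S ⟨x, t⟩‖ ^ 2) - (p1 - p2)))
        ≤ (t - b) * (2 * ((∫ x in (-2:ℝ)..2, ‖S ⟨x, t⟩‖ ^ 2) + (|p1| + |p2|))) := by
          apply mul_le_mul_of_nonneg_left _ (by linarith); linarith
      _ ≤ t * (2 * ((∫ x in (-2:ℝ)..2, ‖S ⟨x, t⟩‖ ^ 2) + (|p1| + |p2|))) := by
          apply mul_le_mul_of_nonneg_right _ (by linarith); linarith
      _ = _ := by ring
  linarith
end Harm

open MeasureTheory ProbabilityTheory Matrix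
open scoped Matrix ENNReal
set_option linter.unusedSectionVars false

section Ker
open Real

lemma arctan_gap {w : ℝ} (hw : 0 ≤ w) : 0 ≤ 2 * arctan w - arctan (2 * w) ∧
    2 * arctan w - arctan (2 * w) ≤ 12 * (w ^ 2 / (1 + w ^ 2)) := by
  have hd : ∀ w : ℝ, HasDerivAt (fun w => 2 * arctan w - arctan (2 * w))
      (6 * w ^ 2 / ((1 + w ^ 2) * (1 + 4 * w ^ 2))) w := by
    intro w
    have h := ((hasDerivAt_arctan w).const_mul 2).sub (((hasDerivAt_id w).const_mul 2).arctan)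
    refine h.congr_deriv ?_
    simp only [id]
    have : (1 + 4 * w ^ 2) ≠ 0 := by positivity
    have h2 : (1 + (2 * w) ^ 2) = 1 + 4 * w^2 := by ring
    rw [h2]
    field_simp
    ring
  have hmono : Monotone (fun w => 2 * arctan w - arctan (2 * w)) :=
    monotone_of_deriv_nonneg (fun w => (hd w).differentiableAt) (fun w => by rw [(hd w).deriv]; positivity)
  have h0 := hmono hw
  simp only [arctan_zero, mul_zero, sub_zero] at h0
  refine ⟨h0, ?_⟩
  have hm2 : MonotoneOn (fun w => 6 * w ^ 2 - (2 * arctan w - arctan (2 * w))) (Set.Ici 0) := by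
    have hd2 : ∀ w : ℝ, HasDerivAt (fun w => 6 * w ^ 2 - (2 * arctan w - arctan (2 * w)))
        (6 * (2 * w) - 6 * w ^ 2 / ((1 + w ^ 2) * (1 + 4 * w ^ 2))) w := by
      intro w
      have := (((hasDerivAt_pow 2 w).const_mul 6).sub (hd w))
      refine this.congr_deriv ?_
      simp
    refine monotoneOn_of_deriv_nonneg (convex_Ici 0) (fun w _ => (hd2 w).continuousAt.continuousWithinAt)
      (fun w _ => (hd2 w).differentiableAt.differentiableWithinAt) ?_
    intro w hw
    rw [interior_Ici] at hw
    have hw' : 0 < w := hw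
    rw [(hd2 w).deriv, sub_nonneg, div_le_iff₀ (by positivity)]
    have : 0 ≤ w * (2 * ((1 + w ^ 2) * (1 + 4 * w ^ 2)) - w) := by
      apply mul_nonneg hw'.le
      nlinarith [sq_nonneg (w - 1), sq_nonneg (w^2)]
    nlinarith
  have h1 := hm2 (Set.mem_Ici.2 le_rfl) (Set.mem_Ici.2 hw) hw
  simp only [arctan_zero, mul_zero, sub_zero] at h1
  norm_num at h1
  rcases le_total w 1 with h | h
  · have : 6 * w ^ 2 ≤ 12 * (w ^ 2 / (1 + w ^ 2)) := by
      rw [← mul_div_assoc, le_div_iff₀ (by positivity)]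
      nlinarith [sq_nonneg w, mul_nonneg (sq_nonneg w) (by nlinarith : 0 ≤ 1 - w^2)]
    linarith
  · have : 6 ≤ 12 * (w ^ 2 / (1 + w ^ 2)) := by
      rw [← mul_div_assoc, le_div_iff₀ (by positivity)]
      nlinarith
    have h2 := arctan_lt_pi_div_two w
    have h3 : 0 ≤ arctan (2 * w) := arctan_nonneg.2 (by linarith)
    have := pi_lt_four
    linarith

/-- smoothing kernel -/
noncomputable def qK (y v : ℝ) : ℝ := (2 / π) * arctan (v / y) - (1 / π) * arctan (v / (2 * y))

lemma qK_pos {y v : ℝ} (hy : 0 < y) (hv : 0 ≤ v) : |qK y v - 1 / 2| ≤ (12 / π) * (y ^ 2 / (v ^ 2 + y ^ 2)) := by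
  rcases hv.eq_or_lt with rfl | hv
  · simp [qK]
    have : y ^ 2 / y ^ 2 = 1 := by field_simp
    rw [this, mul_one, le_div_iff₀ pi_pos]
    linarith [pi_lt_four]
  · have hw : 0 < y / v := by positivity
    have e1 : arctan (v / y) = π / 2 - arctan (y / v) := by
      rw [← arctan_inv_of_pos hw, inv_div]
    have e2 : arctan (v / (2 * y)) = π / 2 - arctan (2 * (y / v)) := by
      rw [← arctan_inv_of_pos (by positivity)]
      congr 1; field_simp
    have h := arctan_gap hw.le
    have e3 : qK y v - 1/2 = -((1/π) * (2 * arctan (y/v) - arctan (2 * (y/v)))) := by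
      rw [qK, e1, e2]; field_simp; ring
    have e4 : (y/v)^2 / (1 + (y/v)^2) = y^2/(v^2+y^2) := by field_simp
    rw [e3, abs_neg, abs_of_nonneg (mul_nonneg (by positivity) h.1), ← e4]
    calc _ ≤ (1/π) * (12 * ((y/v)^2 / (1 + (y/v)^2))) := mul_le_mul_of_nonneg_left h.2 (by positivity)
      _ = _ := by ring

lemma qK_neg {y v : ℝ} (hy : 0 < y) (hv : v ≤ 0) : |qK y v + 1 / 2| ≤ (12 / π) * (y ^ 2 / (v ^ 2 + y ^ 2)) := by
  have h := qK_pos hy (v := -v) (by linarith)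
  have e : qK y (-v) = - qK y v := by rw [qK, qK, neg_div, neg_div, arctan_neg, arctan_neg]; ring
  rw [e, neg_sq] at h
  rw [← abs_neg]
  convert h using 2
  ring

lemma ker_int {y : ℝ} (hy : 0 < y) (a s t : ℝ) (hst : s ≤ t) :
    ∫ x in s..t, (12 / π) * (y ^ 2 / ((x - a) ^ 2 + y ^ 2)) = (12 * y / π) * (arctan ((t - a)/y) - arctan ((s - a)/y)) := by
  have hd : ∀ x ∈ Set.uIcc s t, HasDerivAt (fun x => (12 * y / π) * arctan ((x - a)/y))
      ((12 / π) * (y ^ 2 / ((x - a) ^ 2 + y ^ 2))) x := by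
    intro x _
    have := ((((hasDerivAt_id x).sub_const a).div_const y).arctan).const_mul (12 * y / π)
    refine this.congr_deriv ?_
    simp only [id]
    field_simp
    ring
  rw [intervalIntegral.integral_eq_sub_of_hasDerivAt hd]
  · ring
  · refine Continuous.intervalIntegrable ?_ _ _
    exact continuous_const.fun_mul (Continuous.div (by fun_prop) (by fun_prop) (fun a => by positivity))

/-- clip to [-2,2] -/
noncomputable def clip2 (a : ℝ) : ℝ := max (-2) (min a 2)

lemma clip2_mem (a : ℝ) : clip2 a ∈ Set.Icc (-2:ℝ) 2 :=
  ⟨le_max_left _ _, max_le (by norm_num) (min_le_right _ _)⟩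

lemma clip2_of_mem {a : ℝ} (h : a ∈ Set.Icc (-2:ℝ) 2) : clip2 a = a := by
  rw [clip2, min_eq_left h.2, max_eq_right h.1]

lemma clip2_cont : Continuous clip2 := by unfold clip2; fun_prop

lemma cont_qK {y : ℝ} : Continuous (qK y) := by unfold qK; fun_prop

lemma clip_resid {f f' : ℝ → ℝ} (hf : ∀ x, HasDerivAt f (f' x) x) (hf' : Continuous f') {M : ℝ}
    (hM : ∀ x ∈ Set.Icc (-2:ℝ) 2, |f' x| ≤ M) {y : ℝ} (hy : 0 < y) (a : ℝ) :
    |f (clip2 a) - (f 2 + f (-2)) / 2 + ∫ x in (-2:ℝ)..2, f' x * qK y (x - a)| ≤ 12 * M * y := by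
  set c := clip2 a with hc
  have hcm := clip2_mem a
  rw [← hc] at hcm
  have hM0 : 0 ≤ M := (abs_nonneg _).trans (hM 0 (by norm_num))
  have hq : Continuous fun x => qK y (x - a) := cont_qK.comp (by fun_prop)
  have hI : ∀ g : ℝ → ℝ, Continuous g → ∀ s t, IntervalIntegrable g volume s t := fun g hg s t => hg.intervalIntegrable s t
  have h1 : f c - f (-2) = ∫ x in (-2:ℝ)..c, f' x :=
    (intervalIntegral.integral_eq_sub_of_hasDerivAt (fun x _ => hf x) (hI _ hf' _ _)).symm
  have h2 : f 2 - f c = ∫ x in c..2, f' x :=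
    (intervalIntegral.integral_eq_sub_of_hasDerivAt (fun x _ => hf x) (hI _ hf' _ _)).symm
  have hfq := hf'.fun_mul hq
  have e : f c - (f 2 + f (-2)) / 2 + ∫ x in (-2:ℝ)..2, f' x * qK y (x - a) =
      (∫ x in (-2:ℝ)..c, f' x * (qK y (x - a) + 1/2)) + ∫ x in c..2, f' x * (qK y (x - a) - 1/2) := by
    rw [← intervalIntegral.integral_add_adjacent_intervals (hI _ hfq (-2) c) (hI _ hfq c 2)]
    simp only [mul_add, mul_sub]
    rw [intervalIntegral.integral_add (hI _ hfq _ _) (hI _ (by fun_prop) _ _),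
      intervalIntegral.integral_sub (hI _ hfq _ _) (hI _ (by fun_prop) _ _),
      intervalIntegral.integral_mul_const, intervalIntegral.integral_mul_const, ← h1, ← h2]
    ring
  rw [e]
  have hkc : Continuous fun x => M * ((12 / π) * (y ^ 2 / ((x - a) ^ 2 + y ^ 2))) :=
    continuous_const.fun_mul (continuous_const.fun_mul (Continuous.div (by fun_prop) (by fun_prop) (fun a => by positivity)))
  have b1 : |∫ x in (-2:ℝ)..c, f' x * (qK y (x - a) + 1/2)| ≤ ∫ x in (-2:ℝ)..c, M * ((12 / π) * (y ^ 2 / ((x - a) ^ 2 + y ^ 2))) := by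
    refine (intervalIntegral.abs_integral_le_integral_abs hcm.1).trans ?_
    refine intervalIntegral.integral_mono_on_of_le_Ioo hcm.1
      (hI _ (hf'.fun_mul (hq.fun_add continuous_const)).abs _ _) (hI _ hkc _ _) fun x hx => ?_
    rw [abs_mul]
    have hxa : x ≤ a := by
      have : x < c := hx.2
      rw [hc, clip2, lt_max_iff] at this
      rcases this with h | h
      · linarith [hx.1]
      · exact (h.trans_le (min_le_left _ _)).le
    exact mul_le_mul (hM x ⟨hx.1.le, hx.2.le.trans hcm.2⟩) (qK_neg hy (by linarith)) (abs_nonneg _) hM0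
  have b2 : |∫ x in c..2, f' x * (qK y (x - a) - 1/2)| ≤ ∫ x in c..2, M * ((12 / π) * (y ^ 2 / ((x - a) ^ 2 + y ^ 2))) := by
    refine (intervalIntegral.abs_integral_le_integral_abs hcm.2).trans ?_
    refine intervalIntegral.integral_mono_on_of_le_Ioo hcm.2
      (hI _ (hf'.fun_mul (hq.fun_sub continuous_const)).abs _ _) (hI _ hkc _ _) fun x hx => ?_
    rw [abs_mul]
    have hxa : a ≤ x := by
      have h0 : c < x := hx.1
      rw [hc, clip2, max_lt_iff, min_lt_iff] at h0
      rcases h0.2 with h | h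
      · exact h.le
      · linarith [hx.2]
    exact mul_le_mul (hM x ⟨hcm.1.trans hx.1.le, hx.2.le⟩) (qK_pos hy (by linarith)) (abs_nonneg _) hM0
  refine (abs_add_le _ _).trans ((add_le_add b1 b2).trans ?_)
  rw [intervalIntegral.integral_add_adjacent_intervals (hI _ hkc _ _) (hI _ hkc _ _),
    intervalIntegral.integral_const_mul, ker_int hy a _ _ (by norm_num)]
  have a1 := arctan_lt_pi_div_two ((2 - a)/y)
  have a2 := neg_pi_div_two_lt_arctan ((-2 - a)/y)
  have : (12 * y / π) * (arctan ((2 - a)/y) - arctan ((-2 - a)/y)) ≤ (12 * y / π) * π :=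
    mul_le_mul_of_nonneg_left (by linarith) (by positivity)
  have e5 : (12 * y / π) * π = 12 * y := by field_simp
  rw [e5] at this
  calc _ ≤ M * (12 * y) := mul_le_mul_of_nonneg_left this hM0
    _ = _ := by ring
end Ker

open MeasureTheory ProbabilityTheory Matrix
open scoped Matrix ENNReal
set_option linter.unusedSectionVars false

section W1
open Real NNReal

/-- a compactly supported-like probability measure: all continuous functions integrable -/
structure NiceM (μ : Measure ℝ) : Prop where
  prob : IsProbabilityMeasure μ
  int : ∀ {f : ℝ → ℝ}, Continuous f → Integrable f μ

lemma sc_nice : NiceM semicircle := ⟨inferInstance, fun h => sc_integrable h⟩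

variable {μ : Measure ℝ}

lemma W1m_bdd (hμ : NiceM μ) : BddAbove (Set.range fun f : {f : ℝ → ℝ // LipschitzWith 1 f} =>
    |(∫ x, f.1 x ∂μ) - ∫ x, f.1 x ∂semicircle|) := by
  have := hμ.prob
  refine ⟨(∫ x, |x| ∂μ) + ∫ x, |x| ∂semicircle, ?_⟩
  rintro _ ⟨⟨f, hf⟩, rfl⟩
  have key : ∀ {σ : Measure ℝ}, NiceM σ → |(∫ x, f x ∂σ) - f 0| ≤ ∫ x, |x| ∂σ := by
    intro σ hσ
    have := hσ.prob
    have e : (∫ x, f x ∂σ) - f 0 = ∫ x, (f x - f 0) ∂σ := by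
      rw [integral_sub (hσ.int hf.continuous) (integrable_const _)]; simp
    rw [e]
    refine abs_integral_le_integral_abs.trans (integral_mono ?_ (hσ.int continuous_abs) fun x => ?_)
    · exact (hσ.int (f := fun x => |f x - f 0|) (by have := hf.continuous; fun_prop))
    · have := hf.dist_le_mul x 0
      simpa [Real.dist_eq] using this
  have h1 := key hμ
  have h2 := key sc_nice
  calc |(∫ x, f x ∂μ) - ∫ x, f x ∂semicircle| = |((∫ x, f x ∂μ) - f 0) - ((∫ x, f x ∂semicircle) - f 0)| := by ring_nf
    _ ≤ _ := (abs_sub _ _).trans (add_le_add h1 h2)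

lemma le_W1m (hμ : NiceM μ) {f : ℝ → ℝ} (hf : LipschitzWith 1 f) :
    |(∫ x, f x ∂μ) - ∫ x, f x ∂semicircle| ≤ W1m μ semicircle :=
  le_ciSup (W1m_bdd hμ) ⟨f, hf⟩

instance : Nonempty {f : ℝ → ℝ // LipschitzWith 1 f} := ⟨⟨id, LipschitzWith.id⟩⟩

lemma W1m_le {c : ℝ} (h : ∀ f : ℝ → ℝ, LipschitzWith 1 f → |(∫ x, f x ∂μ) - ∫ x, f x ∂semicircle| ≤ c) :
    W1m μ semicircle ≤ c := ciSup_le fun f => h f.1 f.2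

lemma W1m_nonneg : 0 ≤ W1m μ semicircle := Real.iSup_nonneg fun _ => abs_nonneg _

lemma le_W1m_mul (hμ : NiceM μ) {f : ℝ → ℝ} {K : ℝ} (hK : 0 < K) (hf : ∀ x y, |f x - f y| ≤ K * |x - y|) :
    |(∫ x, f x ∂μ) - ∫ x, f x ∂semicircle| ≤ K * W1m μ semicircle := by
  have h : LipschitzWith 1 (fun x => K⁻¹ * f x) := by
    refine LipschitzWith.of_dist_le_mul fun x y => ?_
    rw [Real.dist_eq, Real.dist_eq, ← mul_sub, abs_mul, abs_of_pos (inv_pos.2 hK), inv_mul_le_iff₀ hK]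
    simpa using hf x y
  have := le_W1m hμ h
  rw [integral_const_mul, integral_const_mul, ← mul_sub, abs_mul, abs_of_pos (inv_pos.2 hK), inv_mul_le_iff₀ hK] at this
  exact this

/-- difference potential -/
noncomputable def vD (μ : Measure ℝ) (x y : ℝ) : ℝ := vP μ x y - vP semicircle x y
noncomputable def SD (μ : Measure ℝ) (z : ℂ) : ℂ := stj μ z - stj semicircle z

lemma harm_D (hμ : NiceM μ) : HarmPair (vD μ) (SD μ) := by
  have := hμ.prob
  exact harmPair_vP μ semicircle

lemma lip_of_deriv {f f' : ℝ → ℝ} {K : ℝ} (hf : ∀ x, HasDerivAt f (f' x) x) (h : ∀ x, |f' x| ≤ K) (x y : ℝ) :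
    |f x - f y| ≤ K * |x - y| := by
  have := Convex.norm_image_sub_le_of_norm_hasDerivWithin_le (f := f) (f' := f') (s := Set.univ) (x := y) (y := x)
    (fun x _ => (hf x).hasDerivWithinAt) (fun x _ => h x) convex_univ (Set.mem_univ _) (Set.mem_univ _)
  simpa using this

lemma vD_le (hμ : NiceM μ) (x : ℝ) {y : ℝ} (hy : 0 < y) : |vD μ x y| ≤ y⁻¹ * W1m μ semicircle := by
  refine le_W1m_mul hμ (inv_pos.2 hy) ?_
  refine lip_of_deriv (f' := fun a => -(y / ((x - a)^2 + y^2))) (fun a => ?_) (fun a => ?_)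
  · have := (((hasDerivAt_id a).const_sub x).div_const y).arctan
    refine this.congr_deriv ?_
    simp only [id]
    field_simp
    ring
  · rw [abs_neg]; exact (abs_parts_le a x hy le_rfl).1

lemma SD_re_le (hμ : NiceM μ) (x : ℝ) {y : ℝ} (hy : 0 < y) : |(SD μ ⟨x, y⟩).re| ≤ (y^2)⁻¹ * W1m μ semicircle := by
  have := hμ.prob
  rw [SD, Complex.sub_re, stj_re (z := ⟨x,y⟩) hy, stj_re (z := ⟨x,y⟩) hy]
  simp only [(inv_sub_parts _ x y).2]
  refine le_W1m_mul hμ (by positivity) ?_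
  refine lip_of_deriv (f' := fun a => (y^2 - (a-x)^2) / ((x - a)^2 + y^2)^2) (fun a => ?_) (fun a => ?_)
  · have h1 := (hasDerivAt_id' a).sub_const x
    have h2 := (((hasDerivAt_id' a).const_sub x).fun_pow 2).add_const (y^2)
    have hp : (x - a)^2 + y^2 ≠ 0 := by positivity
    have := h1.fun_div h2 hp
    refine this.congr_deriv ?_
    congr 1
    push_cast
    simp only [Nat.add_one_sub_one, pow_one]
    ring
  · have hp : 0 < (x - a)^2 + y^2 := by positivity
    rw [abs_div, abs_of_pos (pow_pos hp 2), div_le_iff₀ (pow_pos hp 2), ← div_eq_inv_mul, le_div_iff₀ (by positivity)]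
    have h1 : |y^2 - (a-x)^2| ≤ (x - a)^2 + y^2 := by
      rw [abs_le]; constructor <;> nlinarith [sq_nonneg (x-a), sq_nonneg y]
    nlinarith [sq_nonneg (x-a), sq_nonneg y]

lemma clip_test (hμ : NiceM μ) {f f' : ℝ → ℝ} (hf : ∀ x, HasDerivAt f (f' x) x) (hf' : Continuous f') {M : ℝ}
    (hM : ∀ x ∈ Set.Icc (-2:ℝ) 2, |f' x| ≤ M) {y : ℝ} (hy : 0 < y) :
    |(∫ a, f (clip2 a) ∂μ) - ∫ a, f (clip2 a) ∂semicircle| ≤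
      M * ((2/π) * (∫ x in (-2:ℝ)..2, |vD μ x y|) + (1/π) * (∫ x in (-2:ℝ)..2, |vD μ x (2 * y)|)) + 24 * M * y := by
  have := hμ.prob
  have hfc : Continuous f := continuous_iff_continuousAt.2 fun x => (hf x).continuousAt
  have hM0 : 0 ≤ M := (abs_nonneg _).trans (hM 0 (by norm_num))
  have hFc : Continuous fun a => f (clip2 a) := hfc.comp clip2_cont
  set c0 := (f 2 + f (-2)) / 2
  let J : ℝ → ℝ := fun a => ∫ x in (-2:ℝ)..2, f' x * qK y (x - a)
  have hunc : Continuous (Function.uncurry fun a x => f' x * qK y (x - a)) := by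
    show Continuous fun p : ℝ × ℝ => f' p.2 * qK y (p.2 - p.1)
    exact (hf'.comp continuous_snd).fun_mul (cont_qK.comp (by fun_prop))
  have hJ : Continuous J := intervalIntegral.continuous_parametric_intervalIntegral_of_continuous' hunc _ _
  have hres : ∀ {σ : Measure ℝ}, NiceM σ → |(∫ a, f (clip2 a) ∂σ) - c0 + ∫ a, J a ∂σ| ≤ 12 * M * y := by
    intro σ hσ
    have := hσ.prob
    have e : (∫ a, f (clip2 a) ∂σ) - c0 + ∫ a, J a ∂σ = ∫ a, (f (clip2 a) - c0 + J a) ∂σ := by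
      rw [integral_add (hσ.int (f := fun a => f (clip2 a) - c0) (hFc.fun_sub continuous_const)) (hσ.int hJ),
        integral_sub (hσ.int hFc) (integrable_const _)]
      simp
    rw [e]
    have := norm_integral_le_of_norm_le_const (μ := σ) (f := fun a => f (clip2 a) - c0 + J a) (C := 12 * M * y)
      (Filter.Eventually.of_forall fun a => clip_resid hf hf' hM hy a)
    simpa using this
  have hfub : ∀ {σ : Measure ℝ}, NiceM σ → ∫ a, J a ∂σ = ∫ x in (-2:ℝ)..2, f' x * ((2/π) * vP σ x y - (1/π) * vP σ x (2*y)) := by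
    intro σ hσ
    have := hσ.prob
    have hs : ∫ a, J a ∂σ = ∫ x in (-2:ℝ)..2, ∫ a, f' x * qK y (x - a) ∂σ := by
      symm
      apply intervalIntegral_integral_swap
      have hfin : IsFiniteMeasure ((volume : Measure ℝ).restrict (Set.uIoc (-2:ℝ) 2)) := by
        rw [Set.uIoc_of_le (by norm_num)]; infer_instance
      obtain ⟨B, hB⟩ := isCompact_Icc.exists_bound_of_continuousOn (hf'.continuousOn (s := Set.Icc (-2:ℝ) 2))
      refine Integrable.of_bound (C := |B| * (3/2)) ?_ ?_
      · exact (hunc.comp continuous_swap).aestronglyMeasurable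
      · rw [Set.uIoc_of_le (by norm_num)]
        have hr : (volume.restrict (Set.Ioc (-2:ℝ) 2)).prod σ = (volume.prod σ).restrict (Set.Ioc (-2:ℝ) 2 ×ˢ Set.univ) := by
          rw [← Measure.prod_restrict, Measure.restrict_univ]
        rw [hr]
        refine (ae_restrict_mem (measurableSet_Ioc.prod MeasurableSet.univ)).mono fun p hp => ?_
        have h1 : ‖f' p.1‖ ≤ |B| := (hB p.1 (Set.Ioc_subset_Icc_self hp.1)).trans (le_abs_self _)
        have h2 : ‖qK y (p.1 - p.2)‖ ≤ 3/2 := by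
          rw [norm_eq_abs]
          set w := p.1 - p.2
          have k1 : ∀ s : ℝ, |arctan s| ≤ π/2 := fun s => by
            rw [abs_le]; exact ⟨(neg_pi_div_two_lt_arctan _).le, (arctan_lt_pi_div_two _).le⟩
          have k2 := k1 (w / y)
          have k3 := k1 (w / (2 * y))
          calc |qK y w| ≤ (2/π) * |arctan (w / y)| + (1/π) * |arctan (w / (2*y))| := by
                rw [qK]
                refine (abs_sub _ _).trans ?_
                rw [abs_mul, abs_mul, abs_of_pos (by positivity : 0 < 2/π), abs_of_pos (by positivity : 0 < 1/π)]
            _ ≤ (2/π) * (π/2) + (1/π) * (π/2) := by gcongr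
            _ = 3/2 := by field_simp; norm_num
        show ‖f' p.1 * qK y (p.1 - p.2)‖ ≤ _
        rw [norm_mul]
        exact mul_le_mul h1 h2 (norm_nonneg _) (abs_nonneg _)
    rw [hs]
    refine intervalIntegral.integral_congr fun x _ => ?_
    beta_reduce
    rw [integral_const_mul]
    congr 1
    simp only [qK]
    rw [integral_sub ((integrable_arctan x).const_mul _) ((integrable_arctan x).const_mul _), integral_const_mul, integral_const_mul]
    rfl
  have hvc : ∀ {t : ℝ}, 0 < t → ∀ {σ : Measure ℝ}, NiceM σ → Continuous fun x => vP σ x t := by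
    intro t ht σ hσ
    have := hσ.prob
    exact continuous_iff_continuousAt.2 fun x => (hasDerivAt_vP_x x ht).continuousAt
  have hy2 : 0 < 2 * y := by linarith
  have c1 := hvc hy hμ
  have c2 := hvc hy2 hμ
  have c3 := hvc hy sc_nice
  have c4 := hvc hy2 sc_nice
  have hd1 : Continuous fun x => vD μ x y := c1.sub c3
  have hd2 : Continuous fun x => vD μ x (2*y) := c2.sub c4
  have hdiff : (∫ a, J a ∂μ) - ∫ a, J a ∂semicircle =
      ∫ x in (-2:ℝ)..2, f' x * ((2/π) * vD μ x y - (1/π) * vD μ x (2*y)) := by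
    rw [hfub hμ, hfub sc_nice, ← intervalIntegral.integral_sub (Continuous.intervalIntegrable (by fun_prop) _ _)
      (Continuous.intervalIntegrable (by fun_prop) _ _)]
    refine intervalIntegral.integral_congr fun x _ => ?_
    simp only [vD]; ring
  have hbd : |(∫ a, J a ∂μ) - ∫ a, J a ∂semicircle| ≤
      M * ((2/π) * (∫ x in (-2:ℝ)..2, |vD μ x y|) + (1/π) * (∫ x in (-2:ℝ)..2, |vD μ x (2 * y)|)) := by
    rw [hdiff]
    refine (intervalIntegral.abs_integral_le_integral_abs (by norm_num)).trans ?_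
    rw [← intervalIntegral.integral_const_mul, ← intervalIntegral.integral_const_mul,
      ← intervalIntegral.integral_add (Continuous.intervalIntegrable (by fun_prop) _ _) (Continuous.intervalIntegrable (by fun_prop) _ _),
      ← intervalIntegral.integral_const_mul]
    refine intervalIntegral.integral_mono_on (by norm_num) (Continuous.intervalIntegrable (by fun_prop) _ _)
      (Continuous.intervalIntegrable (by fun_prop) _ _) fun x hx => ?_
    rw [abs_mul]
    refine mul_le_mul (hM x hx) ?_ (abs_nonneg _) hM0
    refine (abs_sub _ _).trans ?_
    rw [abs_mul, abs_mul, abs_of_pos (by positivity : 0 < 2/π), abs_of_pos (by positivity : 0 < 1/π)]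
  have r1 := hres hμ
  have r2 := hres sc_nice
  rw [abs_le] at r1 r2 hbd ⊢
  constructor <;> linarith [r1.1, r1.2, r2.1, r2.2, hbd.1, hbd.2]

lemma W1_reduce (hμ : NiceM μ) {y : ℝ} (hy : 0 < y) :
    W1m μ semicircle ≤ 2 * ((2/π) * (∫ x in (-2:ℝ)..2, |vD μ x y|) + (1/π) * (∫ x in (-2:ℝ)..2, |vD μ x (2 * y)|) + 24 * y) +
      |(∫ x, x^2 ∂μ) - 1| / 4 := by
  have := hμ.prob
  set D := (2/π) * (∫ x in (-2:ℝ)..2, |vD μ x y|) + (1/π) * (∫ x in (-2:ℝ)..2, |vD μ x (2 * y)|) + 24 * y with hD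
  refine W1m_le fun f hf => ?_
  refine le_of_forall_pos_le_add fun ε hε => ?_
  obtain ⟨G, hG1, hG2, hG3⟩ := exists_smooth_approx hf (δ := ε/2) (by linarith)
  have hGc := hG1.continuous
  have hdG : ∀ x, HasDerivAt G (deriv G x) x := fun x => (hG1.differentiable (by norm_num) x).hasDerivAt
  have hG' : Continuous (deriv G) := hG1.continuous_deriv (by norm_num)
  have hb1 : ∀ x ∈ Set.Icc (-2:ℝ) 2, |deriv G x| ≤ 1 := fun x _ => by
    have := norm_deriv_le_of_lipschitz hG2 (x₀ := x)
    simpa using this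
  have t1 := clip_test hμ hdG hG' hb1 hy
  have t2 := clip_test hμ (f := fun x => x^2) (f' := fun x => 2 * x) (fun x => by simpa using hasDerivAt_pow 2 x)
    (by fun_prop) (M := 4) (fun x hx => by rw [abs_le]; constructor <;> linarith [hx.1, hx.2]) hy
  have hcl := clip2_cont
  -- semicircle: clip irrelevant
  have s1 : ∫ a, G (clip2 a) ∂semicircle = ∫ a, G a ∂semicircle := by
    refine integral_congr_ae ?_
    filter_upwards [sc_supp] with a ha
    rw [clip2_of_mem ha]
  have s2 : ∫ a, (clip2 a)^2 ∂semicircle = 1 := by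
    rw [← sc_sq]
    refine integral_congr_ae ?_
    filter_upwards [sc_supp] with a ha
    rw [clip2_of_mem ha]
  have hdiffc : |(∫ a, G a ∂μ) - ∫ a, G (clip2 a) ∂μ| ≤ ((∫ x, x^2 ∂μ) - ∫ a, (clip2 a)^2 ∂μ) / 4 := by
    rw [← integral_sub (hμ.int hGc) (hμ.int (f := fun a => G (clip2 a)) (hGc.comp hcl)), ← integral_sub (hμ.int (by fun_prop)) (hμ.int (by fun_prop)), ← integral_div]
    refine abs_integral_le_integral_abs.trans (integral_mono (hμ.int (by fun_prop)) (hμ.int (by fun_prop)) fun a => ?_)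
    have h1 := hG2.dist_le_mul a (clip2 a)
    rw [Real.dist_eq, Real.dist_eq, NNReal.coe_one, one_mul] at h1
    refine h1.trans ?_
    beta_reduce
    rw [clip2]
    rcases le_total a (-2) with h | h
    · rw [min_eq_left (by linarith), max_eq_left h, abs_of_nonpos (by linarith)]
      nlinarith
    · rcases le_total a 2 with h' | h'
      · rw [min_eq_left h', max_eq_right h]; simp
      · rw [min_eq_right h', max_eq_right (by norm_num), abs_of_nonneg (by linarith)]
        nlinarith
  have happ : ∀ {σ : Measure ℝ}, NiceM σ → |(∫ x, f x ∂σ) - ∫ x, G x ∂σ| ≤ ε/2 := by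
    intro σ hσ
    have := hσ.prob
    rw [← integral_sub (hσ.int hf.continuous) (hσ.int hGc)]
    have := norm_integral_le_of_norm_le_const (μ := σ) (f := fun x => f x - G x) (C := ε/2)
      (Filter.Eventually.of_forall fun a => by
        have := hG3 a
        rw [abs_sub_comm] at this
        simpa using this)
    simpa using this
  have p1 := happ hμ
  have p2 := happ sc_nice
  rw [s1] at t1
  rw [s2] at t2
  have hx := le_abs_self ((∫ x, x^2 ∂μ) - 1)
  rw [abs_le] at t1 t2 hdiffc p1 p2 ⊢
  constructor <;> linarith [t1.1, t1.2, t2.1, t2.2, hdiffc.1, hdiffc.2, p1.1, p1.2, p2.1, p2.2]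
end W1

open MeasureTheory ProbabilityTheory Matrix
open scoped Matrix ENNReal
set_option linter.unusedSectionVars false

section IBPA
open scoped Matrix.Norms.Frobenius

variable {N : Type} [Fintype N] [DecidableEq N]

/-- integration by parts with complexified directions -/
lemma IsHaarU.ibp_lin {ν : Measure (Matrix N N ℂ)} (h : IsHaarU ν)
    {f : Matrix N N ℂ → ℂ} (hf : Continuous f)
    {G : Matrix N N ℂ → Matrix N N ℂ →ₗ[ℂ] ℂ} (hG : ∀ X, Continuous fun W => G W X)
    (hd : ∀ X : Matrix N N ℂ, Xᴴ = -X → ∀ W : Matrix N N ℂ,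
      HasDerivAt (fun t : ℝ => f (NormedSpace.exp (t • X) * W)) (G W X) 0) (X : Matrix N N ℂ) :
    ∫ W, G W X ∂ν = 0 := by
  have := h.prob
  set X1 : Matrix N N ℂ := (1/2 : ℂ) • (X - Xᴴ) with hX1
  set X2 : Matrix N N ℂ := (-Complex.I/2) • (X + Xᴴ) with hX2
  have e1 : X1ᴴ = -X1 := by
    rw [hX1, conjTranspose_smul, conjTranspose_sub, conjTranspose_conjTranspose, ← smul_neg, neg_sub]
    simp
  have e2 : X2ᴴ = -X2 := by
    rw [hX2, conjTranspose_smul, conjTranspose_add, conjTranspose_conjTranspose, ← neg_smul, add_comm]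
    congr 1
    simp [neg_div]
  have e3 : X = X1 + Complex.I • X2 := by
    rw [hX1, hX2, smul_smul]
    have : Complex.I * (-Complex.I/2) = 1/2 := by
      have := Complex.I_mul_I
      linear_combination (-1/2) * this
    rw [this]
    ext i j
    simp
    ring
  have h1 := h.ibp hf (hG X1) e1 (fun W _ => hd X1 e1 W)
  have h2 := h.ibp hf (hG X2) e2 (fun W _ => hd X2 e2 W)
  have e4 : ∀ W, G W X = G W X1 + Complex.I * G W X2 := by
    intro W
    refine (congrArg (G W) e3).trans ?_
    rw [map_add, (G W).map_smul Complex.I X2, smul_eq_mul]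
  simp only [e4]
  rw [integral_add (h.integrable (hG X1)) ((h.integrable (hG X2)).const_mul _), integral_const_mul, h1, h2]
  simp

/-- the conjugated matrix -/
def cA (D W : Matrix N N ℂ) : Matrix N N ℂ := W * D * Wᴴ

@[fun_prop]
lemma continuous_cA (D : Matrix N N ℂ) : Continuous (cA D) := by unfold cA; fun_prop

lemma hasDerivAt_cA (D W : Matrix N N ℂ) {X : Matrix N N ℂ} (hX : Xᴴ = -X) :
    HasDerivAt (fun t : ℝ => cA D (NormedSpace.exp (t • X) * W)) (X * cA D W - cA D W * X) 0 := by
  have h1 := IsHaarU.hasDerivAt_exp_mul X W 0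
  have h2 : HasDerivAt (fun t : ℝ => (NormedSpace.exp (t • X) * W)ᴴ) ((X * W)ᴴ) 0 := by
    have := h1.star
    simp only [zero_smul, NormedSpace.exp_zero, one_mul] at this
    exact this
  have h3 := (h1.mul_const D).fun_mul h2
  refine h3.congr_deriv ?_
  simp [cA, hX, mul_assoc, sub_eq_add_neg]

lemma sum_single_mul (M : Matrix N N ℂ) : ∑ a : N, ∑ b : N, (Matrix.single a b (1:ℂ) * M) a b = Fintype.card N * M.trace := by
  have : ∀ a b : N, (Matrix.single a b (1:ℂ) * M) a b = M b b := fun a b => by simp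
  simp only [this, Matrix.trace, Matrix.diag]
  simp

lemma sum_mul_single_mul (M M' : Matrix N N ℂ) :
    ∑ a : N, ∑ b : N, (M * Matrix.single a b (1:ℂ) * M') a b = M.trace * M'.trace := by
  have : ∀ a b, (M * Matrix.single a b (1:ℂ) * M') a b = M a a * M' b b := fun a b => by
    rw [mul_assoc, Matrix.mul_apply, Finset.sum_eq_single a]
    · simp
    · intro c _ hc; simp [hc]
    · simp
  simp only [this]
  simp only [Matrix.trace, Matrix.diag, Finset.sum_mul_sum]

lemma sum_mul_trace (M M' : Matrix N N ℂ) :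
    ∑ a : N, ∑ b : N, M a b * (M' * Matrix.single a b (1:ℂ)).trace = (M * M').trace := by
  have : ∀ a b, (M' * Matrix.single a b (1:ℂ)).trace = M' b a := fun a b => by
    simp [Matrix.trace_mul_single]
  simp only [this]
  simp only [Matrix.trace, Matrix.diag, Matrix.mul_apply]

/-- derivative of `A T` in direction `X` -/
def loopG (A T Q R S : Matrix N N ℂ) (σ : ℂ) (X : Matrix N N ℂ) : Matrix N N ℂ :=
    (X * A - A * X) * T + A * (σ • (Q * (X * A - A * X) * Q) +
          (S * (X * A - A * X)).trace • R)

lemma loopG_add (A T Q R S : Matrix N N ℂ) (σ : ℂ) (X Y : Matrix N N ℂ) :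
    loopG A T Q R S σ (X + Y) = loopG A T Q R S σ X + loopG A T Q R S σ Y := by
  have e : (X + Y) * A - A * (X + Y) = (X * A - A * X) + (Y * A - A * Y) := by
    rw [add_mul, mul_add]; abel
  unfold loopG
  rw [e]
  generalize X * A - A * X = u
  generalize Y * A - A * Y = v
  simp only [add_mul, mul_add, Matrix.trace_add, smul_add, add_smul]
  abel

lemma loopG_smul (A T Q R S : Matrix N N ℂ) (σ : ℂ) (c : ℂ) (X : Matrix N N ℂ) :
    loopG A T Q R S σ (c • X) = c • loopG A T Q R S σ X := by
  have e : (c • X) * A - A * (c • X) = c • (X * A - A * X) := by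
    rw [smul_mul_assoc, mul_smul_comm, smul_sub]
  unfold loopG
  rw [e]
  generalize X * A - A * X = u
  simp only [smul_add, mul_add, smul_mul_assoc, mul_smul_comm, Matrix.trace_smul, smul_eq_mul, mul_smul]
  rw [smul_comm c σ]

lemma loopG_sum (A T Q R S : Matrix N N ℂ) (σ : ℂ) :
    ∑ a : N, ∑ b : N, loopG A T Q R S σ (Matrix.single a b 1) a b =
    (Fintype.card N * (A * T).trace - A.trace * T.trace
      + σ * ((A * Q).trace * (A * Q).trace - (Q).trace * (A * Q * A).trace)
      + (A * R * (A * S - S * A)).trace) := by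
    have r1 : ∀ X, (S * (X * A - A * X)).trace = ((A * S - S * A) * X).trace := by
      intro X
      rw [mul_sub, sub_mul, Matrix.trace_sub, Matrix.trace_sub, ← mul_assoc, ← mul_assoc]
      congr 1
      rw [Matrix.trace_mul_comm, mul_assoc]
    have r2 : ∀ a b, loopG A T Q R S σ (Matrix.single a b 1) a b = (Matrix.single a b (1:ℂ) * (A * T)) a b
        - (A * Matrix.single a b (1:ℂ) * T) a b
        + σ * ((A * Q * Matrix.single a b (1:ℂ) * (A * Q)) a b
        - (A * Q * A * Matrix.single a b (1:ℂ) * Q) a b)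
        + (A * R) a b * ((A * S - S * A) * Matrix.single a b (1:ℂ)).trace := by
      intro a b
      generalize Matrix.single a b (1:ℂ) = E
      unfold loopG
      rw [r1]
      generalize ((A * S - S * A) * E).trace = τ
      have : (E * A - A * E) * T + A * (σ • (Q * (E * A - A * E) * Q) + τ • R)
        = E * (A * T) - A * E * T + σ • (A * Q * E * (A * Q) - A * Q * A * E * Q) + τ • (A * R) := by
        simp only [mul_add, mul_smul_comm, mul_sub, sub_mul, mul_assoc]
        abel
      rw [this]
      simp only [Matrix.add_apply, Matrix.sub_apply, Matrix.smul_apply, smul_eq_mul]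
      ring
    simp only [r2, Finset.sum_add_distrib, Finset.sum_sub_distrib, ← Finset.mul_sum]
    rw [sum_single_mul, sum_mul_single_mul, sum_mul_single_mul, sum_mul_single_mul, sum_mul_trace]
    ring

lemma loopG_cont {A T Q R S : Matrix N N ℂ → Matrix N N ℂ} {σ : Matrix N N ℂ → ℂ}
    (hA : Continuous A)
    (hT : Continuous T) (hQ : Continuous Q) (hR : Continuous R) (hS : Continuous S) (hσ : Continuous σ) (X : Matrix N N ℂ) :
    Continuous fun W => loopG (A W) (T W) (Q W) (R W) (S W) (σ W) X := by
  have h1 : Continuous fun W => X * A W - A W * X := by fun_prop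
  have htr : Continuous fun W => (S W * (X * A W - A W * X)).trace :=
    Continuous.matrix_trace (hS.mul h1)
  exact (h1.mul hT).add (hA.mul ((hσ.smul ((hQ.mul h1).mul hQ)).add (htr.smul hR)))

/-- the loop-type equation for `T` with derivative `σ Q δ Q + Tr(S δ) R`. -/
lemma IsHaarU.loop {ν : Measure (Matrix N N ℂ)} (h : IsHaarU ν) (D : Matrix N N ℂ)
    {T Q R S : Matrix N N ℂ → Matrix N N ℂ} {σ : Matrix N N ℂ → ℂ}
    (hT : Continuous T) (hQ : Continuous Q) (hR : Continuous R) (hS : Continuous S) (hσ : Continuous σ)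
    (hd : ∀ X : Matrix N N ℂ, Xᴴ = -X → ∀ W : Matrix N N ℂ,
      HasDerivAt (fun t : ℝ => T (NormedSpace.exp (t • X) * W))
        (σ W • (Q W * (X * cA D W - cA D W * X) * Q W) +
          (S W * (X * cA D W - cA D W * X)).trace • R W) 0) :
    ∫ W, (Fintype.card N * (cA D W * T W).trace - (cA D W).trace * (T W).trace
      + σ W * ((cA D W * Q W).trace * (cA D W * Q W).trace
          - (Q W).trace * (cA D W * Q W * cA D W).trace)
      + (cA D W * R W * (cA D W * S W - S W * cA D W)).trace) ∂ν = 0 := by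
  have := h.prob
  let A := cA D
  have hA : Continuous A := continuous_cA D
  let Gm : Matrix N N ℂ → Matrix N N ℂ → Matrix N N ℂ := fun W => loopG (A W) (T W) (Q W) (R W) (S W) (σ W)
  let G : N → N → Matrix N N ℂ → Matrix N N ℂ →ₗ[ℂ] ℂ := fun a b W =>
    { toFun := fun X => Gm W X a b
      map_add' := fun X Y => by
        show loopG _ _ _ _ _ _ _ a b = _
        rw [loopG_add]; rfl
      map_smul' := fun c X => by
        show loopG _ _ _ _ _ _ _ a b = _
        rw [loopG_smul]; rfl }
  have hGm : ∀ X, Continuous fun W => Gm W X := by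
    intro X
    exact loopG_cont hA hT hQ hR hS hσ X
  have key : ∀ a b, ∫ W, Gm W (Matrix.single a b 1) a b ∂ν = 0 := by
    intro a b
    refine h.ibp_lin (f := fun W => (A W * T W) a b) (G := G a b) ?_ ?_ ?_ (Matrix.single a b 1)
    · exact Continuous.matrix_elem (by fun_prop) a b
    · intro X; exact (hGm X).matrix_elem a b
    · intro X hX W
      have h1 := (hasDerivAt_cA D W hX).fun_mul (hd X hX W)
      have h2 : HasDerivAt (fun t : ℝ => A (NormedSpace.exp (t • X) * W) * T (NormedSpace.exp (t • X) * W))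
          (Gm W X) 0 := by
        refine h1.congr_deriv ?_
        simp [Gm, A, loopG]
      have h3 := (hasDerivAt_pi.1 (hasDerivAt_pi.1 h2 a)) b
      exact h3
  have e : ∀ W, (Fintype.card N * (cA D W * T W).trace - (cA D W).trace * (T W).trace
      + σ W * ((cA D W * Q W).trace * (cA D W * Q W).trace
          - (Q W).trace * (cA D W * Q W * cA D W).trace)
      + (cA D W * R W * (cA D W * S W - S W * cA D W)).trace) = ∑ a, ∑ b, Gm W (Matrix.single a b 1) a b := by
    intro W
    exact (loopG_sum _ _ _ _ _ _).symm
  simp only [e]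
  have hGi : ∀ a b, Integrable (fun W => Gm W (Matrix.single a b 1) a b) ν := fun a b =>
    h.integrable ((hGm _).matrix_elem a b)
  rw [integral_finsetSum _ fun a _ => integrable_finsetSum _ fun b _ => hGi a b]
  refine Finset.sum_eq_zero fun a _ => ?_
  rw [integral_finsetSum _ fun b _ => hGi a b]
  exact Finset.sum_eq_zero fun b _ => key a b

end IBPA

open MeasureTheory ProbabilityTheory Matrix
open scoped Matrix ENNReal
set_option linter.unusedSectionVars false

section Corner
open scoped Matrix.Norms.Frobenius

variable {N κ : Type} [Fintype N] [DecidableEq N] [Fintype κ] [DecidableEq κ]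

/-- corner of the conjugated matrix -/
def cB (a : κ → N) (D W : Matrix N N ℂ) : Matrix κ κ ℂ := selM a * cA D W * (selM a)ᴴ

/-- embed a small matrix as a corner -/
def padM (a : κ → N) (M : Matrix κ κ ℂ) : Matrix N N ℂ := (selM a)ᴴ * M * selM a

@[fun_prop]
lemma continuous_cB (a : κ → N) (D : Matrix N N ℂ) : Continuous (cB a D) := by unfold cB; fun_prop

lemma cA_herm {D : Matrix N N ℂ} (hD : D.IsHermitian) (W : Matrix N N ℂ) : (cA D W).IsHermitian := by
  unfold Matrix.IsHermitian cA
  simp [hD.eq, mul_assoc]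

lemma cB_herm {a : κ → N} {D : Matrix N N ℂ} (hD : D.IsHermitian) (W : Matrix N N ℂ) : (cB a D W).IsHermitian := by
  unfold Matrix.IsHermitian cB
  simp [(cA_herm hD W).eq, Matrix.mul_assoc]

lemma cA_mul {D D' W : Matrix N N ℂ} (hW : W ∈ unitaryGroup N ℂ) : cA D W * cA D' W = cA (D * D') W := by
  have h : Wᴴ * W = 1 := mem_unitaryGroup_iff'.1 hW
  unfold cA
  calc W * D * Wᴴ * (W * D' * Wᴴ) = W * D * (Wᴴ * W) * D' * Wᴴ := by simp only [mul_assoc]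
    _ = _ := by rw [h]; simp only [mul_assoc, one_mul]

lemma cA_trace {D W : Matrix N N ℂ} (hW : W ∈ unitaryGroup N ℂ) : (cA D W).trace = D.trace := by
  have h : Wᴴ * W = 1 := mem_unitaryGroup_iff'.1 hW
  unfold cA
  rw [Matrix.trace_mul_comm, ← mul_assoc, h, one_mul]

lemma tr_pad (a : κ → N) (A : Matrix N N ℂ) (M : Matrix κ κ ℂ) :
    (A * padM a M).trace = (selM a * A * (selM a)ᴴ * M).trace := by
  unfold padM
  rw [← Matrix.mul_assoc, Matrix.trace_mul_comm]
  simp only [Matrix.mul_assoc]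

lemma pad_mul {a : κ → N} (ha : Function.Injective a) (M M' : Matrix κ κ ℂ) :
    padM a M * padM a M' = padM a (M * M') := by
  have := selM_mul_selMT (N := N) ha
  unfold padM
  calc (selM a)ᴴ * M * selM a * ((selM a)ᴴ * M' * selM a) = (selM a)ᴴ * M * (selM a * (selM a)ᴴ) * M' * selM a := by
        simp only [Matrix.mul_assoc]
    _ = _ := by rw [this]; simp only [Matrix.mul_assoc, Matrix.one_mul]

lemma pad_trace {a : κ → N} (ha : Function.Injective a) (M : Matrix κ κ ℂ) : (padM a M).trace = M.trace := by
  unfold padM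
  rw [Matrix.trace_mul_comm, ← Matrix.mul_assoc, selM_mul_selMT ha, Matrix.one_mul]

lemma cont_pad (a : κ → N) {f : Matrix N N ℂ → Matrix κ κ ℂ} (hf : Continuous f) : Continuous fun W => padM a (f W) := by
  unfold padM; fun_prop

lemma tr_e1 (a : κ → N) {D W : Matrix N N ℂ} (hW : W ∈ unitaryGroup N ℂ) (Q : Matrix κ κ ℂ) :
    (cA D W * padM a Q * cA D W).trace = (cB a (D * D) W * Q).trace := by
  rw [Matrix.trace_mul_comm, ← Matrix.mul_assoc, cA_mul hW, tr_pad]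
  rfl

lemma tr_e2 {a : κ → N} (ha : Function.Injective a) {D W : Matrix N N ℂ} (hW : W ∈ unitaryGroup N ℂ) (R S : Matrix κ κ ℂ) :
    (cA D W * padM a R * (cA D W * padM a S - padM a S * cA D W)).trace
       = (cB a D W * R * cB a D W * S).trace - (cB a (D * D) W * (R * S)).trace := by
  have e1 : (cA D W * padM a R * (cA D W * padM a S)).trace = (cB a D W * R * cB a D W * S).trace := by
    rw [← Matrix.mul_assoc, tr_pad]
    unfold padM cB
    simp only [Matrix.mul_assoc]
  have e2 : (cA D W * padM a R * (padM a S * cA D W)).trace = (cB a (D * D) W * (R * S)).trace := by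
    have : cA D W * padM a R * (padM a S * cA D W) = cA D W * padM a (R * S) * cA D W := by
      rw [← pad_mul ha]; simp only [Matrix.mul_assoc]
    rw [this, tr_e1 a hW]
  rw [Matrix.mul_sub, Matrix.trace_sub, e1, e2]

/-- loop equation for functions of the corner -/
lemma IsHaarU.loopB {ν : Measure (Matrix N N ℂ)} (h : IsHaarU ν) {a : κ → N} (ha : Function.Injective a)
    {D : Matrix N N ℂ} (hD : D.IsHermitian)
    {T Q R S : Matrix κ κ ℂ → Matrix κ κ ℂ} {σ : Matrix κ κ ℂ → ℂ}
    (hT : Continuous fun W => T (cB a D W)) (hQ : Continuous fun W => Q (cB a D W))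
    (hR : Continuous fun W => R (cB a D W)) (hS : Continuous fun W => S (cB a D W))
    (hσ : Continuous fun W => σ (cB a D W))
    (hd : ∀ (c : ℝ → Matrix κ κ ℂ) (δ : Matrix κ κ ℂ), (c 0).IsHermitian → HasDerivAt c δ 0 →
      HasDerivAt (fun t => T (c t)) (σ (c 0) • (Q (c 0) * δ * Q (c 0)) + (S (c 0) * δ).trace • R (c 0)) 0) :
    ∫ W, (Fintype.card N * (cB a D W * T (cB a D W)).trace - D.trace * (T (cB a D W)).trace
      + σ (cB a D W) * ((cB a D W * Q (cB a D W)).trace * (cB a D W * Q (cB a D W)).trace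
          - (Q (cB a D W)).trace * (cB a (D * D) W * Q (cB a D W)).trace)
      + ((cB a D W * R (cB a D W) * cB a D W * S (cB a D W)).trace
        - (cB a (D * D) W * (R (cB a D W) * S (cB a D W))).trace)) ∂ν = 0 := by
  have key := h.loop D (T := fun W => padM a (T (cB a D W))) (Q := fun W => padM a (Q (cB a D W)))
    (R := fun W => padM a (R (cB a D W))) (S := fun W => padM a (S (cB a D W))) (σ := fun W => σ (cB a D W))
    (cont_pad a hT) (cont_pad a hQ) (cont_pad a hR) (cont_pad a hS) hσ ?_
  · rw [← key]
    refine integral_congr_ae ?_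
    filter_upwards [h.unit] with W hW
    rw [cA_trace hW, tr_pad, tr_pad, pad_trace ha, pad_trace ha]
    rw [tr_e1 a hW, tr_e2 ha hW]
    rfl
  · intro X hX W
    have h1 := hasDerivAt_cA D W hX
    have h2 : HasDerivAt (fun t : ℝ => cB a D (NormedSpace.exp (t • X) * W))
        (selM a * (X * cA D W - cA D W * X) * (selM a)ᴴ) 0 := by
      let l : Matrix N N ℂ →L[ℝ] Matrix κ κ ℂ := LinearMap.toContinuousLinearMap
        { toFun := fun M => selM a * M * (selM a)ᴴ
          map_add' := fun x y => by rw [Matrix.mul_add, Matrix.add_mul]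
          map_smul' := fun c x => by simp }
      exact l.hasFDerivAt.comp_hasDerivAt (0:ℝ) h1
    have e0 : cB a D (NormedSpace.exp ((0:ℝ) • X) * W) = cB a D W := by simp
    have h3 := hd _ _ (cB_herm hD _) h2
    rw [e0] at h3
    let l : Matrix κ κ ℂ →L[ℝ] Matrix N N ℂ := LinearMap.toContinuousLinearMap
        { toFun := fun M => padM a M
          map_add' := fun x y => by unfold padM; rw [Matrix.mul_add, Matrix.add_mul]
          map_smul' := fun c x => by simp [padM] }
    have h4 := l.hasFDerivAt.comp_hasDerivAt (0:ℝ) h3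
    refine h4.congr_deriv ?_
    show padM a _ = _
    generalize X * cA D W - cA D W * X = δ
    have e3 : (S (cB a D W) * (selM a * δ * (selM a)ᴴ)).trace = (padM a (S (cB a D W)) * δ).trace := by
      rw [Matrix.trace_mul_comm, Matrix.trace_mul_comm (padM a _), tr_pad]
    rw [e3]
    unfold padM
    simp only [Matrix.mul_add, Matrix.add_mul, Matrix.mul_smul, Matrix.smul_mul, Matrix.mul_assoc]

/-- first moment -/
lemma IsHaarU.first_moment {ν : Measure (Matrix N N ℂ)} (h : IsHaarU ν) {a : κ → N} (ha : Function.Injective a)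
    {D : Matrix N N ℂ} (hD : D.IsHermitian) :
    Fintype.card N * ∫ W, (cB a D W).trace ∂ν = Fintype.card κ * D.trace := by
  have := h.prob
  have key := h.loopB ha hD (T := fun _ => 1) (Q := fun _ => 0) (R := fun _ => 0) (S := fun _ => 0) (σ := fun _ => 0)
    continuous_const continuous_const continuous_const continuous_const continuous_const ?_
  · simp only [mul_one, Matrix.trace_one, mul_zero, Matrix.trace_zero, sub_zero, zero_mul, add_zero] at key
    have hc : Continuous fun W => (cB a D W).trace := Continuous.matrix_trace (continuous_cB a D)
    rw [integral_sub ((h.integrable hc).const_mul _) (integrable_const _), integral_const_mul] at key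
    simp at key
    linear_combination key
  · intro c δ _ _
    simp only [zero_smul, Matrix.zero_mul, Matrix.trace_zero, add_zero]
    exact hasDerivAt_const _ _

lemma herm_tr_sq {B : Matrix κ κ ℂ} (hB : B.IsHermitian) : (B * B).trace = ((‖B‖^2 : ℝ) : ℂ) := by
  have h : (B * B).trace.im = 0 := by
    have : star (B * B).trace = (B * B).trace := by
      rw [← Matrix.trace_conjTranspose, Matrix.conjTranspose_mul, hB.eq]
    exact Complex.conj_eq_iff_im.1 this
  rw [frob_sq_trace, hB.eq]
  apply Complex.ext <;> simp [h]

lemma herm_tr {B : Matrix κ κ ℂ} (hB : B.IsHermitian) : B.trace = ((B.trace.re : ℝ) : ℂ) := by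
  have : star B.trace = B.trace := by
    rw [← Matrix.trace_conjTranspose, hB.eq]
  exact (Complex.conj_eq_iff_re.1 this).symm

/-- second moment identity -/
lemma IsHaarU.second_moment {ν : Measure (Matrix N N ℂ)} (h : IsHaarU ν) {a : κ → N} (ha : Function.Injective a)
    {D : Matrix N N ℂ} (hD : D.IsHermitian) (htr : D.trace = 0) :
    (Fintype.card N : ℝ)^2 * ∫ W, ‖cB a D W‖^2 ∂ν ≤ (Fintype.card κ : ℝ)^2 * (‖D‖^2) := by
  have := h.prob
  have key := h.loopB ha hD (T := fun B => B) (Q := fun _ => 1) (R := fun _ => 0) (S := fun _ => 0) (σ := fun _ => 1)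
    (continuous_cB a D) continuous_const continuous_const continuous_const continuous_const ?_
  · simp only [htr, zero_mul, sub_zero, mul_one, one_mul, Matrix.trace_one, Matrix.mul_zero, Matrix.zero_mul, Matrix.trace_zero, add_zero] at key
    have hDD : (D * D).IsHermitian := by
      unfold Matrix.IsHermitian; rw [Matrix.conjTranspose_mul, hD.eq]
    have e : ∀ W, (Fintype.card N * (cB a D W * cB a D W).trace + ((cB a D W).trace * (cB a D W).trace
        - Fintype.card κ * (cB a (D*D) W).trace) : ℂ) = ((Fintype.card N * ‖cB a D W‖^2 + (cB a D W).trace.re^2 : ℝ) : ℂ) - Fintype.card κ * (cB a (D*D) W).trace := by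
      intro W
      have h1 := herm_tr_sq (cB_herm (a := a) hD W)
      have h2 := herm_tr (cB_herm (a := a) hD W)
      rw [h1]
      generalize (cB a D W).trace = τ at *
      have h3 : τ * τ = ((τ.re^2 : ℝ) : ℂ) := by
        conv_lhs => rw [h2]
        push_cast; ring
      rw [h3]
      push_cast
      ring
    simp only [e] at key
    have c1 : Continuous fun W => ‖cB a D W‖^2 := by fun_prop
    have c2 : Continuous fun W => (cB a D W).trace.re^2 := by
      have : Continuous fun W => (cB a D W).trace := Continuous.matrix_trace (continuous_cB a D)
      fun_prop
    have c3 : Continuous fun W => (cB a (D*D) W).trace := Continuous.matrix_trace (continuous_cB a _)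
    have i1 := h.integrable c1
    have i2 := h.integrable c2
    rw [integral_sub (h.integrable (by fun_prop)) ((h.integrable c3).const_mul _), integral_const_mul, integral_complex_ofReal,
      integral_add (i1.const_mul _) i2, integral_const_mul] at key
    have fm := h.first_moment ha hDD
    rw [herm_tr_sq hD] at fm
    have pos : 0 ≤ ∫ W, (cB a D W).trace.re^2 ∂ν := integral_nonneg fun W => sq_nonneg _
    have key2 : ((Fintype.card N * (Fintype.card N * (∫ W, ‖cB a D W‖^2 ∂ν) + ∫ W, (cB a D W).trace.re^2 ∂ν) : ℝ) : ℂ)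
       = (((Fintype.card κ)^2 * ‖D‖^2 : ℝ) : ℂ) := by
      push_cast at fm key ⊢
      linear_combination (Fintype.card N : ℂ) * key + (Fintype.card κ : ℂ) * fm
    have key3 := Complex.ofReal_injective key2
    have := mul_nonneg (Nat.cast_nonneg (α := ℝ) (Fintype.card N)) pos
    nlinarith
  · intro c δ _ hc
    simp only [Matrix.zero_mul, Matrix.trace_zero, zero_smul, one_smul, add_zero, Matrix.one_mul, Matrix.mul_one]
    exact hc

end Corner

open MeasureTheory ProbabilityTheory Matrix
open scoped Matrix ENNReal
set_option linter.unusedSectionVars false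

section Moments
open scoped Matrix.Norms.Frobenius

variable {n k : ℕ}

/-- standing assumptions on the spectrum `d` and the row choice `a` -/
structure Setup (d : Fin n → ℝ) (a : Fin k → Fin n) (ρ : ℝ) : Prop where
  ha : Function.Injective a
  sum0 : ∑ i, d i = 0
  pos : 0 < ∑ i, d i ^ 2
  bd : ∀ i, |d i| ≤ ρ
  hk : 2 ≤ k
  hkn : k ≤ n

/-- squared Hilbert–Schmidt norm of the spectrum -/
def s2 (d : Fin n → ℝ) : ℝ := ∑ i, d i ^ 2
/-- the diagonal matrix -/
def dM (d : Fin n → ℝ) : Matrix (Fin n) (Fin n) ℂ := Matrix.diagonal fun i => ((d i : ℝ) : ℂ)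
/-- normalisation constant -/
noncomputable def c0 (k : ℕ) (d : Fin n → ℝ) : ℝ := Real.sqrt ((n:ℝ)^2 - 1) / (Real.sqrt k * Real.sqrt (s2 d))
/-- the normalised corner -/
noncomputable def XM (d : Fin n → ℝ) (a : Fin k → Fin n) (W : Matrix (Fin n) (Fin n) ℂ) : Matrix (Fin k) (Fin k) ℂ :=
  ((c0 k d : ℝ) : ℂ) • cB a (dM d) W
/-- fluctuation of the corner of the square -/
noncomputable def HM (d : Fin n → ℝ) (a : Fin k → Fin n) (W : Matrix (Fin n) (Fin n) ℂ) : Matrix (Fin k) (Fin k) ℂ :=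
  ((n / s2 d : ℝ) : ℂ) • cB a (dM d * dM d) W - 1

lemma dM_herm (d : Fin n → ℝ) : (dM d).IsHermitian := by
  unfold dM
  rw [Matrix.isHermitian_diagonal_iff]
  intro i
  simp [isSelfAdjoint_iff]

lemma dM_norm (d : Fin n → ℝ) : ‖dM d‖^2 = s2 d := by
  rw [frob_sq, s2]
  refine Finset.sum_congr rfl fun i _ => ?_
  rw [Finset.sum_eq_single i]
  · simp [dM]
  · intro j _ hj; simp [dM, Matrix.diagonal_apply_ne' _ hj]
  · simp

lemma dM_trace (d : Fin n → ℝ) : (dM d).trace = ((∑ i, d i : ℝ) : ℂ) := by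
  simp [dM]

@[fun_prop]
lemma continuous_XM (d : Fin n → ℝ) (a : Fin k → Fin n) : Continuous (XM d a) := by
  unfold XM; fun_prop
@[fun_prop]
lemma continuous_HM (d : Fin n → ℝ) (a : Fin k → Fin n) : Continuous (HM d a) := by
  unfold HM; fun_prop

lemma XM_herm (d : Fin n → ℝ) (a : Fin k → Fin n) (W : Matrix (Fin n) (Fin n) ℂ) : (XM d a W).IsHermitian := by
  unfold Matrix.IsHermitian XM
  rw [Matrix.conjTranspose_smul, (cB_herm (dM_herm d) W).eq]
  simp

lemma HM_herm (d : Fin n → ℝ) (a : Fin k → Fin n) (W : Matrix (Fin n) (Fin n) ℂ) : (HM d a W).IsHermitian := by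
  have hDD : (dM d * dM d).IsHermitian := by
      unfold Matrix.IsHermitian; rw [Matrix.conjTranspose_mul, (dM_herm d).eq]
  unfold Matrix.IsHermitian HM
  rw [Matrix.conjTranspose_sub, Matrix.conjTranspose_smul, (cB_herm hDD W).eq]
  simp

variable {d : Fin n → ℝ} {a : Fin k → Fin n} {ρ : ℝ}

namespace Setup
lemma s2pos (h : Setup d a ρ) : 0 < s2 d := h.pos
lemma kpos (h : Setup d a ρ) : (0:ℝ) < k := by have := h.hk; exact_mod_cast (by omega : 0 < k)
lemma npos (h : Setup d a ρ) : (0:ℝ) < n := by have := h.hk; have := h.hkn; exact_mod_cast (by omega : 0 < n)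
lemma n2 (h : Setup d a ρ) : (2:ℝ) ≤ n := by have := h.hk; have := h.hkn; exact_mod_cast (by omega : 2 ≤ n)
lemma k2 (h : Setup d a ρ) : (2:ℝ) ≤ k := by have := h.hk; exact_mod_cast this
lemma kn (h : Setup d a ρ) : (k:ℝ) ≤ n := by have := h.hkn; exact_mod_cast this
lemma c0sq (h : Setup d a ρ) : c0 k d ^ 2 = ((n:ℝ)^2 - 1) / (k * s2 d) := by
  have := h.n2
  have := h.kpos
  have := h.s2pos
  unfold c0
  rw [div_pow, mul_pow, Real.sq_sqrt (by nlinarith), Real.sq_sqrt (by positivity), Real.sq_sqrt (by positivity)]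
lemma c0pos (h : Setup d a ρ) : 0 < c0 k d := by
  have := h.n2
  have := h.kpos
  have := h.s2pos
  have : (0:ℝ) < (n:ℝ)^2 - 1 := by nlinarith
  unfold c0
  positivity
lemma rho_nonneg (h : Setup d a ρ) : 0 ≤ ρ := by
  have := h.hk; have := h.hkn
  exact (abs_nonneg _).trans (h.bd ⟨0, by omega⟩)
/-- `n r² ≥ 1` -/
lemma nr2 (h : Setup d a ρ) : s2 d ≤ n * ρ^2 := by
  unfold s2
  calc ∑ i, d i^2 ≤ ∑ i : Fin n, ρ^2 := Finset.sum_le_sum fun i _ => sq_le_sq' (by have := abs_le.1 (h.bd i); linarith) (abs_le.1 (h.bd i)).2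
    _ = _ := by simp
lemma rhopos (h : Setup d a ρ) : 0 < ρ := by
  rcases h.rho_nonneg.eq_or_lt with h0 | h0
  · have := h.nr2; have := h.s2pos; rw [← h0] at *; norm_num at *; linarith
  · exact h0

lemma XM_moment (h : Setup d a ρ) {ν : Measure (Matrix (Fin n) (Fin n) ℂ)} (hν : IsHaarU ν) :
    ∫ W, ‖XM d a W‖^2 ∂ν ≤ k := by
  have h1 := hν.second_moment h.ha (dM_herm d) (by rw [dM_trace, h.sum0]; simp)
  have e : ∀ W, ‖XM d a W‖^2 = c0 k d^2 * ‖cB a (dM d) W‖^2 := by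
    intro W
    unfold XM
    rw [norm_smul, mul_pow, Complex.norm_real, Real.norm_eq_abs, sq_abs]
  simp only [e]
  rw [integral_const_mul, h.c0sq]
  rw [dM_norm] at h1
  simp only [Fintype.card_fin] at h1
  have hk := h.kpos; have hn := h.n2; have hs := h.s2pos
  rw [div_mul_eq_mul_div, div_le_iff₀ (by positivity)]
  have : (0:ℝ) ≤ ∫ W, ‖cB a (dM d) W‖^2 ∂ν := integral_nonneg fun W => sq_nonneg _
  nlinarith

/-- traceless version of the squared spectrum -/
lemma HM_eq (h : Setup d a ρ) {W : Matrix (Fin n) (Fin n) ℂ} (hW : W ∈ unitaryGroup (Fin n) ℂ) :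
    HM d a W = ((n / s2 d : ℝ) : ℂ) • cB a (dM fun i => d i ^ 2 - s2 d / n) W := by
  have hn := h.npos; have hs := h.s2pos
  have e1 : dM (fun i => d i^2 - s2 d / n) = dM d * dM d - ((s2 d / n : ℝ) : ℂ) • 1 := by
    unfold dM
    ext i j
    by_cases hij : i = j
    · subst hij; simp [Matrix.one_apply]; ring
    · simp [hij]
  have e2 : cB a (1 : Matrix (Fin n) (Fin n) ℂ) W = 1 := by
    unfold cB cA
    rw [mul_one, show W * Wᴴ = 1 from mem_unitaryGroup_iff.1 hW, Matrix.mul_one, selM_mul_selMT h.ha]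
  have e3 : cB a (dM d * dM d - ((s2 d / n : ℝ) : ℂ) • 1) W = cB a (dM d * dM d) W - ((s2 d / n : ℝ) : ℂ) • cB a 1 W := by
    unfold cB cA
    simp only [Matrix.mul_sub, Matrix.sub_mul, Matrix.mul_smul, Matrix.smul_mul]
  rw [e1, e3, e2, smul_sub, smul_smul]
  unfold HM
  congr 1
  rw [← Complex.ofReal_mul, div_mul_div_comm, mul_comm (n:ℝ), div_self (by positivity)]
  simp

lemma HM_moment (h : Setup d a ρ) {ν : Measure (Matrix (Fin n) (Fin n) ℂ)} (hν : IsHaarU ν) :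
    ∫ W, ‖HM d a W‖^2 ∂ν ≤ k^2 * (ρ^2 / s2 d) := by
  have hn := h.npos; have hs := h.s2pos
  have hsum : ∑ i, (d i^2 - s2 d / n) = 0 := by
    rw [Finset.sum_sub_distrib, Finset.sum_const, Finset.card_univ, Fintype.card_fin, nsmul_eq_mul,
      mul_div_cancel₀ _ hn.ne']
    simp [s2]
  have h1 := hν.second_moment h.ha (dM_herm (fun i => d i ^ 2 - s2 d / n)) (by rw [dM_trace, hsum]; simp)
  have e : ∫ W, ‖HM d a W‖^2 ∂ν = ∫ W, (n / s2 d)^2 * ‖cB a (dM fun i => d i ^ 2 - s2 d / n) W‖^2 ∂ν := by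
    refine integral_congr_ae ?_
    filter_upwards [hν.unit] with W hW
    rw [h.HM_eq hW, norm_smul, mul_pow, Complex.norm_real, Real.norm_eq_abs, sq_abs]
  rw [e, integral_const_mul]
  rw [dM_norm] at h1
  simp only [Fintype.card_fin] at h1
  have h2 : s2 (fun i => d i^2 - s2 d / n) ≤ ρ^2 * s2 d := by
    have e1 : s2 (fun i => d i^2 - s2 d / n) = ∑ i, (d i^2)^2 - s2 d * s2 d / n := by
      have : ∀ i, (d i^2 - s2 d / n)^2 = (d i^2)^2 - 2 * (s2 d / n) * d i^2 + (s2 d / n)^2 := fun i => by ring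
      change ∑ i, (d i^2 - s2 d / n)^2 = _
      simp only [this, Finset.sum_add_distrib, Finset.sum_sub_distrib, ← Finset.mul_sum, Finset.sum_const, Finset.card_univ, Fintype.card_fin, nsmul_eq_mul]
      change _ - 2 * (s2 d / n) * s2 d + _ = _
      field_simp
      ring
    have e2 : ∑ i, (d i^2)^2 ≤ ρ^2 * s2 d := by
      unfold s2
      rw [Finset.mul_sum]
      refine Finset.sum_le_sum fun i _ => ?_
      have : d i^2 ≤ ρ^2 := sq_le_sq' (by have := abs_le.1 (h.bd i); linarith) (abs_le.1 (h.bd i)).2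
      nlinarith [sq_nonneg (d i)]
    have : 0 ≤ s2 d * s2 d / n := by positivity
    linarith
  have h3 := h1.trans (mul_le_mul_of_nonneg_left h2 (by positivity : (0:ℝ) ≤ (k:ℝ)^2))
  calc (n / s2 d)^2 * ∫ W, ‖cB a (dM fun i => d i ^ 2 - s2 d / n) W‖^2 ∂ν
      = ((n:ℝ)^2 * ∫ W, ‖cB a (dM fun i => d i ^ 2 - s2 d / n) W‖^2 ∂ν) / s2 d^2 := by rw [div_pow]; ring
    _ ≤ ((k:ℝ)^2 * (ρ^2 * s2 d)) / s2 d^2 := by gcongr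
    _ = _ := by field_simp
end Setup
end Moments

open MeasureTheory ProbabilityTheory Matrix
open scoped Matrix ENNReal
set_option linter.unusedSectionVars false

section Xi
open scoped Matrix.Norms.Frobenius

variable {n k : ℕ} {d : Fin n → ℝ} {a : Fin k → Fin n} {ρ : ℝ}

lemma hasDerivAt_tr {κ : Type} [Fintype κ] [DecidableEq κ] {c : ℝ → Matrix κ κ ℂ} {δ : Matrix κ κ ℂ} {t : ℝ}
    (h : HasDerivAt c δ t) : HasDerivAt (fun t => (c t).trace) δ.trace t := by
  let l : Matrix κ κ ℂ →L[ℝ] ℂ := LinearMap.toContinuousLinearMap (Matrix.traceLinearMap κ ℝ ℂ)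
  exact l.hasFDerivAt.comp_hasDerivAt t h

lemma abs_tr_mul_le {κ : Type} [Fintype κ] [DecidableEq κ] (M M' : Matrix κ κ ℂ) : ‖(M * M').trace‖ ≤ ‖M‖ * ‖M'‖ := by
  have h1 : ‖(M * M').trace‖ ≤ ∑ i, ∑ j, ‖M i j‖ * ‖M' j i‖ := by
    simp only [Matrix.trace, Matrix.diag, Matrix.mul_apply]
    refine (norm_sum_le _ _).trans (Finset.sum_le_sum fun i _ => ?_)
    refine (norm_sum_le _ _).trans (Finset.sum_le_sum fun j _ => ?_)
    rw [norm_mul]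
  have h2 : (∑ i, ∑ j, ‖M i j‖ * ‖M' j i‖)^2 ≤ (‖M‖ * ‖M'‖)^2 := by
    rw [mul_pow, frob_sq, frob_sq, Finset.sum_comm (f := fun i j => ‖M' i j‖^2)]
    simp only [← Finset.sum_product']
    exact Finset.sum_mul_sq_le_sq_mul_sq _ _ _
  exact h1.trans (abs_le_of_sq_le_sq' h2 (by positivity)).2

lemma abs_tr_le {k : ℕ} (M : Matrix (Fin k) (Fin k) ℂ) : ‖M.trace‖ ≤ Real.sqrt k * ‖M‖ := by
  have := abs_tr_mul_le (1 : Matrix (Fin k) (Fin k) ℂ) M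
  rw [Matrix.one_mul] at this
  refine this.trans (le_of_eq ?_)
  congr 1
  have h : ‖(1 : Matrix (Fin k) (Fin k) ℂ)‖^2 = k := by
    rw [frob_sq_trace]; simp
  rw [← h, Real.sqrt_sq (norm_nonneg _)]

/-- centred normalised second moment -/
noncomputable def xiM (d : Fin n → ℝ) (a : Fin k → Fin n) (W : Matrix (Fin n) (Fin n) ℂ) : ℝ := ‖XM d a W‖^2 / k - 1

@[fun_prop]
lemma continuous_xiM (d : Fin n → ℝ) (a : Fin k → Fin n) : Continuous (xiM d a) := by
  unfold xiM; fun_prop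

lemma XM_of (h : Setup d a ρ) (W : Matrix (Fin n) (Fin n) ℂ) : cB a (dM d) W = ((c0 k d : ℝ) : ℂ)⁻¹ • XM d a W := by
  have : ((c0 k d : ℝ) : ℂ) ≠ 0 := by exact_mod_cast h.c0pos.ne'
  unfold XM
  rw [smul_smul, inv_mul_cancel₀ this, one_smul]

lemma HM_of (h : Setup d a ρ) (W : Matrix (Fin n) (Fin n) ℂ) :
    cB a (dM d * dM d) W = ((s2 d / n : ℝ) : ℂ) • (1 + HM d a W) := by
  unfold HM
  rw [add_sub_cancel, smul_smul, ← Complex.ofReal_mul, div_mul_div_comm, mul_comm (n:ℝ), div_self (by have := h.s2pos; have := h.npos; positivity)]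
  simp

/-- the loop equation for `ξ` -/
lemma Setup.xi_loop (h : Setup d a ρ) {ν : Measure (Matrix (Fin n) (Fin n) ℂ)} (hν : IsHaarU ν) :
    ∫ W, (xiM d a W * (1 + xiM d a W) + (k/n:ℝ) * xiM d a W * ((XM d a W).trace.re/k)^2
      - (1 - 1/(n:ℝ)^2) * xiM d a W * (1 + (HM d a W).trace.re / k)
      + 2/(n*k^2:ℝ) * ‖XM d a W * XM d a W‖^2
      - 2 * (1 - 1/(n:ℝ)^2) / (k:ℝ)^3 * ((1 + HM d a W) * (XM d a W * XM d a W)).trace.re) ∂ν = 0 := by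
  set c : ℂ := ((c0 k d ^ 2 : ℝ) : ℂ) with hc
  have hk := h.kpos; have hn := h.npos; have hs := h.s2pos; have hc0 := h.c0pos
  have key := hν.loopB h.ha (dM_herm d) (T := fun B => (c / k * (B * B).trace - 1) • B) (Q := fun _ => 1) (R := fun B => B)
    (S := fun B => (2 * c / k) • B) (σ := fun B => (c / k * (B * B).trace - 1)) ?_ continuous_const (continuous_cB _ _) ?_ ?_ ?_
  · have h2 := congrArg (fun z : ℂ => ((c0 k d^2 / (n*k) : ℝ)) * z.re) key
    simp only [Complex.zero_re, mul_zero] at h2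
    rw [← h2]
    have hcB := continuous_cB a (dM d)
    have hcB2 := continuous_cB a (dM d * dM d)
    rw [← RCLike.re_eq_complex_re, ← integral_re, ← integral_const_mul]
    · refine integral_congr_ae (Filter.Eventually.of_forall fun W => ?_)
      beta_reduce
      rw [RCLike.re_eq_complex_re, XM_of h, HM_of h, dM_trace, h.sum0]
      have hX := XM_herm d a W
      have hXX : (XM d a W * XM d a W).IsHermitian := by
        unfold Matrix.IsHermitian; rw [Matrix.conjTranspose_mul, hX.eq]
      have t1 := herm_tr_sq hX
      have t2 := herm_tr_sq hXX
      have t3 := herm_tr hX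
      have t4 := herm_tr (HM_herm d a W)
      simp only [smul_mul_assoc, mul_smul_comm, Matrix.trace_smul, smul_eq_mul, Matrix.mul_one, Matrix.trace_one, smul_smul, Fintype.card_fin,
        Complex.ofReal_zero, zero_mul, sub_zero]
      rw [show XM d a W * XM d a W * XM d a W * XM d a W = XM d a W * XM d a W * (XM d a W * XM d a W) by simp only [Matrix.mul_assoc]]
      rw [t1, t2, t3, Matrix.trace_add, Matrix.trace_one, t4, Fintype.card_fin]
      have cc : (c:ℂ) * ((((c0 k d:ℝ):ℂ))⁻¹ * (((c0 k d:ℝ):ℂ))⁻¹) = 1 := by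
        have : ((c0 k d : ℝ) : ℂ) ≠ 0 := by exact_mod_cast h.c0pos.ne'
        rw [hc]; push_cast; field_simp
      obtain ⟨q, hq⟩ : ∃ q : ℂ, q = ((1 + HM d a W) * (XM d a W * XM d a W)).trace := ⟨_, rfl⟩
      have e1 : c / k * ((((c0 k d:ℝ):ℂ))⁻¹ * (((c0 k d:ℝ):ℂ))⁻¹ * (((‖XM d a W‖^2:ℝ)):ℂ)) - 1 = ((xiM d a W : ℝ) : ℂ) := by
        unfold xiM; push_cast; linear_combination ((‖XM d a W‖:ℂ)^2 / k) * cc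
      rw [← hq]
      rw [← Complex.re_ofReal_mul (c0 k d^2 / (n*k))]
      simp only [e1, Complex.ofReal_re]
      have e5 : (‖XM d a W‖^2 : ℝ) = k * (1 + xiM d a W) := by unfold xiM; field_simp; ring
      rw [e5]
      have c0q := h.c0sq
      have c0' : ((n:ℝ)^2 - 1) = c0 k d^2 * (k * s2 d) := by rw [c0q]; field_simp
      have c0'' : (1 - 1/(n:ℝ)^2) = c0 k d^2 * (k * s2 d) / n^2 := by rw [← c0']; field_simp
      rw [c0'']
      rw [← Complex.ofReal_re (xiM d a W * (1 + xiM d a W) + _ - _ + _)]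
      rw [← Complex.re_ofReal_mul (_ / (k:ℝ)^3), ← Complex.sub_re]
      congr 1
      have : ((c0 k d : ℝ) : ℂ) ≠ 0 := by exact_mod_cast h.c0pos.ne'
      have hk' : (k:ℂ) ≠ 0 := by exact_mod_cast hk.ne'
      have hn' : (n:ℂ) ≠ 0 := by exact_mod_cast hn.ne'
      have hs' : ((s2 d : ℝ):ℂ) ≠ 0 := by exact_mod_cast hs.ne'
      rw [hc]
      push_cast
      field_simp
      ring
    · apply hν.integrable
      have hc1 : Continuous fun W : Matrix (Fin n) (Fin n) ℂ => (cB a (dM d) W).trace := Continuous.matrix_trace hcB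
      have hc2 : Continuous fun W : Matrix (Fin n) (Fin n) ℂ => (cB a (dM d) W * cB a (dM d) W).trace := Continuous.matrix_trace (by fun_prop)
      simp only [Matrix.mul_one]
      have hc3 : Continuous fun W : Matrix (Fin n) (Fin n) ℂ => (cB a (dM d * dM d) W).trace := Continuous.matrix_trace hcB2
      have hc4 : Continuous fun W : Matrix (Fin n) (Fin n) ℂ => (cB a (dM d) W * cB a (dM d) W * cB a (dM d) W * (2 * c / k) • cB a (dM d) W).trace := Continuous.matrix_trace (by fun_prop)
      have hc5 : Continuous fun W : Matrix (Fin n) (Fin n) ℂ => (cB a (dM d * dM d) W * (cB a (dM d) W * (2 * c / k) • cB a (dM d) W)).trace := Continuous.matrix_trace (by fun_prop)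
      have hc6 : Continuous fun W : Matrix (Fin n) (Fin n) ℂ => (cB a (dM d) W * (c / k * (cB a (dM d) W * cB a (dM d) W).trace - 1) • cB a (dM d) W).trace := Continuous.matrix_trace (by fun_prop)
      have hc7 : Continuous fun W : Matrix (Fin n) (Fin n) ℂ => ((c / k * (cB a (dM d) W * cB a (dM d) W).trace - 1) • cB a (dM d) W).trace := Continuous.matrix_trace (by fun_prop)
      fun_prop
  · have hcB := continuous_cB a (dM d)
    have hc2 : Continuous fun W : Matrix (Fin n) (Fin n) ℂ => (cB a (dM d) W * cB a (dM d) W).trace := Continuous.matrix_trace (by fun_prop)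
    fun_prop
  · fun_prop
  · have hcB := continuous_cB a (dM d)
    have hc2 : Continuous fun W : Matrix (Fin n) (Fin n) ℂ => (cB a (dM d) W * cB a (dM d) W).trace := Continuous.matrix_trace (by fun_prop)
    fun_prop
  · intro B δ _ hB
    have h1 := ((hasDerivAt_tr (hB.fun_mul hB)).const_mul (c / k)).sub_const 1
    have h2 := h1.fun_smul hB
    refine h2.congr_deriv ?_
    simp only [Matrix.one_mul, Matrix.mul_one]
    congr 2
    rw [Matrix.trace_add, Matrix.trace_mul_comm δ, smul_mul_assoc, Matrix.trace_smul, smul_eq_mul]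
    ring
end Xi

open MeasureTheory ProbabilityTheory Matrix
open scoped Matrix ENNReal
set_option linter.unusedSectionVars false

section Xi3
open scoped Matrix.Norms.Frobenius NNReal

variable {n k : ℕ} {d : Fin n → ℝ} {a : Fin k → Fin n} {ρ : ℝ}

lemma xi_pt {ξ y2 τ h R q e p s : ℝ} (hξ : -1 ≤ ξ) (hy0 : 0 ≤ y2) (hy : y2 ≤ 1 + ξ) (hτ : |τ| ≤ h)
    (hR : R ≤ (1 + s * h) * (1 + ξ)) (hq : 0 ≤ q) (he0 : 0 ≤ e) (he : e ≤ q^2) (he1 : e ≤ 1)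
    (hp : 0 ≤ p) (hp1 : p ≤ 1) (hs : p^2 * s ≤ p) (hR0 : R ≤ 0 ∨ 0 ≤ R) :
    ξ^2 / 4 - 40 * (p^2 + h^2 + q^2) ≤ ξ * (1 + ξ) + q * ξ * y2 - (1 - e) * ξ * (1 + τ) - 2 * (1 - e) * p^2 * R := by
  have hh : 0 ≤ h := (abs_nonneg _).trans hτ
  obtain ⟨hτ1, hτ2⟩ := abs_le.1 hτ
  have t1 : -(ξ^2/16 + 4 * q^2) ≤ e * ξ := by
    have : e^2 ≤ q^2 := by nlinarith
    nlinarith [sq_nonneg (ξ/4 + 2 * e)]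
  have t2 : -(ξ^2/16 + 4 * q^2) ≤ q * ξ * y2 := by
    rcases le_total 0 ξ with h0 | h0
    · have : 0 ≤ q * ξ * y2 := by positivity
      nlinarith [sq_nonneg ξ, sq_nonneg q]
    · have : q * (-ξ) * y2 ≤ q * (-ξ) * 1 := by
        apply mul_le_mul_of_nonneg_left (by linarith) (mul_nonneg hq (by linarith))
      nlinarith [sq_nonneg (ξ/4 + 2 * q)]
  have t3 : (1 - e) * ξ * τ ≤ ξ^2/16 + 4 * h^2 := by
    have h1 : τ^2 ≤ h^2 := sq_le_sq' hτ1 hτ2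
    have h2 : ((1-e)*τ)^2 ≤ τ^2 := by
      rw [mul_pow]
      have : (1-e)^2 ≤ 1 := by nlinarith
      nlinarith [sq_nonneg τ]
    nlinarith [sq_nonneg (ξ/4 - 2 * ((1-e)*τ))]
  have t4 : 2 * (1 - e) * p^2 * R ≤ 2 * (p^2 + p * h) * (1 + ξ) := by
    rcases hR0 with h0 | h0
    · have : 2 * (1 - e) * p^2 * R ≤ 0 := mul_nonpos_of_nonneg_of_nonpos (by nlinarith [sq_nonneg p]) h0
      have : 0 ≤ 2 * (p^2 + p * h) * (1 + ξ) := mul_nonneg (by positivity) (by linarith)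
      linarith
    · have h1 : 2 * (1 - e) * p^2 * R ≤ 2 * p^2 * R := by
        have : 0 ≤ p^2 * R := by positivity
        nlinarith
      have h2 : 2 * p^2 * R ≤ 2 * p^2 * ((1 + s * h) * (1 + ξ)) := mul_le_mul_of_nonneg_left hR (by positivity)
      have h3 : p^2 * s * (h * (1 + ξ)) ≤ p * (h * (1 + ξ)) := mul_le_mul_of_nonneg_right hs (mul_nonneg hh (by linarith))
      nlinarith
  have t5 : 2 * (p^2 + p * h) * (1 + ξ) ≤ ξ^2/8 + 30 * (p^2 + h^2) := by
    have hp2 : p^2 ≤ 1 := by nlinarith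
    have hp4 : p^2 * p^2 ≤ p^2 := by nlinarith [sq_nonneg p]
    have hph : p^2 * h^2 ≤ h^2 := by nlinarith [sq_nonneg h]
    nlinarith [sq_nonneg (ξ/4 - 4 * p^2), sq_nonneg (ξ/4 - 4 * (p * h)), sq_nonneg (p - h)]
  nlinarith

set_option maxHeartbeats 1000000 in
lemma Setup.xi_moment (h : Setup d a ρ) {ν : Measure (Matrix (Fin n) (Fin n) ℂ)} (hν : IsHaarU ν) :
    ∫ W, (xiM d a W)^2 ∂ν ≤ 160 * (1/(k:ℝ)^2 + (k * (ρ^2/s2 d)) + (k/n:ℝ)^2) := by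
  have hk := h.kpos; have hn := h.npos; have hs := h.s2pos; have hn2 := h.n2; have hk2 := h.k2; have hkn := h.kn
  have := hν.prob
  have key := h.xi_loop hν
  have hX := continuous_XM d a
  have hH := continuous_HM d a
  have ci : Continuous fun W => (xiM d a W)^2/4 - 40 * (1/(k:ℝ)^2 + ‖HM d a W‖^2/k + (k/n:ℝ)^2) := by fun_prop
  have c1 : Continuous fun W => (XM d a W).trace := Continuous.matrix_trace hX
  have c2 : Continuous fun W => (HM d a W).trace := Continuous.matrix_trace hH
  have c3 : Continuous fun W => ((1 + HM d a W) * (XM d a W * XM d a W)).trace := Continuous.matrix_trace (by fun_prop)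
  have mono := integral_mono (μ := ν) (hν.integrable ci) (hν.integrable (by fun_prop)) (fun W => ?_) |>.trans key.le
  · rw [integral_sub (hν.integrable (by fun_prop)) (hν.integrable (by fun_prop)), integral_div, integral_const_mul,
      integral_add (hν.integrable (by fun_prop)) (hν.integrable (by fun_prop)), integral_add (hν.integrable (by fun_prop)) (hν.integrable (by fun_prop)),
      integral_div] at mono
    simp only [integral_const, probReal_univ, one_smul] at mono
    have h1 := h.HM_moment hν
    have h2 : (∫ W, ‖HM d a W‖^2/k ∂ν) ≤ k * (ρ^2/s2 d) := by
      rw [integral_div, div_le_iff₀ hk]; nlinarith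
    linarith
  · beta_reduce
    set x := ‖XM d a W‖ with hx
    set hh := ‖HM d a W‖ with hhh
    have hsk := Real.sqrt_pos.2 hk
    have hsk2 := Real.sq_sqrt hk.le
    have e1 : x^2 = k * (1 + xiM d a W) := by unfold xiM; field_simp; ring
    have e2 : hh^2/k = (hh/Real.sqrt k)^2 := by rw [div_pow, hsk2]
    rw [e2]
    have p1 : -1 ≤ xiM d a W := by unfold xiM; have : 0 ≤ ‖XM d a W‖^2/k := by positivity
                                   linarith
    have p2 : ((XM d a W).trace.re/k)^2 ≤ 1 + xiM d a W := by
      have h1 := (Complex.abs_re_le_norm _).trans (abs_tr_le (XM d a W))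
      have h2 : (XM d a W).trace.re^2 ≤ (Real.sqrt k * x)^2 := by
        rw [← sq_abs]; exact pow_le_pow_left₀ (abs_nonneg _) h1 2
      rw [mul_pow, hsk2, e1] at h2
      rw [div_pow, div_le_iff₀ (by positivity)]
      calc _ ≤ _ := h2
        _ = _ := by ring
    have p3 : |(HM d a W).trace.re/k| ≤ hh / Real.sqrt k := by
      have h1 := (Complex.abs_re_le_norm _).trans (abs_tr_le (HM d a W))
      rw [abs_div, abs_of_pos hk, div_le_div_iff₀ hk hsk]
      calc _ ≤ Real.sqrt k * hh * Real.sqrt k := mul_le_mul_of_nonneg_right h1 hsk.le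
        _ = hh * (Real.sqrt k)^2 := by ring
        _ = _ := by rw [hsk2]
    have p4 : ((1 + HM d a W) * (XM d a W * XM d a W)).trace.re / k ≤ (1 + Real.sqrt k * (hh/Real.sqrt k)) * (1 + xiM d a W) := by
      rw [mul_div_cancel₀ _ hsk.ne', div_le_iff₀ hk, Matrix.add_mul, Matrix.trace_add, Complex.add_re, Matrix.one_mul, herm_tr_sq (XM_herm d a W), Complex.ofReal_re]
      have h1 := (Complex.re_le_norm _).trans (abs_tr_mul_le (HM d a W) (XM d a W * XM d a W))
      have h2 := norm_mul_le (XM d a W) (XM d a W)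
      have h3 : ‖HM d a W‖ * ‖XM d a W * XM d a W‖ ≤ hh * (x * x) := mul_le_mul_of_nonneg_left h2 (norm_nonneg _)
      rw [← hx]
      have e9 : (1 + hh) * (1 + xiM d a W) * k = x^2 + hh * (x * x) := by
        rw [← sq, e1]; ring
      rw [e9]
      exact add_le_add le_rfl (h1.trans h3)
    have hsq : Real.sqrt k ≤ k := by
      rw [Real.sqrt_le_left hk.le]; exact le_self_pow₀ (by linarith) two_ne_zero
    have main := xi_pt (q := k/n) (e := 1/(n:ℝ)^2) (p := 1/k) (s := Real.sqrt k) p1 (sq_nonneg _) p2 p3 p4 (by positivity) (by positivity)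
      (by rw [div_pow]; gcongr; nlinarith) (by rw [div_le_one (by positivity)]; nlinarith) (by positivity)
      (by rw [div_le_one hk]; linarith) (by
        rw [div_pow, one_pow, div_mul_eq_mul_div, one_mul, div_le_div_iff₀ (by positivity) hk]; nlinarith) (le_total _ _)
    have pos : 0 ≤ 2/(n*k^2:ℝ) * ‖XM d a W * XM d a W‖^2 := by positivity
    have e3 : 2 * (1 - 1/(n:ℝ)^2) / (k:ℝ)^3 * ((1 + HM d a W) * (XM d a W * XM d a W)).trace.re =
      2 * (1 - 1/(n:ℝ)^2) * (1/k)^2 * (((1 + HM d a W) * (XM d a W * XM d a W)).trace.re / k) := by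
      field_simp
    rw [e3]
    have e4 : (1/(k:ℝ))^2 = 1/(k:ℝ)^2 := by rw [div_pow, one_pow]
    rw [e4] at main ⊢
    linarith

lemma mul_stiefel_le {κ N m : Type} [Fintype N] [DecidableEq N] [Fintype κ] [DecidableEq κ] [Fintype m]
    {V : Matrix κ N ℂ} (hV : V * Vᴴ = 1) (M : Matrix m N ℂ) : ‖M * Vᴴ‖ ≤ ‖M‖ := by
  have h1 : ‖M‖^2 = ‖M * Vᴴ‖^2 + ‖M * (1 - Vᴴ * V)‖^2 := by
    rw [frob_sq_trace, frob_sq_trace, frob_sq_trace, ← Complex.add_re, ← Matrix.trace_add]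
    congr 2
    have e : (1 - Vᴴ * V) * (1 - Vᴴ * V) = 1 - Vᴴ * V := by
      have : Vᴴ * V * (Vᴴ * V) = Vᴴ * V := by
        calc Vᴴ * V * (Vᴴ * V) = Vᴴ * (V * Vᴴ) * V := by simp only [Matrix.mul_assoc]
          _ = _ := by rw [hV, Matrix.mul_one]
      rw [Matrix.mul_sub, Matrix.mul_one, Matrix.sub_mul, Matrix.one_mul, this, sub_self, sub_zero]
    have e' : (1 - Vᴴ * V)ᴴ = 1 - Vᴴ * V := by simp
    have : M * (1 - Vᴴ * V) * (M * (1 - Vᴴ * V))ᴴ = M * (1 - Vᴴ * V) * Mᴴ := by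
      rw [Matrix.conjTranspose_mul, e', ← Matrix.mul_assoc, Matrix.mul_assoc M, e]
    rw [this, Matrix.conjTranspose_mul, Matrix.conjTranspose_conjTranspose, Matrix.mul_sub, Matrix.sub_mul]
    simp only [Matrix.mul_assoc, Matrix.mul_one]
    simp
  exact le_of_sq_le_sq (by nlinarith [sq_nonneg ‖M * (1 - Vᴴ * V)‖]) (norm_nonneg _)

lemma mul_dM_le {m : Type} [Fintype m] {e : Fin n → ℝ} {ε : ℝ} (he : ∀ i, |e i| ≤ ε) (hε : 0 ≤ ε) (M : Matrix m (Fin n) ℂ) :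
    ‖M * dM e‖ ≤ ε * ‖M‖ := by
  refine le_of_sq_le_sq ?_ (by positivity)
  rw [mul_pow, frob_sq, frob_sq, Finset.mul_sum]
  refine Finset.sum_le_sum fun i _ => ?_
  rw [Finset.mul_sum]
  refine Finset.sum_le_sum fun j _ => ?_
  rw [dM, Matrix.mul_diagonal, norm_mul, mul_pow, mul_comm, Complex.norm_real, Real.norm_eq_abs]
  gcongr
  exact he j

lemma stiefel_lip {e : Fin n → ℝ} {ε : ℝ} (he : ∀ i, |e i| ≤ ε) (hε : 0 ≤ ε) {V V' : Matrix (Fin k) (Fin n) ℂ}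
    (hV : V * Vᴴ = 1) (hV' : V' * V'ᴴ = 1) :
    ‖V * dM e * Vᴴ - V' * dM e * V'ᴴ‖ ≤ 2 * ε * ‖V - V'‖ := by
  have e1 : V * dM e * Vᴴ - V' * dM e * V'ᴴ = (V - V') * dM e * Vᴴ + (((V - V') * dM e) * V'ᴴ)ᴴ := by
    rw [Matrix.conjTranspose_mul, Matrix.conjTranspose_mul, (dM_herm e).eq, Matrix.conjTranspose_conjTranspose, Matrix.conjTranspose_sub]
    simp only [Matrix.sub_mul, Matrix.mul_sub, Matrix.mul_assoc]
    abel
  rw [e1]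
  refine (norm_add_le _ _).trans ?_
  rw [Matrix.frobenius_norm_conjTranspose]
  have h1 := (mul_stiefel_le hV ((V - V') * dM e)).trans (mul_dM_le he hε _)
  have h2 := (mul_stiefel_le hV' ((V - V') * dM e)).trans (mul_dM_le he hε _)
  linarith

lemma sel_stiefel {a : Fin k → Fin n} (ha : Function.Injective a) {W : Matrix (Fin n) (Fin n) ℂ} (hW : W ∈ unitaryGroup (Fin n) ℂ) :
    (selM a * W) * (selM a * W)ᴴ = 1 := by
  rw [Matrix.conjTranspose_mul, ← Matrix.mul_assoc, Matrix.mul_assoc (selM a) W, show W * Wᴴ = 1 from mem_unitaryGroup_iff.1 hW,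
    Matrix.mul_one, selM_mul_selMT ha]

lemma cB_eq (a : Fin k → Fin n) (D W : Matrix (Fin n) (Fin n) ℂ) : cB a D W = (selM a * W) * D * (selM a * W)ᴴ := by
  unfold cB cA
  rw [Matrix.conjTranspose_mul]
  simp only [Matrix.mul_assoc]

lemma dM_sq (d : Fin n → ℝ) : dM d * dM d = dM fun i => d i^2 := by
  unfold dM
  rw [Matrix.diagonal_mul_diagonal]
  congr 1
  ext i
  push_cast; ring

lemma pow8_add (x y : ℝ) : (x + y)^8 ≤ 128 * (x^8 + y^8) := by
  have h2 : ∀ x y : ℝ, (x + y)^2 ≤ 2 * (x^2 + y^2) := fun x y => by nlinarith [sq_nonneg (x - y)]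
  have h4 : (x + y)^4 ≤ 8 * (x^4 + y^4) := by
    have := pow_le_pow_left₀ (sq_nonneg _) (h2 x y) 2
    have := h2 (x^2) (y^2)
    nlinarith
  have := pow_le_pow_left₀ (by positivity) h4 2
  have := h2 (x^4) (y^4)
  nlinarith

lemma Setup.HM8 (h : Setup d a ρ) {ν : Measure (Matrix (Fin n) (Fin n) ℂ)} (hν : IsHaarU ν) (hc : 9 * k ≤ n) :
    ∫ W, ‖HM d a W‖^8 ∂ν ≤ (2^18 * 80640 * Real.exp 3) * ((n * (ρ^2/s2 d)^2)^4 + (k^2 * (ρ^2/s2 d))^4) := by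
  have hk := h.kpos; have hn := h.npos; have hs := h.s2pos; have hρ := h.rhopos
  have := hν.prob
  let F : Matrix (Fin k) (Fin n) ℂ → ℝ := fun V => ‖((n / s2 d : ℝ) : ℂ) • (V * dM (fun i => d i^2) * Vᴴ) - 1‖
  let L : ℝ≥0 := ⟨2 * (n / s2 d) * ρ^2, by positivity⟩
  have hL : (L:ℝ) = 2 * (n / s2 d) * ρ^2 := rfl
  have hFL : LipschitzOnWith L F {V | V * Vᴴ = 1} := by
    refine LipschitzOnWith.of_dist_le_mul fun V hV V' hV' => ?_
    rw [Real.dist_eq, dist_eq_norm, hL]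
    refine (abs_norm_sub_norm_le _ _).trans ?_
    rw [sub_sub_sub_cancel_right, ← smul_sub, norm_smul, Complex.norm_real, Real.norm_eq_abs, abs_of_pos (by positivity)]
    have := stiefel_lip (e := fun i => d i^2) (ε := ρ^2) (fun i => by
      rw [abs_of_nonneg (sq_nonneg _)]; exact sq_le_sq' (by have := abs_le.1 (h.bd i); linarith) (abs_le.1 (h.bd i)).2) (by positivity) hV hV'
    calc _ ≤ (n / s2 d) * (2 * ρ^2 * ‖V - V'‖) := mul_le_mul_of_nonneg_left this (by positivity)
      _ = _ := by ring
  obtain ⟨G, hG, hGF⟩ := hFL.extend_real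
  have hae : ∀ᵐ W ∂ν, G (selM a * W) = ‖HM d a W‖ := by
    filter_upwards [hν.unit] with W hW
    rw [← hGF (sel_stiefel h.ha hW)]
    simp only [F, HM]
    rw [cB_eq, dM_sq]
  have hLpos : 0 < L := by
    rw [← NNReal.coe_pos, hL]; positivity
  have m8 := conc_moment8 hν hLpos hG h.ha (by simpa using hc) (by simpa using (by exact_mod_cast hn : 0 < n))
  have e0 : ∫ W', G (selM a * W') ∂ν = ∫ W', ‖HM d a W'‖ ∂ν := integral_congr_ae hae
  rw [e0] at m8
  set E0 := ∫ W', ‖HM d a W'‖ ∂ν with hE0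
  have e1 : ∫ W, (G (selM a * W) - E0)^8 ∂ν = ∫ W, (‖HM d a W‖ - E0)^8 ∂ν := by
    refine integral_congr_ae ?_
    filter_upwards [hae] with W hW
    rw [hW]
  rw [e1] at m8
  have hH := continuous_HM d a
  have h1 : ∫ W, ‖HM d a W‖^8 ∂ν ≤ ∫ W, 128 * ((‖HM d a W‖ - E0)^8 + E0^8) ∂ν := by
    refine integral_mono (hν.integrable (by fun_prop)) (hν.integrable (by fun_prop)) fun W => ?_
    have := pow8_add (‖HM d a W‖ - E0) E0
    rwa [sub_add_cancel] at this
  rw [integral_const_mul, integral_add (hν.integrable (by fun_prop)) (hν.integrable (by fun_prop))] at h1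
  simp only [integral_const, probReal_univ, one_smul] at h1
  have hE2 : E0^2 ≤ k^2 * (ρ^2/s2 d) := by
    refine le_trans ?_ (h.HM_moment hν)
    have : 0 ≤ ∫ W, (‖HM d a W‖ - E0)^2 ∂ν := integral_nonneg fun W => sq_nonneg _
    have e : ∀ W, (‖HM d a W‖ - E0)^2 = ‖HM d a W‖^2 - 2 * E0 * ‖HM d a W‖ + E0^2 := fun W => by ring
    simp only [e] at this
    rw [integral_add (hν.integrable (by fun_prop)) (hν.integrable (by fun_prop)), integral_sub (hν.integrable (by fun_prop)) (hν.integrable (by fun_prop)),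
      integral_const_mul, ← hE0] at this
    simp only [integral_const, probReal_univ, one_smul] at this
    nlinarith
  have hE8 : E0^8 ≤ (k^2 * (ρ^2/s2 d))^4 := by
    calc E0^8 = (E0^2)^4 := by ring
      _ ≤ _ := pow_le_pow_left₀ (sq_nonneg _) hE2 4
  rw [Fintype.card_fin, hL] at m8
  have e2 : ((2 * (n / s2 d) * ρ^2)^2 / n)^4 = 256 * (n * (ρ^2/s2 d)^2)^4 := by
    field_simp
    ring
  rw [e2] at m8
  have hexp : (1:ℝ) ≤ Real.exp 3 := Real.one_le_exp (by norm_num)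
  have hpos1 : 0 ≤ (n * (ρ^2/s2 d)^2)^4 := by positivity
  have hpos2 : 0 ≤ (k^2 * (ρ^2/s2 d))^4 := by positivity
  nlinarith [mul_nonneg hpos1 (Real.exp_pos 3).le, mul_nonneg hpos2 (Real.exp_pos 3).le, mul_nonneg hpos2 (sub_nonneg.2 hexp)]
end Xi3

open MeasureTheory ProbabilityTheory Matrix
open scoped Matrix ENNReal
set_option linter.unusedSectionVars false

section Resolvent
open scoped Matrix.Norms.Frobenius NNReal
open ComplexConjugate

variable {k : ℕ}

noncomputable def Rs (z : ℂ) (X : Matrix (Fin k) (Fin k) ℂ) : Matrix (Fin k) (Fin k) ℂ := (X - z • (1 : Matrix (Fin k) (Fin k) ℂ))⁻¹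

lemma Rs_spec {X : Matrix (Fin k) (Fin k) ℂ} (hX : X.IsHermitian) {z : ℂ} (hz : z.im ≠ 0) :
    (X - z • 1) * ((hX.eigenvectorUnitary : Matrix (Fin k) (Fin k) ℂ) * diagonal (fun i => ((hX.eigenvalues i : ℂ) - z)⁻¹) *
      (hX.eigenvectorUnitary : Matrix (Fin k) (Fin k) ℂ)ᴴ) = 1 := by
  set U : Matrix (Fin k) (Fin k) ℂ := (hX.eigenvectorUnitary : Matrix (Fin k) (Fin k) ℂ) with hU
  have hU1 : Uᴴ * U = 1 := mem_unitaryGroup_iff'.1 hX.eigenvectorUnitary.2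
  have hU2 : U * Uᴴ = 1 := mem_unitaryGroup_iff.1 hX.eigenvectorUnitary.2
  have hsp : X = U * diagonal (fun i => (hX.eigenvalues i : ℂ)) * Uᴴ := by
    conv_lhs => rw [hX.spectral_theorem]
    rfl
  have e : X - z • 1 = U * diagonal (fun i => (hX.eigenvalues i : ℂ) - z) * Uᴴ := by
    have : diagonal (fun i => (hX.eigenvalues i : ℂ) - z) = diagonal (fun i => (hX.eigenvalues i : ℂ)) - z • (1 : Matrix (Fin k) (Fin k) ℂ) := by
      ext i j
      by_cases h : i = j
      · subst h; simp
      · simp [h]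
    rw [this, Matrix.mul_sub, Matrix.sub_mul, ← hsp, mul_smul_comm, Matrix.mul_one, smul_mul_assoc, hU2]
  rw [e]
  calc _ = U * (diagonal (fun i => (hX.eigenvalues i : ℂ) - z) * (Uᴴ * U) * diagonal (fun i => ((hX.eigenvalues i : ℂ) - z)⁻¹)) * Uᴴ := by
        simp only [Matrix.mul_assoc]
    _ = 1 := by
        rw [hU1, Matrix.mul_one, Matrix.diagonal_mul_diagonal]
        have : (fun i => ((hX.eigenvalues i : ℂ) - z) * ((hX.eigenvalues i : ℂ) - z)⁻¹) = fun _ => 1 := by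
          ext i
          apply mul_inv_cancel₀
          intro h
          apply hz
          have := congrArg Complex.im h
          simpa using this
        rw [this, Matrix.diagonal_one, Matrix.mul_one, hU2]

lemma Rs_eq {X : Matrix (Fin k) (Fin k) ℂ} (hX : X.IsHermitian) {z : ℂ} (hz : z.im ≠ 0) :
    Rs z X = (hX.eigenvectorUnitary : Matrix (Fin k) (Fin k) ℂ) * diagonal (fun i => ((hX.eigenvalues i : ℂ) - z)⁻¹) *
      (hX.eigenvectorUnitary : Matrix (Fin k) (Fin k) ℂ)ᴴ :=
  Matrix.inv_eq_right_inv (Rs_spec hX hz)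

lemma Rs_mul {X : Matrix (Fin k) (Fin k) ℂ} (hX : X.IsHermitian) {z : ℂ} (hz : z.im ≠ 0) : (X - z • 1) * Rs z X = 1 := by
  rw [Rs_eq hX hz, Rs_spec hX hz]

lemma mul_Rs {X : Matrix (Fin k) (Fin k) ℂ} (hX : X.IsHermitian) {z : ℂ} (hz : z.im ≠ 0) : Rs z X * (X - z • 1) = 1 :=
  mul_eq_one_comm.1 (Rs_mul hX hz)

lemma Rs_conj {X : Matrix (Fin k) (Fin k) ℂ} (hX : X.IsHermitian) {z : ℂ} (hz : z.im ≠ 0) : Rs (conj z) X = (Rs z X)ᴴ := by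
  apply Matrix.inv_eq_right_inv
  have := congrArg Matrix.conjTranspose (mul_Rs hX hz)
  rw [Matrix.conjTranspose_mul, Matrix.conjTranspose_sub, Matrix.conjTranspose_smul, Matrix.conjTranspose_one, hX.eq] at this
  exact this

lemma Rs_trace {X : Matrix (Fin k) (Fin k) ℂ} (hX : X.IsHermitian) {z : ℂ} (hz : z.im ≠ 0) :
    (Rs z X).trace = ∑ i, ((hX.eigenvalues i : ℂ) - z)⁻¹ := by
  have hU1 : (hX.eigenvectorUnitary : Matrix (Fin k) (Fin k) ℂ)ᴴ * (hX.eigenvectorUnitary : Matrix (Fin k) (Fin k) ℂ) = 1 :=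
    mem_unitaryGroup_iff'.1 hX.eigenvectorUnitary.2
  rw [Rs_eq hX hz, Matrix.trace_mul_comm, ← Matrix.mul_assoc, hU1, Matrix.one_mul, Matrix.trace_diagonal]

lemma stj_esd {X : Matrix (Fin k) (Fin k) ℂ} (hX : X.IsHermitian) {z : ℂ} (hz : z.im ≠ 0) :
    stj (esd X) z = (k:ℂ)⁻¹ * (Rs z X).trace := by
  rw [stj, esd, dif_pos hX, integral_smul_measure, integral_finsetSum_measure, Rs_trace hX hz]
  · simp [integral_dirac]
  · intro i _
    exact integrable_dirac (by simp)

lemma X_mul_Rs {X : Matrix (Fin k) (Fin k) ℂ} (hX : X.IsHermitian) {z : ℂ} (hz : z.im ≠ 0) : X * Rs z X = 1 + z • Rs z X := by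
  have := Rs_mul hX hz
  rw [Matrix.sub_mul, smul_mul_assoc, Matrix.one_mul] at this
  rw [← this]; abel

lemma Rs_mul_X {X : Matrix (Fin k) (Fin k) ℂ} (hX : X.IsHermitian) {z : ℂ} (hz : z.im ≠ 0) : Rs z X * X = 1 + z • Rs z X := by
  have := mul_Rs hX hz
  rw [Matrix.mul_sub, mul_smul_comm, Matrix.mul_one] at this
  rw [← this]; abel

lemma conj_im_ne {z : ℂ} (hz : z.im ≠ 0) : (conj z).im ≠ 0 := by simpa using hz

/-- `‖G‖² = Im Tr G / Im z`. -/
lemma Rs_norm_sq {X : Matrix (Fin k) (Fin k) ℂ} (hX : X.IsHermitian) {z : ℂ} (hz : z.im ≠ 0) :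
    ‖Rs z X‖^2 * z.im = (Rs z X).trace.im := by
  have hc := Rs_conj hX hz
  have e1 : Rs z X - (Rs z X)ᴴ = (z - conj z) • (Rs z X * (Rs z X)ᴴ) := by
    have h1 := Rs_mul hX (conj_im_ne hz)
    rw [hc] at h1
    have h2 := mul_Rs hX hz
    calc Rs z X - (Rs z X)ᴴ = Rs z X * ((X - conj z • 1) * (Rs z X)ᴴ) - Rs z X * (X - z • 1) * (Rs z X)ᴴ := by
          rw [h1, h2, Matrix.mul_one, Matrix.one_mul]
      _ = _ := by
          simp only [Matrix.mul_sub, Matrix.sub_mul, smul_mul_assoc, mul_smul_comm, Matrix.mul_one, Matrix.one_mul, sub_smul, Matrix.mul_assoc]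
          abel
  have e2 := congrArg (fun M => (Matrix.trace M).im) e1
  simp only [Matrix.trace_sub, Matrix.trace_smul, Matrix.trace_conjTranspose, smul_eq_mul] at e2
  have e3 : z - conj z = ((2 * z.im : ℝ) : ℂ) * Complex.I := by rw [Complex.sub_conj]
  rw [e3, Complex.sub_im, mul_assoc, Complex.im_ofReal_mul] at e2
  rw [frob_sq_trace]
  simp at e2
  linarith

lemma shift_norm {X N : Matrix (Fin k) (Fin k) ℂ} (hX : X.IsHermitian) (z : ℂ) : |z.im| * ‖N‖ ≤ ‖(X - z • 1) * N‖ := by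
  set Y : Matrix (Fin k) (Fin k) ℂ := X - (z.re : ℂ) • 1 with hY
  have hYh : Yᴴ = Y := by
    rw [hY, Matrix.conjTranspose_sub, hX.eq, Matrix.conjTranspose_smul, Matrix.conjTranspose_one]; simp
  have e : (X - z • 1) * N = Y * N - ((z.im : ℂ) * Complex.I) • N := by
    conv_lhs => rw [← Complex.re_add_im z]
    rw [hY, add_smul, ← sub_sub, Matrix.sub_mul, smul_mul_assoc _ 1 N, Matrix.one_mul]
  have key : ‖(X - z • 1) * N‖^2 = ‖Y * N‖^2 + z.im^2 * ‖N‖^2 := by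
    have hr : (Y * (N * Nᴴ)).trace.im = 0 := by
      have : star (Y * (N * Nᴴ)).trace = (Y * (N * Nᴴ)).trace := by
        rw [← Matrix.trace_conjTranspose, Matrix.conjTranspose_mul, hYh, Matrix.conjTranspose_mul, Matrix.conjTranspose_conjTranspose, Matrix.trace_mul_comm]
      exact Complex.conj_eq_iff_im.1 this
    have hr2 : (N * Nᴴ * Y).trace.im = 0 := by rw [Matrix.trace_mul_comm]; exact hr
    rw [frob_sq_trace, frob_sq_trace (Y * N), frob_sq_trace N, e, Matrix.conjTranspose_sub, Matrix.conjTranspose_smul, Matrix.conjTranspose_mul, hYh]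
    simp only [Matrix.sub_mul, Matrix.mul_sub, smul_mul_assoc, mul_smul_comm, Matrix.trace_sub, Matrix.trace_smul, smul_eq_mul]
    rw [show Y * N * Nᴴ = Y * (N * Nᴴ) from Matrix.mul_assoc _ _ _, show N * (Nᴴ * Y) = N * Nᴴ * Y from (Matrix.mul_assoc _ _ _).symm]
    simp [hr, hr2]
    ring
  refine le_of_sq_le_sq ?_ (norm_nonneg _)
  rw [key, mul_pow, sq_abs]
  nlinarith [sq_nonneg ‖Y * N‖]

lemma Rs_mul_le {X : Matrix (Fin k) (Fin k) ℂ} (hX : X.IsHermitian) {z : ℂ} (hz : z.im ≠ 0) (M : Matrix (Fin k) (Fin k) ℂ) :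
    ‖Rs z X * M‖ ≤ ‖M‖ / |z.im| := by
  rw [le_div_iff₀ (abs_pos.2 hz), mul_comm]
  have := shift_norm (N := Rs z X * M) hX z
  rwa [← Matrix.mul_assoc, Rs_mul hX hz, Matrix.one_mul] at this

lemma RsH_mul_le {X : Matrix (Fin k) (Fin k) ℂ} (hX : X.IsHermitian) {z : ℂ} (hz : z.im ≠ 0) (M : Matrix (Fin k) (Fin k) ℂ) :
    ‖(Rs z X)ᴴ * M‖ ≤ ‖M‖ / |z.im| := by
  have := Rs_mul_le hX (conj_im_ne hz) M
  rw [Rs_conj hX hz] at this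
  simpa using this

lemma isUnit_shift {X : Matrix (Fin k) (Fin k) ℂ} (hX : X.IsHermitian) {z : ℂ} (hz : z.im ≠ 0) : IsUnit (X - z • (1 : Matrix (Fin k) (Fin k) ℂ)) :=
  IsUnit.of_mul_eq_one _ (Rs_mul hX hz)

lemma continuous_Rs {α : Type} [TopologicalSpace α] {X : α → Matrix (Fin k) (Fin k) ℂ} {z : α → ℂ} (hX : Continuous X) (hz : Continuous z)
    (hh : ∀ p, (X p).IsHermitian) (him : ∀ p, (z p).im ≠ 0) : Continuous fun p => Rs (z p) (X p) := by
  have : CompleteSpace (Matrix (Fin k) (Fin k) ℂ) := FiniteDimensional.complete ℂ _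
  rw [continuous_iff_continuousAt]
  intro p
  obtain ⟨u, hu⟩ := isUnit_shift (hh p) (him p)
  have h1 : ContinuousAt Ring.inverse (X p - z p • (1 : Matrix (Fin k) (Fin k) ℂ)) := hu ▸ NormedRing.inverse_continuousAt u
  have h2 : Continuous fun p => X p - z p • (1 : Matrix (Fin k) (Fin k) ℂ) := by fun_prop
  have h3 := ContinuousAt.comp (f := fun p => X p - z p • (1 : Matrix (Fin k) (Fin k) ℂ)) (x := p) h1 h2.continuousAt
  refine h3.congr (Filter.Eventually.of_forall fun q => ?_)
  simp only [Function.comp, Rs, Matrix.nonsing_inv_eq_ringInverse]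

lemma hasDerivAt_Rs {c : ℝ → Matrix (Fin k) (Fin k) ℂ} {δ : Matrix (Fin k) (Fin k) ℂ} {z : ℂ} (h0 : (c 0).IsHermitian) (hz : z.im ≠ 0)
    (hc : HasDerivAt c δ 0) : HasDerivAt (fun t => Rs z (c t)) (-(Rs z (c 0) * δ * Rs z (c 0))) 0 := by
  have : CompleteSpace (Matrix (Fin k) (Fin k) ℂ) := FiniteDimensional.complete ℂ _
  obtain ⟨u, hu⟩ := isUnit_shift h0 hz
  have h1 := hasFDerivAt_ringInverse (𝕜 := ℝ) u
  rw [hu] at h1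
  have h2 : HasDerivAt (fun t => c t - z • (1 : Matrix (Fin k) (Fin k) ℂ)) δ 0 := hc.sub_const _
  have h3 := HasFDerivAt.comp_hasDerivAt (f := fun t => c t - z • (1 : Matrix (Fin k) (Fin k) ℂ)) 0 h1 h2
  have hi : (↑u⁻¹ : Matrix (Fin k) (Fin k) ℂ) = Rs z (c 0) := by
    rw [Rs, ← hu, Matrix.coe_units_inv]
  have h4 : (-(ContinuousLinearMap.mulLeftRight ℝ (Matrix (Fin k) (Fin k) ℂ)) ↑u⁻¹ ↑u⁻¹) δ = -(Rs z (c 0) * δ * Rs z (c 0)) := by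
    rw [hi]; simp
  rw [h4] at h3
  refine h3.congr_of_eventuallyEq (Filter.Eventually.of_forall fun t => ?_)
  simp only [Function.comp, Rs, Matrix.nonsing_inv_eq_ringInverse]

end Resolvent

open MeasureTheory ProbabilityTheory Matrix
open scoped Matrix ENNReal
set_option linter.unusedSectionVars false

section ResLoop
open scoped Matrix.Norms.Frobenius NNReal
open ComplexConjugate

variable {n k : ℕ} {d : Fin n → ℝ} {a : Fin k → Fin n} {ρ : ℝ}

noncomputable def mm (z : ℂ) (X : Matrix (Fin k) (Fin k) ℂ) : ℂ := (k:ℂ)⁻¹ * (Rs z X).trace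
noncomputable def DD (z : ℂ) (X : Matrix (Fin k) (Fin k) ℂ) : ℂ := mm z X ^2 + z * mm z X + 1

lemma mm_conj {X : Matrix (Fin k) (Fin k) ℂ} (hX : X.IsHermitian) {z : ℂ} (hz : z.im ≠ 0) : mm (conj z) X = conj (mm z X) := by
  unfold mm
  rw [Rs_conj hX hz, Matrix.trace_conjTranspose, map_mul, map_inv₀, Complex.conj_natCast]
  rfl

lemma DD_conj {X : Matrix (Fin k) (Fin k) ℂ} (hX : X.IsHermitian) {z : ℂ} (hz : z.im ≠ 0) : DD (conj z) X = conj (DD z X) := by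
  unfold DD
  rw [mm_conj hX hz]; simp

lemma continuous_mm {α : Type} [TopologicalSpace α] {X : α → Matrix (Fin k) (Fin k) ℂ} {z : α → ℂ} (hX : Continuous X) (hz : Continuous z)
    (hh : ∀ p, (X p).IsHermitian) (him : ∀ p, (z p).im ≠ 0) : Continuous fun p => mm (z p) (X p) := by
  unfold mm
  exact continuous_const.mul (Continuous.matrix_trace (continuous_Rs hX hz hh him))

lemma continuous_DD {α : Type} [TopologicalSpace α] {X : α → Matrix (Fin k) (Fin k) ℂ} {z : α → ℂ} (hX : Continuous X) (hz : Continuous z)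
    (hh : ∀ p, (X p).IsHermitian) (him : ∀ p, (z p).im ≠ 0) : Continuous fun p => DD (z p) (X p) := by
  have := continuous_mm hX hz hh him
  unfold DD
  fun_prop

lemma loop_alg {X G Gc H : Matrix (Fin k) (Fin k) ℂ} {c s Db q n' k' : ℂ} (hc : c ≠ 0) (hn : n' ≠ 0) (hk : k' ≠ 0) :
    (c / (n' * k')) * (n' * ((c⁻¹ • X) * (Db • G)).trace - 0 * (Db • G).trace
      + (-(c * Db)) * (((c⁻¹ • X) * G).trace * ((c⁻¹ • X) * G).trace - G.trace * (((s / n') • (1 + H)) * G).trace)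
      + (((c⁻¹ • X) * G * (c⁻¹ • X) * ((-(c / k' * q)) • (Gc * Gc))).trace
        - (((s / n') • (1 + H)) * (G * ((-(c / k' * q)) • (Gc * Gc)))).trace)) =
    Db * (k'⁻¹ * (X * G).trace) - k' / n' * (k'⁻¹ * (X * G).trace)^2 * Db
      + (c^2 * s * k' / n'^2) * (k'⁻¹ * G.trace) * (k'⁻¹ * G.trace + k'⁻¹ * (H * G).trace) * Db
      - q / (n' * k') * (k'⁻¹ * (X * G * X * (Gc * Gc)).trace)
      + (c^2 * s * k' / n'^2) / k'^2 * q * (k'⁻¹ * (G * (Gc * Gc)).trace + k'⁻¹ * (H * (G * (Gc * Gc))).trace) := by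
  simp only [smul_mul_assoc, mul_smul_comm, Matrix.trace_smul, smul_eq_mul, Matrix.add_mul, Matrix.one_mul, Matrix.trace_add, smul_add]
  field_simp
  ring

lemma hd_alg {c : ℂ} {z : ℂ} (hz : z.im ≠ 0) (hcr : conj c = c) (b : ℝ → Matrix (Fin k) (Fin k) ℂ) (δ : Matrix (Fin k) (Fin k) ℂ)
    (h0 : (b 0).IsHermitian) (hb : HasDerivAt b δ 0) :
    HasDerivAt (fun t => DD (conj z) (c • b t) • Rs z (c • b t))
      ((-(c * DD (conj z) (c • b 0))) • (Rs z (c • b 0) * δ * Rs z (c • b 0)) +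
        (((-(c / k * (2 * mm (conj z) (c • b 0) + conj z))) • (Rs (conj z) (c • b 0) * Rs (conj z) (c • b 0))) * δ).trace • Rs z (c • b 0)) 0 := by
  have hX0 : (c • b 0).IsHermitian := by
    unfold Matrix.IsHermitian
    rw [Matrix.conjTranspose_smul, h0.eq]
    rw [show star c = c from hcr]
  have hcb : HasDerivAt (fun t => c • b t) (c • δ) 0 := hb.const_smul c
  have h1 := hasDerivAt_Rs (c := fun t => c • b t) hX0 hz hcb
  have h2 := hasDerivAt_Rs (c := fun t => c • b t) hX0 (conj_im_ne hz) hcb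
  have h3 : HasDerivAt (fun t => mm (conj z) (c • b t)) ((k:ℂ)⁻¹ * (-(Rs (conj z) (c • b 0) * (c • δ) * Rs (conj z) (c • b 0))).trace) 0 :=
    (hasDerivAt_tr h2).const_mul _
  have h4 : HasDerivAt (fun t => DD (conj z) (c • b t)) _ 0 := ((h3.fun_pow 2).fun_add (h3.const_mul (conj z))).add_const 1
  refine (h4.fun_smul h1).congr_deriv ?_
  have e : (Rs (conj z) (c • b 0) * (c • δ) * Rs (conj z) (c • b 0)).trace = c * (Rs (conj z) (c • b 0) * Rs (conj z) (c • b 0) * δ).trace := by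
    rw [mul_smul_comm, smul_mul_assoc, Matrix.trace_smul, smul_eq_mul, Matrix.trace_mul_comm, ← Matrix.mul_assoc]
  rw [Matrix.trace_neg, e]
  have e5 : (-(c / k * (2 * mm (conj z) (c • b 0) + conj z)) • (Rs (conj z) (c • b 0) * Rs (conj z) (c • b 0)) * δ).trace =
      -(c / k * (2 * mm (conj z) (c • b 0) + conj z)) * (Rs (conj z) (c • b 0) * Rs (conj z) (c • b 0) * δ).trace := by
    rw [smul_mul_assoc, Matrix.trace_smul, smul_eq_mul]
  rw [e5, mul_smul_comm, smul_mul_assoc]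
  generalize (Rs (conj z) (c • b 0) * Rs (conj z) (c • b 0) * δ).trace = τ
  generalize DD (conj z) (c • b 0) = D'
  generalize mm (conj z) (c • b 0) = m'
  generalize Rs z (c • b 0) = G'
  generalize G' * δ * G' = J
  simp only [Nat.cast_ofNat]
  module

lemma Setup.res_loop (h : Setup d a ρ) {ν : Measure (Matrix (Fin n) (Fin n) ℂ)} (hν : IsHaarU ν) {z : ℂ} (hz : z.im ≠ 0) :
    ∫ W, (conj (DD z (XM d a W)) * (1 + z * mm z (XM d a W)) - ((k:ℂ) / n) * (1 + z * mm z (XM d a W))^2 * conj (DD z (XM d a W))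
      + (1 - 1/(n:ℂ)^2) * mm z (XM d a W) * (mm z (XM d a W) + (k:ℂ)⁻¹ * (HM d a W * Rs z (XM d a W)).trace) * conj (DD z (XM d a W))
      - (2 * conj (mm z (XM d a W)) + conj z) / (n * k) *
        ((k:ℂ)⁻¹ * (XM d a W * Rs z (XM d a W) * XM d a W * ((Rs z (XM d a W))ᴴ * (Rs z (XM d a W))ᴴ)).trace)
      + (1 - 1/(n:ℂ)^2) / (k:ℂ)^2 * (2 * conj (mm z (XM d a W)) + conj z) *
        ((k:ℂ)⁻¹ * (Rs z (XM d a W) * ((Rs z (XM d a W))ᴴ * (Rs z (XM d a W))ᴴ)).trace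
          + (k:ℂ)⁻¹ * (HM d a W * (Rs z (XM d a W) * ((Rs z (XM d a W))ᴴ * (Rs z (XM d a W))ᴴ))).trace)) ∂ν = 0 := by
  have hk := h.kpos; have hn := h.npos; have hs := h.s2pos; have hc0 := h.c0pos
  have hk' : (k:ℂ) ≠ 0 := by exact_mod_cast hk.ne'
  have hn' : (n:ℂ) ≠ 0 := by exact_mod_cast hn.ne'
  have hs' : ((s2 d : ℝ):ℂ) ≠ 0 := by exact_mod_cast hs.ne'
  obtain ⟨c, hc⟩ : ∃ c : ℂ, c = ((c0 k d : ℝ) : ℂ) := ⟨_, rfl⟩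
  have hcne : c ≠ 0 := by rw [hc]; exact_mod_cast hc0.ne'
  have hX := continuous_XM d a
  have cR := continuous_Rs (z := fun _ => z) hX continuous_const (XM_herm d a) (fun _ => hz)
  have cR' := continuous_Rs (z := fun _ => conj z) hX continuous_const (XM_herm d a) (fun _ => conj_im_ne hz)
  have cm' := continuous_mm (z := fun _ => conj z) hX continuous_const (XM_herm d a) (fun _ => conj_im_ne hz)
  have cD' := continuous_DD (z := fun _ => conj z) hX continuous_const (XM_herm d a) (fun _ => conj_im_ne hz)
  have hXW : ∀ W, c • cB a (dM d) W = XM d a W := fun W => by rw [hc]; rfl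
  have key := hν.loopB h.ha (dM_herm d) (T := fun B => DD (conj z) (c • B) • Rs z (c • B)) (Q := fun B => Rs z (c • B))
    (R := fun B => Rs z (c • B)) (S := fun B => (-(c / k * (2 * mm (conj z) (c • B) + conj z))) • (Rs (conj z) (c • B) * Rs (conj z) (c • B)))
    (σ := fun B => -(c * DD (conj z) (c • B)))
    (by simp only [hXW]; fun_prop) (by simp only [hXW]; fun_prop) (by simp only [hXW]; fun_prop) (by simp only [hXW]; fun_prop) (by simp only [hXW]; fun_prop)
    (fun b δ h0 hb => hd_alg hz (by rw [hc]; simp) b δ h0 hb)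
  have k2 := congrArg (fun w : ℂ => (c / (n * k)) * w) key
  beta_reduce at k2
  rw [mul_zero, ← integral_const_mul] at k2
  rw [← k2]
  refine integral_congr_ae (Filter.Eventually.of_forall fun W => ?_)
  beta_reduce
  rw [hXW, XM_of h, HM_of h, dM_trace, h.sum0, ← hc, Fintype.card_fin, Complex.ofReal_zero, Complex.ofReal_div, Complex.ofReal_natCast,
    loop_alg hcne hn' hk']
  have hXh := XM_herm d a W
  have e1 : (k:ℂ)⁻¹ * (XM d a W * Rs z (XM d a W)).trace = 1 + z * mm z (XM d a W) := by
    rw [X_mul_Rs hXh hz, Matrix.trace_add, Matrix.trace_one, Matrix.trace_smul, Fintype.card_fin, mm]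
    field_simp
    rfl
  have e2 : c^2 * ((s2 d:ℝ):ℂ) * k / (n:ℂ)^2 = 1 - 1/(n:ℂ)^2 := by
    have := h.c0sq
    rw [hc, ← Complex.ofReal_pow, this]; push_cast
    field_simp
  rw [e1, e2, DD_conj hXh hz, mm_conj hXh hz, Rs_conj hXh hz]
  rfl
end ResLoop

open MeasureTheory ProbabilityTheory Matrix
open scoped Matrix ENNReal
set_option linter.unusedSectionVars false

section Scalar

lemma young43 {a b ε : ℝ} (ha : 0 ≤ a) (hb : 0 ≤ b) (hε : 0 < ε) : a * b^3 ≤ ε * b^4 + a^4 / ε^3 := by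
  rcases le_total a (ε * b) with h | h
  · have : a * b^3 ≤ (ε * b) * b^3 := mul_le_mul_of_nonneg_right h (by positivity)
    have : 0 ≤ a^4/ε^3 := by positivity
    nlinarith
  · have hb' : b ≤ a / ε := by rw [le_div_iff₀ hε]; linarith
    have : a * b^3 ≤ a * (a/ε)^3 := mul_le_mul_of_nonneg_left (pow_le_pow_left₀ hb hb' 3) ha
    have e : a * (a/ε)^3 = a^4/ε^3 := by rw [div_pow]; ring
    have : 0 ≤ ε * b^4 := by positivity
    linarith

lemma young2 (x y : ℝ) : x * y ≤ y^2/100 + 25 * x^2 := by nlinarith [sq_nonneg (y/10 - 5 * x)]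

/-- `h² M³` absorbed. -/
lemma hM3 {h M D : ℝ} (hM : 0 ≤ M) (hD : 0 ≤ D) (hMD : M^2 ≤ 2 * D + 2603) :
    h^2 * M^3 ≤ D^2/2500 + 10^14 * (h^2 + h^8) := by
  have h8 : 0 ≤ h^8 := by positivity
  rcases le_total 5206 (M^2) with hc | hc
  · have h1 : M^2 ≤ 4 * D := by linarith
    have h2 : M^4 ≤ 16 * D^2 := by nlinarith [sq_nonneg M]
    have := young43 (a := h^2) (b := M) (ε := 1/40000) (sq_nonneg _) hM (by norm_num)
    have e : (h^2)^4 = h^8 := by ring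
    rw [e] at this
    have h20 := sq_nonneg h
    norm_num at this ⊢
    linarith
  · have h1 : M ≤ 73 := by nlinarith
    have h2 : M^3 ≤ 400000 := by nlinarith [sq_nonneg M]
    have h3 : h^2 * M^3 ≤ h^2 * 400000 := mul_le_mul_of_nonneg_left h2 (sq_nonneg _)
    nlinarith [sq_nonneg D, sq_nonneg h]

set_option maxHeartbeats 2000000 in
lemma P_bound {q e h M D u α Q s1 : ℝ} (hM : 0 ≤ M) (hD : 0 ≤ D) (hh : 0 ≤ h) (hMD : M^2 ≤ 2 * D + 2603) (hu0 : 0 ≤ u) (hu : u^2 ≤ M)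
    (hQ0 : 0 ≤ Q) (hQ : Q ≤ 2 * M + 51) (hs : s1 ≤ 2 + 5202 * M^2) (hq0 : 0 ≤ q) (hq : q ≤ 1/10^8) (hqα : q ≤ α^2)
    (he0 : 0 ≤ e) (heq : e ≤ q) (heα : e ≤ 10^5 * α^4) (hα0 : 0 ≤ α) (hα : α ≤ 1) :
    q * s1 * D + e^2 * M^2 * D + M * (h * u) * D + Q * (α * e * 2 + α^2 * u^2 * (q * 5202) + α^2 * (u^2 + h * u))
      ≤ D^2/4 + 5/2 * α^2 * (Q * u^2) + 10^20 * (α^4 + h^2 + h^8) := by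
  have key := hM3 (h := h) hM hD hMD
  have h8 : 0 ≤ h^8 := by positivity
  have h2 : 0 ≤ h^2 := by positivity
  have a4 : 0 ≤ α^4 := by positivity
  -- term 1
  have q2 : q^2 ≤ α^4 := by nlinarith [sq_nonneg α]
  have T1 : q * s1 * D ≤ D^2/50 + 10^17 * α^4 := by
    have h1 : q * s1 * D ≤ q * (2 + 5202 * (2 * D + 2603)) * D := by gcongr; linarith
    have h2 := young2 (q * 13540808) D
    have h3 : q * 10404 * D^2 ≤ D^2/100 := by nlinarith [sq_nonneg D]
    nlinarith
  have e2 : e^2 ≤ q^2 := by nlinarith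
  have e2' : e^2 ≤ 1/10^8 := by nlinarith
  have T2 : e^2 * M^2 * D ≤ D^2/50 + 10^17 * α^4 := by
    have h1 : e^2 * M^2 * D ≤ e^2 * (2 * D + 2603) * D := by gcongr
    have h2 := young2 (e^2 * 2603) D
    have h3 : e^2 * 2 * D^2 ≤ D^2/100 := by nlinarith [sq_nonneg D]
    have h4 : (e^2)^2 ≤ α^4 := by nlinarith [sq_nonneg e]
    nlinarith
  have T3 : M * (h * u) * D ≤ D^2/50 + 10^17 * (h^2 + h^8) := by
    have h1 := young2 (M * (h * u)) D
    have h3 : (M * (h * u))^2 ≤ h^2 * M^3 := by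
      have : (M * (h * u))^2 = h^2 * M^2 * u^2 := by ring
      rw [this]
      calc _ ≤ h^2 * M^2 * M := by gcongr
        _ = _ := by ring
    nlinarith
  have hMh : h^2 * M ≤ h^2 * M^3 + h^2 := by
    have : M ≤ M^3 + 1 := by
      rcases le_total M 1 with h | h
      · have : 0 ≤ M^3 := by positivity
        linarith
      · have := le_self_pow₀ h (three_ne_zero)
        linarith
    nlinarith
  have T5 : Q * (α^2 * (h * u)) ≤ α^2 * (Q * u^2) / 2 + D^2/50 + 10^17 * (h^2 + h^8) := by
    have h1 : h * u ≤ u^2/2 + h^2/2 := by nlinarith [sq_nonneg (h - u)]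
    have h3 : Q * (α^2 * (h * u)) ≤ Q * (α^2 * (u^2/2 + h^2/2)) := by gcongr
    have h4 : Q * α^2 * h^2 ≤ (2 * M + 51) * 1 * h^2 := by
      have : α^2 ≤ 1 := by nlinarith
      gcongr
    nlinarith
  have T6 : Q * (α^2 * u^2 * (q * 5202)) ≤ α^2 * (Q * u^2) := by
    have : 0 ≤ α^2 * (Q * u^2) := by positivity
    nlinarith
  have T7 : Q * (α * e * 2) ≤ D^2/50 + 10^17 * α^4 := by
    have h1 : Q * (α * e * 2) ≤ (2 * M + 51) * (1 * e * 2) := by gcongr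
    have h3 : M ≤ 2 * D + 2604 := by nlinarith [sq_nonneg (M - 1)]
    have h4 : (2 * M + 51) * (1 * e * 2) ≤ (2 * (2 * D + 2604) + 51) * (1 * e * 2) := by gcongr
    have h5 := young2 (8 * e) D
    have h6 : e^2 ≤ e := by nlinarith
    nlinarith
  nlinarith [sq_nonneg D]

/-- stability of the quadratic equation: `w = 2 m_sc + z`, `L = |m - m_sc|`. -/
lemma stab_pt {m s z : ℂ} (hs : s^2 + z * s + 1 = 0) (hsi : 0 < s.im) (hmi : 0 ≤ m.im) (hz : 0 < z.im) (hx : |z.re| ≤ 2) :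
    ‖m - s‖^2 * ‖2 * s + z‖^2 ≤ 8 * ‖m^2 + z * m + 1‖^2 ∧ ‖m - s‖^4 ≤ 4 * ‖m^2 + z * m + 1‖^2 + 16 * ‖2 * s + z‖^4 ∧
    ‖2 * m + z‖ * m.im ≤ 3/2 * ‖2 * s + z‖^2 + 3 * ‖m - s‖^2 := by
  set w := 2 * s + z with hw
  set L := m - s with hL
  have hD : m^2 + z * m + 1 = L * (L + w) := by rw [hL, hw]; linear_combination hs
  have hw2 : w^2 = z^2 - 4 := by rw [hw]; linear_combination 4 * hs
  have hwi : w.im = 2 * s.im + z.im := by rw [hw]; simp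
  have hn : ‖w‖^2 ≤ 2 * w.im^2 := by
    have h1 := congrArg Complex.re hw2
    simp [sq] at h1
    rw [← Complex.normSq_eq_norm_sq, Complex.normSq_apply]
    nlinarith [abs_le.1 hx, sq_nonneg z.im]
  have h3 : w.im / 2 ≤ ‖L + w‖ := by
    have : (L + w).im = m.im + s.im + z.im := by rw [hL, hw]; simp; ring
    have := (Complex.abs_im_le_norm (L + w))
    have := le_abs_self (L+w).im
    linarith
  refine ⟨?_, ?_, ?_⟩
  · rw [hD, norm_mul, mul_pow]
    have h4 : ‖w‖^2 ≤ 8 * ‖L + w‖^2 := by nlinarith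
    calc ‖L‖^2 * ‖w‖^2 ≤ ‖L‖^2 * (8 * ‖L + w‖^2) := by gcongr
      _ = _ := by ring
  · rw [hD, norm_mul]
    have h5 : ‖L‖ ≤ ‖L + w‖ + ‖w‖ := by
      calc ‖L‖ = ‖(L + w) - w‖ := by rw [add_sub_cancel_right]
        _ ≤ _ := norm_sub_le _ _
    have l0 := norm_nonneg L
    have w0 := norm_nonneg w
    rcases le_total (2 * ‖w‖) ‖L‖ with h | h
    · have h6 : ‖L‖/2 ≤ ‖L + w‖ := by linarith
      have h7 : ‖L‖^4 ≤ 4 * (‖L‖ * ‖L + w‖)^2 := by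
        have : ‖L‖^4 = 4 * (‖L‖ * (‖L‖/2))^2 := by ring
        rw [this]
        gcongr
      have : 0 ≤ ‖w‖^4 := by positivity
      linarith
    · have := pow_le_pow_left₀ l0 h 4
      have h8 : 0 ≤ (‖L‖ * ‖L + w‖)^2 := by positivity
      nlinarith
  · have e1 : 2 * m + z = w + 2 * L := by rw [hw, hL]; ring
    have h6 : ‖2 * m + z‖ ≤ ‖w‖ + 2 * ‖L‖ := by
      rw [e1]
      refine (norm_add_le _ _).trans ?_
      rw [norm_mul]; simp
    have h7 : m.im ≤ ‖L‖ + ‖w‖/2 := by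
      have : m.im = L.im + s.im := by rw [hL]; simp
      have := (le_abs_self _).trans (Complex.abs_im_le_norm L)
      have := (le_abs_self _).trans (Complex.abs_im_le_norm w)
      linarith
    have h8 : ‖2 * m + z‖ * m.im ≤ (‖w‖ + 2 * ‖L‖) * (‖L‖ + ‖w‖/2) := by gcongr
    nlinarith [sq_nonneg (‖w‖ - ‖L‖)]

lemma stab_final {ED EL EL4 α w2 A C : ℝ} (hα : 0 < α) (hC : 1 ≤ C) (hA : 0 ≤ A) (hED : 0 ≤ ED) (hw : 0 ≤ w2)
    (h0 : α^2 * EL ≤ 25 * (α^2)^2 + EL4/100)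
    (h1 : EL * w2 ≤ 8 * ED) (h2 : EL4 ≤ 4 * ED + 16 * w2^2)
    (h3 : 3/4 * ED ≤ 5/2 * α^2 * (3/2 * w2 + 3 * EL) + C * (α^4 + A)) :
    EL ≤ 10^8 * C * (α^2 + A / α^2) := by
  have ha2 : 0 < α^2 := by positivity
  have e4 : α^4 = α^2 * α^2 := by ring
  rw [e4] at h3
  set b := α^2 with hb
  rcases le_total (200 * b) w2 with h | h
  · have hw2 : 0 < w2 := by linarith
    have hEL : EL ≤ 8 * ED / w2 := by rw [le_div_iff₀ hw2]; exact h1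
    have h4 : b * EL ≤ ED / 25 := by
      have : b * EL ≤ b * (8 * ED / w2) := by gcongr
      have : b * (8 * ED / w2) ≤ ED / 25 := by
        rw [mul_div_assoc', div_le_iff₀ hw2]; nlinarith
      linarith
    have h5 : ED ≤ 10 * b * w2 + 10 * C * (b * b + A) := by
      nlinarith
    have h6 : EL ≤ 8 * (10 * b * w2 + 10 * C * (b * b + A)) / w2 := by
      refine hEL.trans ?_
      gcongr
    have h7 : 8 * (10 * b * w2 + 10 * C * (b * b + A)) / w2 = 80 * b + 80 * C * (b * b + A) / w2 := by field_simp; ring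
    have h8 : 80 * C * (b * b + A) / w2 ≤ 80 * C * (b * b + A) / b := by
      apply div_le_div_of_nonneg_left (by positivity) ha2; linarith
    have h9 : 80 * C * (b * b + A) / b = 80 * C * (b + A / b) := by field_simp
    have h10 : 0 ≤ A / b := by positivity
    have : 0 ≤ C * (A / b) := by positivity
    nlinarith
  · have hb2 : 0 ≤ b * b := by positivity
    have hw4 : w2^2 ≤ 40000 * (b * b) := by nlinarith
    have hbw : b * w2 ≤ 200 * (b * b) := by nlinarith
    have hCb : b * b ≤ C * (b * b) := by nlinarith
    have hCA : 0 ≤ C * A := by positivity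
    have h5 : ED ≤ 120000 * (C * (b * b + A)) := by
      have : 5/2 * b * (3/2 * w2 + 3 * EL) = 15/4 * (b * w2) + 15/2 * (b * EL) := by ring
      rw [this] at h3
      rw [← sq] at *
      nlinarith
    have h6 : b * EL ≤ 10^8 * C * (b * b + A) := by
      nlinarith
    have h7 : EL ≤ 10^8 * C * (b * b + A) / b := by
      rw [le_div_iff₀ ha2]; linarith
    refine h7.trans (le_of_eq ?_)
    field_simp
end Scalar

open MeasureTheory ProbabilityTheory Matrix
open scoped Matrix ENNReal
set_option linter.unusedSectionVars false

section Res7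
open scoped Matrix.Norms.Frobenius NNReal
open ComplexConjugate

lemma J_bound {D m z t1 t2 t3 t4 : ℂ} {n k : ℕ} (hn : 1 ≤ n) (hk : 1 ≤ k) (hD : D = m^2 + z * m + 1) {T1 T2 T3 T4 s1 : ℝ}
    (h1 : ‖t1‖ ≤ T1) (h2 : ‖t2‖ ≤ T2) (h3 : ‖t3‖ ≤ T3) (h4 : ‖t4‖ ≤ T4) (hs : ‖1 + z * m‖^2 ≤ s1) :
    ‖D‖^2 ≤ (conj D * (1 + z * m) - ((k:ℂ) / n) * (1 + z * m)^2 * conj D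
      + (1 - 1/(n:ℂ)^2) * m * (m + t1) * conj D
      - (2 * conj m + conj z) / (n * k) * t2
      + (1 - 1/(n:ℂ)^2) / (k:ℂ)^2 * (2 * conj m + conj z) * (t3 + t4)).re +
      ((k/n : ℝ) * s1 * ‖D‖ + (1/n : ℝ)^2 * ‖m‖^2 * ‖D‖ + ‖m‖ * T1 * ‖D‖ + ‖2 * m + z‖ * (T2 / (n * k) + (T3 + T4) / k^2)) := by
  have hn' : (1:ℝ) ≤ n := by exact_mod_cast hn
  have hk' : (1:ℝ) ≤ k := by exact_mod_cast hk
  set J : ℂ := (conj D * (1 + z * m) - ((k:ℂ) / n) * (1 + z * m)^2 * conj D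
      + (1 - 1/(n:ℂ)^2) * m * (m + t1) * conj D
      - (2 * conj m + conj z) / (n * k) * t2
      + (1 - 1/(n:ℂ)^2) / (k:ℂ)^2 * (2 * conj m + conj z) * (t3 + t4)) with hJ
  have hc : 2 * conj m + conj z = conj (2 * m + z) := by rw [map_add, map_mul, map_ofNat]
  have hcn : ‖2 * conj m + conj z‖ = ‖2 * m + z‖ := by rw [hc, Complex.norm_conj]
  have e : conj D * D = J + (((k:ℂ) / n) * (1 + z * m)^2 * conj D + (1/(n:ℂ))^2 * m^2 * conj D - (1 - 1/(n:ℂ)^2) * m * t1 * conj D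
      + ((2 * conj m + conj z) / (n * k) * t2 - (1 - 1/(n:ℂ)^2) / (k:ℂ)^2 * (2 * conj m + conj z) * (t3 + t4))) := by
    rw [hJ]
    have : D = m^2 + (1 + z * m) := by rw [hD]; ring
    nth_rewrite 2 [this]
    ring
  have e1 : ‖D‖^2 = (conj D * D).re := by
    rw [← Complex.normSq_eq_conj_mul_self, Complex.ofReal_re, Complex.normSq_eq_norm_sq]
  rw [e1, e, Complex.add_re]
  have hκ : ‖(1 - 1/(n:ℂ)^2)‖ ≤ 1 := by
    have : (1 - 1/(n:ℂ)^2) = ((1 - 1/(n:ℝ)^2 : ℝ) : ℂ) := by push_cast; rfl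
    rw [this, Complex.norm_real, Real.norm_eq_abs, abs_le]
    have : 0 ≤ 1/(n:ℝ)^2 := by positivity
    have : 1/(n:ℝ)^2 ≤ 1 := by rw [div_le_one (by positivity)]; nlinarith
    constructor <;> linarith
  have T10 := (norm_nonneg _).trans h1
  gcongr
  refine (Complex.re_le_norm _).trans ?_
  refine (norm_add_le _ _).trans ?_
  gcongr
  · refine (norm_sub_le _ _).trans ?_
    gcongr
    · refine (norm_add_le _ _).trans ?_
      gcongr
      · rw [norm_mul, norm_mul, norm_pow, norm_div, Complex.norm_natCast, Complex.norm_natCast, Complex.norm_conj]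
        gcongr
      · rw [norm_mul, norm_mul, norm_pow, norm_pow, norm_div, norm_one, Complex.norm_natCast, Complex.norm_conj]
    · rw [norm_mul, norm_mul, norm_mul, Complex.norm_conj]
      calc ‖(1 - 1/(n:ℂ)^2)‖ * ‖m‖ * ‖t1‖ * ‖D‖ ≤ 1 * ‖m‖ * T1 * ‖D‖ := by gcongr
        _ = _ := by ring
  · refine (norm_sub_le _ _).trans ?_
    have e9 : ‖2 * m + z‖ * (T2 / (n * k) + (T3 + T4) / k^2) = ‖2 * m + z‖ * (T2 / (n * k)) + ‖2 * m + z‖ * ((T3 + T4) / k^2) := mul_add _ _ _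
    rw [e9]
    refine add_le_add ?_ ?_
    · rw [norm_mul, norm_div, norm_mul, hcn, Complex.norm_natCast, Complex.norm_natCast]
      calc _ ≤ ‖2 * m + z‖ / (n * k) * T2 := by gcongr
        _ = _ := by ring
    · rw [norm_mul, norm_mul, norm_div, norm_pow, hcn, Complex.norm_natCast]
      calc _ ≤ 1 / (k:ℝ)^2 * ‖2 * m + z‖ * (T3 + T4) := by
            have := (norm_add_le t3 t4).trans (add_le_add h3 h4)
            gcongr
        _ = _ := by ring

/-- trace bounds -/
lemma T_bounds {k : ℕ} (hk : 1 ≤ k) {X H : Matrix (Fin k) (Fin k) ℂ} (hX : X.IsHermitian) {z : ℂ} (hz : 0 < z.im) (hz2 : ‖z‖ ≤ 51) :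
    0 ≤ (mm z X).im ∧
    ‖(k:ℂ)⁻¹ * (H * Rs z X).trace‖ ≤ ‖H‖ / Real.sqrt (k * z.im) * Real.sqrt (mm z X).im ∧
    ‖(k:ℂ)⁻¹ * (X * Rs z X * X * ((Rs z X)ᴴ * (Rs z X)ᴴ)).trace‖ ≤ (2 + 5202 * (Real.sqrt (mm z X).im)^2 / z.im) / z.im ∧
    ‖(k:ℂ)⁻¹ * (Rs z X * ((Rs z X)ᴴ * (Rs z X)ᴴ)).trace‖ ≤ (Real.sqrt (mm z X).im)^2 / z.im^2 ∧
    ‖(k:ℂ)⁻¹ * (H * (Rs z X * ((Rs z X)ᴴ * (Rs z X)ᴴ))).trace‖ ≤ ‖H‖ / Real.sqrt (k * z.im) * Real.sqrt (mm z X).im / z.im^2 := by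
  have hk' : (0:ℝ) < k := by exact_mod_cast hk
  set G := Rs z X with hG
  set i := (mm z X).im with hi
  have hGi : ‖G‖^2 * z.im = k * i := by
    rw [Rs_norm_sq hX hz.ne', hi, mm, ← hG]
    rw [← Complex.ofReal_natCast, ← Complex.ofReal_inv, Complex.im_ofReal_mul]
    field_simp
  have hi0 : 0 ≤ i := by
    have : 0 ≤ k * i := by rw [← hGi]; positivity
    exact nonneg_of_mul_nonneg_right this hk'
  have hu2 := Real.sq_sqrt hi0
  have hη := abs_of_pos hz
  have hGG : ‖G‖ ^ 2 / (k * z.im) = i / z.im^2 := by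
    field_simp; linarith
  have hG1 : ‖G‖ / k = Real.sqrt i / Real.sqrt (k * z.im) := by
    have h1 : ‖G‖ = Real.sqrt (k * i / z.im) := by
      rw [← hGi, mul_div_assoc, div_self hz.ne', mul_one, Real.sqrt_sq (norm_nonneg _)]
    have hs1 := Real.sqrt_pos.2 hz
    have hs2 := Real.sqrt_pos.2 hk'
    rw [h1, Real.sqrt_div' _ hz.le, Real.sqrt_mul hk'.le, Real.sqrt_mul hk'.le]
    rw [div_div, div_eq_div_iff (by positivity) (by positivity)]
    have := Real.mul_self_sqrt hk'.le
    calc _ = (Real.sqrt k * Real.sqrt k) * Real.sqrt i * Real.sqrt z.im := by ring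
      _ = _ := by rw [this]; ring
  have hkn : ‖(k:ℂ)⁻¹‖ = (k:ℝ)⁻¹ := by rw [norm_inv, Complex.norm_natCast]
  have hGh : ‖Gᴴ‖ = ‖G‖ := Matrix.frobenius_norm_conjTranspose _
  have hGhGh : ‖Gᴴ * Gᴴ‖ ≤ ‖G‖ / z.im := by
    have := RsH_mul_le hX hz.ne' (Gᴴ)
    rwa [hGh, hη] at this
  have hz2' : ‖z‖^2 ≤ 2601 := by nlinarith [norm_nonneg z]
  refine ⟨hi0, ?_, ?_, ?_, ?_⟩
  · rw [norm_mul, hkn]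
    calc _ ≤ (k:ℝ)⁻¹ * (‖H‖ * ‖G‖) := by gcongr; exact abs_tr_mul_le _ _
      _ = ‖H‖ * (‖G‖ / k) := by ring
      _ = _ := by rw [hG1]; ring
  · rw [norm_mul, hkn]
    have hXG : ‖X * G‖^2 ≤ 2 * k + 5202 * ‖G‖^2 := by
      rw [hG, X_mul_Rs hX hz.ne', ← hG]
      have h1 : ‖(1 : Matrix (Fin k) (Fin k) ℂ) + z • G‖ ≤ ‖(1 : Matrix (Fin k) (Fin k) ℂ)‖ + ‖z‖ * ‖G‖ := by
        refine (norm_add_le _ _).trans ?_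
        rw [norm_smul]
      have h2 : ‖(1 : Matrix (Fin k) (Fin k) ℂ)‖^2 = k := by
        rw [frob_sq_trace]; simp
      have h3 := pow_le_pow_left₀ (norm_nonneg _) h1 2
      have h4 : ‖z‖^2 * ‖G‖^2 ≤ 2601 * ‖G‖^2 := by gcongr
      nlinarith [sq_nonneg (‖(1 : Matrix (Fin k) (Fin k) ℂ)‖ - ‖z‖ * ‖G‖)]
    have hXGH : ‖X * (Gᴴ * Gᴴ)‖ ≤ ‖X * G‖ / z.im := by
      have e : X * (Gᴴ * Gᴴ) = Gᴴ * (X * Gᴴ) := by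
        have h1 := X_mul_Rs hX (conj_im_ne hz.ne')
        have h2 := Rs_mul_X hX (conj_im_ne hz.ne')
        rw [Rs_conj hX hz.ne', ← hG] at h1 h2
        rw [← Matrix.mul_assoc, h1]
        simp [Matrix.add_mul, Matrix.mul_add]
      have e2 : ‖X * Gᴴ‖ = ‖X * G‖ := by
        rw [← Matrix.frobenius_norm_conjTranspose, Matrix.conjTranspose_mul, Matrix.conjTranspose_conjTranspose, hX.eq]
        rw [hG, X_mul_Rs hX hz.ne', Rs_mul_X hX hz.ne']
      rw [e, ← e2]
      have := RsH_mul_le hX hz.ne' (X * Gᴴ)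
      rwa [hη] at this
    have e3 : X * G * X * (Gᴴ * Gᴴ) = (X * G) * (X * (Gᴴ * Gᴴ)) := by simp only [Matrix.mul_assoc]
    rw [e3]
    calc _ ≤ (k:ℝ)⁻¹ * (‖X * G‖ * (‖X * G‖ / z.im)) := by
          gcongr
          exact (abs_tr_mul_le _ _).trans (by gcongr)
      _ = ‖X * G‖^2 / (k * z.im) := by field_simp
      _ ≤ (2 * k + 5202 * ‖G‖^2) / (k * z.im) := by gcongr
      _ = 2 * k / (k * z.im) + 5202 * (‖G‖^2 / (k * z.im)) := by ring
      _ = _ := by rw [hGG, hu2]; field_simp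
  · rw [norm_mul, hkn, hu2, ← hGG]
    calc _ ≤ (k:ℝ)⁻¹ * (‖G‖ * (‖G‖ / z.im)) := by
          gcongr
          exact (abs_tr_mul_le _ _).trans (by gcongr)
      _ = _ := by field_simp
  · rw [norm_mul, hkn]
    have h5 : ‖G * (Gᴴ * Gᴴ)‖ ≤ ‖G‖ / z.im / z.im := by
      have := Rs_mul_le hX hz.ne' (Gᴴ * Gᴴ)
      rw [hη] at this
      exact this.trans (by gcongr)
    calc _ ≤ (k:ℝ)⁻¹ * (‖H‖ * (‖G‖ / z.im / z.im)) := by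
          gcongr
          exact (abs_tr_mul_le _ _).trans (by gcongr)
      _ = ‖H‖ * (‖G‖ / k) / z.im^2 := by ring
      _ = _ := by rw [hG1]; ring

end Res7

open MeasureTheory ProbabilityTheory Matrix
open scoped Matrix ENNReal
set_option linter.unusedSectionVars false

section Res8
open scoped Matrix.Norms.Frobenius NNReal
open ComplexConjugate
variable {n k : ℕ} {d : Fin n → ℝ} {a : Fin k → Fin n} {ρ : ℝ}

lemma stab_scal {n k η : ℝ} (hk : 10^6 ≤ k) (hkn : 81 * k^4 ≤ n) (h1 : 1/k ≤ η) (h2 : η ≤ 50) :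
    0 < 1/(k*η) ∧ 1/(k*η) ≤ 1 ∧ k/n ≤ 1/10^8 ∧ k/n ≤ (1/(k*η))^2 ∧ 1/n ≤ k/n ∧ 1/n ≤ 10^5 * (1/(k*η))^4 := by
  have hk0 : 0 < k := by linarith
  have hn0 : 0 < n := by have : 0 < k^4 := by positivity
                         linarith
  have hη : 0 < η := lt_of_lt_of_le (by positivity) h1
  have h3 : 1 ≤ k * η := by rw [div_le_iff₀ hk0] at h1; linarith
  have h4 : k * η ≤ 50 * k := by nlinarith
  have h5 : 1/(50*k) ≤ 1/(k*η) := one_div_le_one_div_of_le (by positivity) h4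
  have h50 : 0 < 1/(50*k) := by positivity
  have h6 : k/n ≤ 1/(81*k^3) := by
    rw [div_le_div_iff₀ hn0 (by positivity)]; nlinarith
  refine ⟨by positivity, (div_le_one (by positivity)).2 h3, h6.trans ?_, h6.trans ?_, by gcongr; linarith, ?_⟩
  · gcongr
    nlinarith [pow_le_pow_left₀ (by norm_num) hk 3]
  · refine le_trans ?_ (pow_le_pow_left₀ h50.le h5 2)
    rw [div_pow, one_pow]
    gcongr
    nlinarith [sq_nonneg k, mul_le_mul_of_nonneg_left hk (sq_nonneg k)]
  · refine le_trans ?_ (mul_le_mul_of_nonneg_left (pow_le_pow_left₀ h50.le h5 4) (by norm_num))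
    calc 1/n ≤ 1/(81*k^4) := by gcongr
      _ ≤ _ := by
        rw [div_pow, mul_pow]
        have : 0 < k^4 := by positivity
        rw [mul_div_assoc', div_le_div_iff₀ (by positivity) (by positivity)]
        nlinarith

lemma stab_pointwise {J t1 t2 t3 t4 m z D : ℂ} {n k : ℕ} {η h u : ℝ} (hk : (10:ℝ)^6 ≤ k) (hkn : 81 * (k:ℝ)^4 ≤ n) (h1 : 1/(k:ℝ) ≤ η) (h2 : η ≤ 50)
    (hz2 : ‖z‖ ≤ 51) (hD : D = m^2 + z*m + 1) (hh : 0 ≤ h) (hu0 : 0 ≤ u) (hui : u^2 = m.im)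
    (hJ : J = conj D * (1 + z * m) - ((k:ℂ) / n) * (1 + z * m)^2 * conj D
      + (1 - 1/(n:ℂ)^2) * m * (m + t1) * conj D
      - (2 * conj m + conj z) / (n * k) * t2
      + (1 - 1/(n:ℂ)^2) / (k:ℂ)^2 * (2 * conj m + conj z) * (t3 + t4))
    (ht1 : ‖t1‖ ≤ h * u) (ht2 : ‖t2‖ ≤ (2 + 5202 * u^2 / η) / η) (ht3 : ‖t3‖ ≤ u^2/η^2) (ht4 : ‖t4‖ ≤ h * u / η^2) :
    3/4 * ‖D‖^2 ≤ J.re + 5/2 * (1/(k*η))^2 * (‖2*m+z‖ * m.im) + 10^20 * ((1/(k*η))^4 + h^2 + h^8) := by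
  obtain ⟨a0, a1, a2, a3, a4, a5⟩ := stab_scal hk hkn h1 h2
  have hk0 : (0:ℝ) < k := by linarith
  have hn0 : (0:ℝ) < n := by have : 0 < (k:ℝ)^4 := by positivity
                             linarith
  have hη : 0 < η := lt_of_lt_of_le (by positivity) h1
  have hs1 : ‖1 + z * m‖^2 ≤ 2 + 5202 * ‖m‖^2 := by
    have e1 : ‖1 + z * m‖ ≤ 1 + 51 * ‖m‖ := by
      refine (norm_add_le _ _).trans ?_
      rw [norm_one, norm_mul]; gcongr
    have := pow_le_pow_left₀ (norm_nonneg _) e1 2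
    nlinarith [sq_nonneg (1 - 51 * ‖m‖)]
  have hMD : ‖m‖^2 ≤ 2 * ‖D‖ + 2603 := by
    have e1 : m^2 = D - (z * m + 1) := by rw [hD]; ring
    have e2 : ‖m‖^2 ≤ ‖D‖ + (51 * ‖m‖ + 1) := by
      rw [← norm_pow, e1]
      refine (norm_sub_le _ _).trans ?_
      gcongr
      refine (norm_add_le _ _).trans ?_
      rw [norm_one, norm_mul]; gcongr
    nlinarith [sq_nonneg (‖m‖ - 51)]
  have hQ : ‖2*m+z‖ ≤ 2 * ‖m‖ + 51 := by
    refine (norm_add_le _ _).trans ?_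
    rw [norm_mul]; simp; linarith
  have hb := J_bound (n := n) (k := k) (by exact_mod_cast (Nat.cast_pos.1 hn0)) (by exact_mod_cast (Nat.cast_pos.1 hk0)) hD ht1 ht2 ht3 ht4 hs1
  rw [← hJ] at hb
  have hP := P_bound (norm_nonneg m) (norm_nonneg D) hh hMD hu0 (by rw [hui]; exact (le_abs_self _).trans (Complex.abs_im_le_norm _)) (norm_nonneg (2*m+z)) hQ le_rfl
    (by positivity) a2 a3 (by positivity) a4 a5 a0.le a1
  have e : ((2 + 5202 * u^2 / η) / η) / (n * k) + (u^2/η^2 + h * u / η^2) / (k:ℝ)^2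
     = ((1/(k*η)) * (1/n) * 2 + (1/(k*η))^2 * u^2 * (k/n * 5202) + (1/(k*η))^2 * (u^2 + h * u)) := by
    field_simp
  rw [e] at hb
  rw [hui] at *
  linarith

/-- final scalar bookkeeping -/
lemma stab_end {k n r η E2 E8 : ℝ} {C8 : ℝ} (hC8 : 1 ≤ C8) (hk : 10^6 ≤ k) (hn : 0 < n) (h1 : 1/k ≤ η) (h2 : η ≤ 50) (hr : 0 ≤ r) (hnr : 1 ≤ n * r)
    (hβ : k^4*n*r^2 ≤ 1) (hE2 : E2 ≤ k^2 * r) (hE8 : E8 ≤ C8 * ((n * r^2)^4 + (k^2 * r)^4)) :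
    (1/(k*η))^2 + (E2/(k*η) + E8/(k*η)^4) / (1/(k*η))^2 ≤ (10^6 * C8) * (1/k^2 + k^3*n*r^2)/η^2 := by
  have hk0 : 0 < k := by linarith
  have hη : 0 < η := lt_of_lt_of_le (by positivity) h1
  have f1 : k^2 * r ≤ k^2 * (n * r^2) := by
    have : r ≤ n * r^2 := by nlinarith
    gcongr
  have f2 : k^2 * r ≤ 1/k^2 := by
    refine f1.trans ?_
    rw [le_div_iff₀ (by positivity)]
    nlinarith
  have f3 : n * r^2 ≤ 1/k^2 := by
    rw [le_div_iff₀ (by positivity)]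
    have : n * r^2 * k^2 ≤ n * r^2 * k^4 := by
      gcongr <;> first | linarith | norm_num
    nlinarith
  have f4 : (n * r^2)^4 ≤ 1/k^2 := by
    have h1 : (n*r^2)^4 ≤ (1/k^2)^4 := by gcongr
    have h2 : (1/k^2)^4 ≤ (1/k^2)^1 := by
      refine pow_le_pow_of_le_one (by positivity) ?_ (by norm_num)
      rw [div_le_one (by positivity)]; nlinarith
    linarith
  have f5 : (k^2*r)^4 ≤ 1/k^2 := by
    have h1 : (k^2*r)^4 ≤ (1/k^2)^4 := by gcongr
    have h2 : (1/k^2)^4 ≤ (1/k^2)^1 := by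
      refine pow_le_pow_of_le_one (by positivity) ?_ (by norm_num)
      rw [div_le_one (by positivity)]; nlinarith
    linarith
  have hE8' : E8 ≤ 2 * C8 * (1/k^2) := by nlinarith
  have e : (1/(k*η))^2 + (E2/(k*η) + E8/(k*η)^4) / (1/(k*η))^2 = (1/k^2 + k * E2 * η^3 + E8 / k^2) / η^2 := by
    field_simp
    ring
  rw [e]
  gcongr
  have g1 : k * E2 * η^3 ≤ 125000 * (k^3*n*r^2) := by
    have : η^3 ≤ 50^3 := by gcongr
    calc k * E2 * η^3 ≤ k * (k^2 * (n * r^2)) * η^3 := by gcongr; linarith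
      _ ≤ k * (k^2 * (n * r^2)) * 50^3 := by gcongr
      _ = _ := by ring
  have g2 : E8 / k^2 ≤ 2 * C8 * (1/k^2) := by
    rw [div_le_iff₀ (by positivity)]
    refine hE8'.trans ?_
    have : (1:ℝ) ≤ k^2 := by nlinarith
    exact le_mul_of_one_le_right (by positivity) this
  have p1 : 0 < 1/k^2 := by positivity
  have p2 : 0 ≤ k^3*n*r^2 := by positivity
  nlinarith [mul_nonneg (sub_nonneg.2 hC8) p1.le, mul_nonneg (sub_nonneg.2 hC8) p2]

noncomputable def Cstab : ℝ := 10^8 * 10^20 * (10^6 * (2^18 * 80640 * Real.exp 3))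

lemma Setup.stab (h : Setup d a ρ) {ν : Measure (Matrix (Fin n) (Fin n) ℂ)} (hν : IsHaarU ν) (hk : (10:ℝ)^6 ≤ k) (hkn : 81 * (k:ℝ)^4 ≤ n)
    (hβ : (k:ℝ)^4 * n * (ρ^2/s2 d)^2 ≤ 1) {x η : ℝ} (hx : |x| ≤ 2) (h1 : 1/(k:ℝ) ≤ η) (h2 : η ≤ 50) :
    ∫ W, ‖mm ⟨x, η⟩ (XM d a W) - stj semicircle ⟨x, η⟩‖^2 ∂ν ≤ Cstab * (1/(k:ℝ)^2 + (k:ℝ)^3 * n * (ρ^2/s2 d)^2) / η^2 := by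
  have := hν.prob
  have hk0 := h.kpos; have hn0 := h.npos; have hs := h.s2pos
  have hη : 0 < η := lt_of_lt_of_le (by positivity) h1
  obtain ⟨z, hzdef⟩ : ∃ z : ℂ, z = ⟨x, η⟩ := ⟨_, rfl⟩
  rw [← hzdef]
  have hzi : z.im = η := by rw [hzdef]
  have hzr : z.re = x := by rw [hzdef]
  have hz : 0 < z.im := by rw [hzi]; exact hη
  have hz51 : ‖z‖ ≤ 51 := by
    have : ‖z‖^2 ≤ 51^2 := by
      rw [← Complex.normSq_eq_norm_sq, Complex.normSq_apply, hzi, hzr]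
      have := abs_le.1 hx
      nlinarith
    exact le_of_sq_le_sq this (by norm_num)
  obtain ⟨hse, hsi⟩ := stj_sc hz
  obtain ⟨s, hsdef⟩ : ∃ s : ℂ, s = stj semicircle z := ⟨_, rfl⟩
  rw [← hsdef] at hse hsi ⊢
  have hX := continuous_XM d a
  have hH := continuous_HM d a
  have cR := continuous_Rs (z := fun _ => z) hX continuous_const (XM_herm d a) (fun _ => hz.ne')
  have cm := continuous_mm (z := fun _ => z) hX continuous_const (XM_herm d a) (fun _ => hz.ne')
  have cD := continuous_DD (z := fun _ => z) hX continuous_const (XM_herm d a) (fun _ => hz.ne')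
  have hloop := h.res_loop hν hz.ne'
  have c1 : Continuous fun W => (HM d a W * Rs z (XM d a W)).trace := Continuous.matrix_trace (by fun_prop)
  have c2 : Continuous fun W => (XM d a W * Rs z (XM d a W) * XM d a W * ((Rs z (XM d a W))ᴴ * (Rs z (XM d a W))ᴴ)).trace := Continuous.matrix_trace (by fun_prop)
  have c3 : Continuous fun W => (Rs z (XM d a W) * ((Rs z (XM d a W))ᴴ * (Rs z (XM d a W))ᴴ)).trace := Continuous.matrix_trace (by fun_prop)
  have c4 : Continuous fun W => (HM d a W * (Rs z (XM d a W) * ((Rs z (XM d a W))ᴴ * (Rs z (XM d a W))ᴴ))).trace := Continuous.matrix_trace (by fun_prop)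
  set J : Matrix (Fin n) (Fin n) ℂ → ℂ := fun W => (conj (DD z (XM d a W)) * (1 + z * mm z (XM d a W)) - ((k:ℂ) / n) * (1 + z * mm z (XM d a W))^2 * conj (DD z (XM d a W))
      + (1 - 1/(n:ℂ)^2) * mm z (XM d a W) * (mm z (XM d a W) + (k:ℂ)⁻¹ * (HM d a W * Rs z (XM d a W)).trace) * conj (DD z (XM d a W))
      - (2 * conj (mm z (XM d a W)) + conj z) / (n * k) *
        ((k:ℂ)⁻¹ * (XM d a W * Rs z (XM d a W) * XM d a W * ((Rs z (XM d a W))ᴴ * (Rs z (XM d a W))ᴴ)).trace)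
      + (1 - 1/(n:ℂ)^2) / (k:ℂ)^2 * (2 * conj (mm z (XM d a W)) + conj z) *
        ((k:ℂ)⁻¹ * (Rs z (XM d a W) * ((Rs z (XM d a W))ᴴ * (Rs z (XM d a W))ᴴ)).trace
          + (k:ℂ)⁻¹ * (HM d a W * (Rs z (XM d a W) * ((Rs z (XM d a W))ᴴ * (Rs z (XM d a W))ᴴ))).trace)) with hJdef
  have cJ : Continuous J := by rw [hJdef]; fun_prop
  have hJ0 : ∫ W, (J W).re ∂ν = 0 := by
    have e1 : ∫ W, (J W).re ∂ν = (∫ W, J W ∂ν).re := integral_re (hν.integrable cJ)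
    rw [e1, hloop]; rfl
  obtain ⟨α, hαdef⟩ : ∃ α : ℝ, α = 1/(k*η) := ⟨_, rfl⟩
  have hα : 0 < α := by rw [hαdef]; positivity
  have hT := fun W => T_bounds (H := HM d a W) (by have := h.hk; omega) (XM_herm d a W) hz hz51
  rw [hzi] at hT
  have hP1 : ∀ W, 3/4 * ‖DD z (XM d a W)‖^2 ≤ (J W).re + 5/2 * α^2 * (3/2 * ‖2*s+z‖^2 + 3 * ‖mm z (XM d a W) - s‖^2)
      + 10^20 * (α^4 + (‖HM d a W‖^2/(k*η) + ‖HM d a W‖^8/(k*η)^4)) := by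
    intro W
    obtain ⟨t0, t1, t2, t3, t4⟩ := hT W
    have p := stab_pointwise (J := J W) hk hkn h1 h2 hz51 rfl (div_nonneg (norm_nonneg _) (Real.sqrt_nonneg _)) (Real.sqrt_nonneg _) (Real.sq_sqrt t0) rfl
      t1 t2 t3 t4
    obtain ⟨q1, q2, q3⟩ := stab_pt hse hsi t0 hz (by rw [hzr]; exact hx)
    rw [← hαdef] at p
    have e1 : (‖HM d a W‖ / Real.sqrt (k*η))^2 = ‖HM d a W‖^2/(k*η) := by
      rw [div_pow, Real.sq_sqrt (by positivity)]
    have e2 : (‖HM d a W‖ / Real.sqrt (k*η))^8 = ‖HM d a W‖^8/(k*η)^4 := by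
      have := Real.sq_sqrt (show 0 ≤ (k:ℝ)*η by positivity)
      rw [div_pow, show (8:ℕ) = 2 * 4 from rfl, pow_mul (Real.sqrt _), this]
    rw [e1, e2] at p
    have := mul_le_mul_of_nonneg_left q3 (show 0 ≤ 5/2*α^2 by positivity)
    change 3/4 * ‖(mm z (XM d a W))^2 + z * mm z (XM d a W) + 1‖^2 ≤ _
    linarith
  have iD : Integrable (fun W => ‖DD z (XM d a W)‖^2) ν := hν.integrable (by fun_prop)
  have iL : Integrable (fun W => ‖mm z (XM d a W) - s‖^2) ν := hν.integrable (by fun_prop)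
  have iL4 : Integrable (fun W => ‖mm z (XM d a W) - s‖^4) ν := hν.integrable (by fun_prop)
  have iJ : Integrable (fun W => (J W).re) ν := hν.integrable (by fun_prop)
  have iH2 : Integrable (fun W => ‖HM d a W‖^2) ν := hν.integrable (by fun_prop)
  have iH8 : Integrable (fun W => ‖HM d a W‖^8) ν := hν.integrable (by fun_prop)
  obtain ⟨A, hA⟩ : ∃ A, A = (∫ W, ‖HM d a W‖^2 ∂ν)/(k*η) + (∫ W, ‖HM d a W‖^8 ∂ν)/(k*η)^4 := ⟨_, rfl⟩
  have hA0 : 0 ≤ A := by rw [hA]; positivity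
  have h3 : 3/4 * ∫ W, ‖DD z (XM d a W)‖^2 ∂ν ≤ 5/2 * α^2 * (3/2 * ‖2*s+z‖^2 + 3 * ∫ W, ‖mm z (XM d a W) - s‖^2 ∂ν) + 10^20 * (α^4 + A) := by
    have := integral_mono (iD.const_mul (3/4)) ((iJ.add (((integrable_const (3/2 * ‖2*s+z‖^2)).add (iL.const_mul 3)).const_mul (5/2*α^2))).add
      (((integrable_const (α^4)).add ((iH2.div_const (k*η)).add (iH8.div_const ((k*η)^4)))).const_mul (10^20))) hP1
    rw [integral_const_mul] at this
    refine this.trans_eq ?_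
    rw [integral_add' (iJ.add (((integrable_const (3/2 * ‖2*s+z‖^2)).add (iL.const_mul 3)).const_mul (5/2*α^2))) 
      (((integrable_const (α^4)).add ((iH2.div_const (k*η)).add (iH8.div_const ((k*η)^4)))).const_mul (10^20)),
      integral_add' iJ (((integrable_const (3/2 * ‖2*s+z‖^2)).add (iL.const_mul 3)).const_mul (5/2*α^2)), hJ0, integral_const_mul, integral_const_mul,
      integral_add' (integrable_const (3/2 * ‖2*s+z‖^2)) (iL.const_mul 3), integral_add' (integrable_const (α^4)) ((iH2.div_const (k*η)).add (iH8.div_const ((k*η)^4))),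
      integral_add' (iH2.div_const (k*η)) (iH8.div_const ((k*η)^4)), integral_const_mul, integral_div, integral_div, integral_const, integral_const, hA]
    simp
    left; exact integral_const_mul _ _
  have f := stab_final (ED := ∫ W, ‖DD z (XM d a W)‖^2 ∂ν) (EL := ∫ W, ‖mm z (XM d a W) - s‖^2 ∂ν) (EL4 := ∫ W, ‖mm z (XM d a W) - s‖^4 ∂ν)
    (w2 := ‖2*s+z‖^2) hα (by norm_num) hA0 (by positivity) (by positivity) ?_ ?_ ?_ h3
  · refine f.trans ?_
    have hr := h.nr2
    have g := stab_end (k := k) (n := n) (r := ρ^2/s2 d) (C8 := 2^18 * 80640 * Real.exp 3) (by have := Real.add_one_le_exp (3:ℝ); nlinarith) hk hn0 h1 h2 (by positivity)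
      (by rw [mul_div_assoc', le_div_iff₀ hs]; linarith) hβ (h.HM_moment hν) (h.HM8 hν (by
        have : (9:ℝ) * k ≤ n := by
          have : (k:ℝ) ≤ (k:ℝ)^4 := le_self_pow₀ (by linarith) (by norm_num)
          linarith
        exact_mod_cast this))
    rw [← hαdef, ← hA] at g
    rw [Cstab]
    calc _ ≤ 10^8 * 10^20 * _ := mul_le_mul_of_nonneg_left g (by positivity)
      _ = _ := by ring
  · have : ∀ W, α^2 * ‖mm z (XM d a W) - s‖^2 ≤ 25*(α^2)^2 + ‖mm z (XM d a W) - s‖^4/100 := fun W => by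
      nlinarith [sq_nonneg (‖mm z (XM d a W) - s‖^2/10 - 5*α^2)]
    have := integral_mono (iL.const_mul (α^2)) ((integrable_const _).add (iL4.div_const 100)) this
    rw [integral_const_mul] at this
    refine this.trans_eq ?_
    rw [integral_add' (integrable_const _) (iL4.div_const 100), integral_div, integral_const]
    simp
  · rw [← integral_mul_const, ← integral_const_mul]
    refine integral_mono (iL.mul_const _) (iD.const_mul _) fun W => ?_
    exact (stab_pt hse hsi (hT W).1 hz (by rw [hzr]; exact hx)).1
  · have : ∀ W, ‖mm z (XM d a W) - s‖^4 ≤ 4 * ‖DD z (XM d a W)‖^2 + 16 * (‖2*s+z‖^2)^2 := fun W => by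
      have := (stab_pt hse hsi (hT W).1 hz (by rw [hzr]; exact hx)).2.1
      rw [← pow_mul]; exact this
    have := integral_mono iL4 ((iD.const_mul 4).add (integrable_const _)) this
    refine this.trans_eq ?_
    rw [integral_add' (iD.const_mul 4) (integrable_const _), integral_const_mul, integral_const]
    simp

end Res8

open MeasureTheory ProbabilityTheory Matrix
open scoped Matrix ENNReal
set_option linter.unusedSectionVars false

section Det
variable {μ : Measure ℝ}

lemma cont_mk (x : ℝ) : Continuous fun s : ℝ => (⟨x, s⟩ : ℂ) := by
  have : (fun s : ℝ => (⟨x, s⟩ : ℂ)) = fun s : ℝ => (x:ℂ) + (s:ℂ) * Complex.I := by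
    funext s; exact Complex.mk_eq_add_mul_I x s
  rw [this]; fun_prop

lemma cont_mk' (y : ℝ) : Continuous fun s : ℝ => (⟨s, y⟩ : ℂ) := by
  have : (fun s : ℝ => (⟨s, y⟩ : ℂ)) = fun s : ℝ => (s:ℂ) + (y:ℂ) * Complex.I := by
    funext s; exact Complex.mk_eq_add_mul_I s y
  rw [this]; fun_prop

lemma SD_contOn (hμ : NiceM μ) (x : ℝ) : ContinuousOn (fun s : ℝ => SD μ ⟨x, s⟩) (Set.Ioi 0) :=
  (harm_D hμ).diff.continuousOn.comp (cont_mk x).continuousOn (fun _ hs => hs)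

lemma uIcc_sub_Ioi {t Y : ℝ} (ht : 0 < t) (h : t ≤ Y) : Set.uIcc t Y ⊆ Set.Ioi 0 := by
  rw [Set.uIcc_of_le h]; intro s hs; exact ht.trans_le hs.1

/-- weighted square integral of the transform along a vertical line -/
noncomputable def Psi (μ : Measure ℝ) (x y : ℝ) (p : ℕ) : ℝ := ∫ s in y..50, s^p * ‖SD μ ⟨x, s⟩‖^2

lemma psi_ii (hμ : NiceM μ) (x : ℝ) (p : ℕ) {t : ℝ} (ht : 0 < t) (h : t ≤ 50) :
    IntervalIntegrable (fun s => s^p * ‖SD μ ⟨x, s⟩‖^2) volume t 50 := by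
  refine ContinuousOn.intervalIntegrable ?_
  have := (SD_contOn hμ x).mono (uIcc_sub_Ioi ht h)
  exact (continuousOn_id.pow p).mul (this.norm.pow 2)

lemma vD_line (hμ : NiceM μ) (x : ℝ) {t : ℝ} (ht : 0 < t) (h : t ≤ 50) :
    |vD μ x t| ≤ W1m μ semicircle / 50 + ∫ s in t..50, ‖SD μ ⟨x, s⟩‖ := by
  have c := (SD_contOn hμ x).mono (uIcc_sub_Ioi ht h)
  have e := intervalIntegral.integral_eq_sub_of_hasDerivAt (f := fun s => vD μ x s) (f' := fun s => (SD μ ⟨x, s⟩).re) (a := t) (b := 50)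
    (fun s hs => (harm_D hμ).dy x s (uIcc_sub_Ioi ht h hs)) (by
      refine ContinuousOn.intervalIntegrable ?_
      exact Complex.continuous_re.comp_continuousOn c)
  have h1 : |∫ s in t..50, (SD μ ⟨x, s⟩).re| ≤ ∫ s in t..50, ‖SD μ ⟨x, s⟩‖ := by
    refine (intervalIntegral.abs_integral_le_integral_abs h).trans ?_
    refine intervalIntegral.integral_mono_on h ?_ c.norm.intervalIntegrable fun s _ => Complex.abs_re_le_norm _
    exact (Complex.continuous_re.comp_continuousOn c).abs.intervalIntegrable
  have h2 := vD_le hμ x (y := 50) (by norm_num)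
  rw [e] at h1
  have := abs_sub_abs_le_abs_sub (vD μ x t) (vD μ x 50)
  rw [abs_sub_comm] at this
  have e3 : (50:ℝ)⁻¹ * W1m μ semicircle = W1m μ semicircle / 50 := by ring
  linarith

lemma line_pt (hμ : NiceM μ) (x : ℝ) {y t : ℝ} (hy : 0 < y) (hyt : y ≤ t) (h : t ≤ 50) :
    t * |vD μ x t * (SD μ ⟨x, t⟩).im| ≤ W1m μ semicircle ^ 2 / 50000 + (5 + Real.log (50/y) / 2) * (t^2 * ‖SD μ ⟨x, t⟩‖^2) + Psi μ x y 1 / 2 := by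
  have ht := hy.trans_le hyt
  have hv := vD_line hμ x ht h
  have hw := W1m_nonneg (μ := μ)
  set w := W1m μ semicircle
  set g := ‖SD μ ⟨x, t⟩‖ with hg
  have hg0 : 0 ≤ g := norm_nonneg _
  have hgi : |(SD μ ⟨x, t⟩).im| ≤ g := Complex.abs_im_le_norm _
  have c := (SD_contOn hμ x).mono (uIcc_sub_Ioi ht h)
  have i1 : IntervalIntegrable (fun s : ℝ => (t * g)^2/2 * s⁻¹) volume t 50 := by
    refine ContinuousOn.intervalIntegrable ?_
    refine continuousOn_const.mul (ContinuousOn.inv₀ continuousOn_id fun s hs => (uIcc_sub_Ioi ht h hs).ne')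
  have i2 := psi_ii hμ x 1 ht h
  have key : t * g * (∫ s in t..50, ‖SD μ ⟨x, s⟩‖) ≤ (t*g)^2/2 * Real.log (50/t) + (∫ s in t..50, s^1 * ‖SD μ ⟨x, s⟩‖^2) / 2 := by
    rw [← intervalIntegral.integral_const_mul, ← integral_inv_of_pos ht (by norm_num), ← intervalIntegral.integral_const_mul,
      ← intervalIntegral.integral_div, ← intervalIntegral.integral_add i1 (i2.div_const 2)]
    refine intervalIntegral.integral_mono_on h (c.norm.intervalIntegrable.const_mul _) (i1.add (i2.div_const 2)) fun s hs => ?_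
    have hs0 : 0 < s := ht.trans_le hs.1
    have h3 : 0 ≤ s * (t * g / s - ‖SD μ ⟨x, s⟩‖)^2 := by positivity
    have e : s * (t * g / s - ‖SD μ ⟨x, s⟩‖)^2 = (t*g)^2 * s⁻¹ - 2 * (t * g * ‖SD μ ⟨x, s⟩‖) + s^1 * ‖SD μ ⟨x, s⟩‖^2 := by
      field_simp
      ring
    linarith
  have hmono : (∫ s in t..50, s^1 * ‖SD μ ⟨x, s⟩‖^2) ≤ Psi μ x y 1 := by
    rw [Psi]
    refine intervalIntegral.integral_mono_interval hyt h le_rfl ?_ (psi_ii hμ x 1 hy (hyt.trans h))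
    filter_upwards [ae_restrict_mem measurableSet_Ioc] with s hs
    have : 0 < s := hy.trans hs.1
    positivity
  have hlog : Real.log (50/t) ≤ Real.log (50/y) := by
    apply Real.log_le_log (by positivity)
    gcongr
  have e1 : t * |vD μ x t * (SD μ ⟨x, t⟩).im| ≤ t * g * (w / 50 + ∫ s in t..50, ‖SD μ ⟨x, s⟩‖) := by
    rw [abs_mul]
    calc _ ≤ t * ((w / 50 + ∫ s in t..50, ‖SD μ ⟨x, s⟩‖) * g) := by
            have := (abs_nonneg _).trans hv
            gcongr
      _ = _ := by ring
  have e2 : (t*g)^2/2 * Real.log (50/t) ≤ (t*g)^2/2 * Real.log (50/y) := by gcongr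
  nlinarith [sq_nonneg (w/100 - 5 * (t*g))]

/-- remainder -/
noncomputable def Rm (μ : Measure ℝ) (y : ℝ) : ℝ :=
  2 * (∫ t in y..50, t * ∫ x in (-2:ℝ)..2, ‖SD μ ⟨x, t⟩‖ ^ 2) +
    (2 * ((5 + Real.log (50/y) / 2) * Psi μ 2 y 2 + 25 * Psi μ 2 y 1) + 2 * ((5 + Real.log (50/y) / 2) * Psi μ (-2) y 2 + 25 * Psi μ (-2) y 1))

lemma psi_nonneg (x : ℝ) {y : ℝ} (hy : 0 < y) (h : y ≤ 50) (p : ℕ) : 0 ≤ Psi μ x y p := by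
  rw [Psi]
  refine intervalIntegral.integral_nonneg h fun s hs => ?_
  have : 0 < s := hy.trans_le hs.1
  positivity

lemma Rm_nonneg {y : ℝ} (hy : 0 < y) (h : y ≤ 50) : 0 ≤ Rm μ y := by
  have h1 : 0 ≤ Real.log (50/y) := Real.log_nonneg (by rw [le_div_iff₀ hy]; linarith)
  have p := fun x p => psi_nonneg (μ := μ) x hy h p
  have h2 : 0 ≤ ∫ t in y..50, t * ∫ x in (-2:ℝ)..2, ‖SD μ ⟨x, t⟩‖ ^ 2 := by
    refine intervalIntegral.integral_nonneg h fun s hs => ?_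
    have : 0 < s := hy.trans_le hs.1
    refine mul_nonneg this.le (intervalIntegral.integral_nonneg (by norm_num) fun x _ => by positivity)
  have := p 2 1; have := p 2 2; have := p (-2) 1; have := p (-2) 2
  rw [Rm]; positivity

lemma I_bound (hμ : NiceM μ) {y : ℝ} (hy : 0 < y) (h : y ≤ 50) :
    ∫ x in (-2:ℝ)..2, vD μ x y ^ 2 ≤ 11/1250 * W1m μ semicircle ^ 2 + Rm μ y := by
  have hw := W1m_nonneg (μ := μ)
  have hH := harm_D hμ
  have key := hH.ineq hy h
  set w := W1m μ semicircle with hwdef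
  have b1 : ∀ x, |vD μ x 50| ≤ w / 50 := fun x => by
    have := vD_le hμ x (y := 50) (by norm_num)
    rw [← hwdef] at this; linarith
  have b2 : ∀ x, |(SD μ ⟨x, 50⟩).re| ≤ w / 2500 := fun x => by
    have := SD_re_le hμ x (y := 50) (by norm_num)
    rw [← hwdef] at this; norm_num at this; linarith
  have cv : Continuous fun x => vD μ x 50 := continuous_iff_continuousAt.2 fun x => (hH.dx x 50 (by norm_num)).continuousAt
  have cS : Continuous fun x : ℝ => SD μ ⟨x, 50⟩ := by
    have := hH.diff.continuousOn.comp (cont_mk' 50).continuousOn (s := Set.univ) (fun _ _ => by simp)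
    exact continuousOn_univ.1 this
  have t1 : ∫ x in (-2:ℝ)..2, vD μ x 50 ^ 2 ≤ 4 * (w/50)^2 := by
    calc _ ≤ ∫ x in (-2:ℝ)..2, (w/50)^2 := by
          refine intervalIntegral.integral_mono_on (by norm_num) ((cv.pow 2).intervalIntegrable _ _) (by simp) fun x _ => ?_
          exact sq_le_sq' (by linarith [(abs_le.1 (b1 x)).1]) (abs_le.1 (b1 x)).2
      _ = _ := by rw [intervalIntegral.integral_const, smul_eq_mul]; ring
  have t2 : ∫ x in (-2:ℝ)..2, |vD μ x 50 * (SD μ ⟨x, 50⟩).re| ≤ 4 * (w/50 * (w/2500)) := by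
    calc _ ≤ ∫ x in (-2:ℝ)..2, (w/50 * (w/2500)) := by
          refine intervalIntegral.integral_mono_on (by norm_num) ?_ (by simp) fun x _ => ?_
          · exact (cv.mul (Complex.continuous_re.comp cS)).abs.intervalIntegrable _ _
          · rw [abs_mul]; exact mul_le_mul (b1 x) (b2 x) (abs_nonneg _) (by positivity)
      _ = _ := by rw [intervalIntegral.integral_const, smul_eq_mul]; ring
  have cvt : ∀ x, ContinuousOn (fun t => vD μ x t) (Set.uIcc y 50) := fun x t ht =>
    (hH.dy x t (uIcc_sub_Ioi hy h ht)).continuousAt.continuousWithinAt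
  have cSt : ∀ x, ContinuousOn (fun t => (SD μ ⟨x, t⟩).im) (Set.uIcc y 50) := fun x =>
    Complex.continuous_im.comp_continuousOn ((SD_contOn hμ x).mono (uIcc_sub_Ioi hy h))
  have ib : ∀ x, IntervalIntegrable (fun t => t * |vD μ x t * (SD μ ⟨x, t⟩).im|) volume y 50 := fun x =>
    (continuousOn_id.mul ((cvt x).mul (cSt x)).abs).intervalIntegrable
  have bb : ∀ x, ∫ t in y..50, t * |vD μ x t * (SD μ ⟨x, t⟩).im| ≤ w^2/1000 + ((5 + Real.log (50/y) / 2) * Psi μ x y 2 + 25 * Psi μ x y 1) := by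
    intro x
    have hp := psi_nonneg (μ := μ) x hy h 1
    have i2 := psi_ii hμ x 2 hy h
    have ic : IntervalIntegrable (fun _ : ℝ => w^2/50000 + Psi μ x y 1 / 2) volume y 50 := by simp
    calc _ ≤ ∫ t in y..50, ((w^2/50000 + Psi μ x y 1 / 2) + (5 + Real.log (50/y) / 2) * (t^2 * ‖SD μ ⟨x, t⟩‖^2)) := by
          refine intervalIntegral.integral_mono_on h (ib x) (ic.add (i2.const_mul _)) fun t ht => ?_
          have := line_pt hμ x hy ht.1 ht.2
          linarith
      _ = (50 - y) * (w^2/50000 + Psi μ x y 1 / 2) + (5 + Real.log (50/y) / 2) * Psi μ x y 2 := by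
          rw [intervalIntegral.integral_add ic (i2.const_mul _), intervalIntegral.integral_const, intervalIntegral.integral_const_mul, smul_eq_mul, Psi, Psi]
      _ ≤ 50 * (w^2/50000 + Psi μ x y 1 / 2) + (5 + Real.log (50/y) / 2) * Psi μ x y 2 := by
          gcongr; linarith
      _ = _ := by ring
  have t4 : ∫ t in y..50, t * (|vD μ 2 t * (SD μ ⟨2, t⟩).im| + |vD μ (-2) t * (SD μ ⟨-2, t⟩).im|) =
      (∫ t in y..50, t * |vD μ 2 t * (SD μ ⟨2, t⟩).im|) + ∫ t in y..50, t * |vD μ (-2) t * (SD μ ⟨-2, t⟩).im| := by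
    rw [← intervalIntegral.integral_add (ib 2) (ib (-2))]
    simp only [mul_add]
  rw [t4] at key
  have := bb 2
  have := bb (-2)
  rw [Rm]
  nlinarith

lemma int_abs_sq {f : ℝ → ℝ} (hf : Continuous f) : (∫ x in (-2:ℝ)..2, |f x|)^2 ≤ 4 * ∫ x in (-2:ℝ)..2, f x ^ 2 := by
  obtain ⟨c, hc⟩ : ∃ c, c = (∫ x in (-2:ℝ)..2, |f x|) := ⟨_, rfl⟩
  have h1 : IntervalIntegrable (fun x => |f x|) volume (-2) 2 := hf.abs.intervalIntegrable _ _
  have h2 : IntervalIntegrable (fun x => f x ^ 2) volume (-2) 2 := (hf.pow 2).intervalIntegrable _ _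
  have : (∫ x in (-2:ℝ)..2, ((c/2) * |f x| - c^2/16)) ≤ ∫ x in (-2:ℝ)..2, f x ^ 2 := by
    refine intervalIntegral.integral_mono_on (by norm_num) ((h1.const_mul _).sub (by simp)) h2 fun x _ => ?_
    rw [← sq_abs (f x)]
    nlinarith [sq_nonneg (|f x| - c/4)]
  rw [intervalIntegral.integral_sub (h1.const_mul _) (by simp), intervalIntegral.integral_const_mul, intervalIntegral.integral_const, ← hc, smul_eq_mul] at this
  rw [← hc]; nlinarith

lemma W1_det (hμ : NiceM μ) {y : ℝ} (hy : 0 < y) (h : 2 * y ≤ 50) :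
    W1m μ semicircle ^ 2 ≤ 54 * Rm μ y + 14 * Rm μ (2*y) + 18432 * y^2 + ((∫ x, x^2 ∂μ) - 1)^2/2 := by
  have hw := W1m_nonneg (μ := μ)
  have hH := harm_D hμ
  have h2y : 0 < 2 * y := by linarith
  have key := W1_reduce hμ hy
  have cv : ∀ {y}, 0 < y → Continuous fun x => vD μ x y := fun {y} hy => continuous_iff_continuousAt.2 fun x => (hH.dx x y hy).continuousAt
  have a1 := int_abs_sq (cv hy)
  have a2 := int_abs_sq (cv h2y)
  have i1 := I_bound hμ hy (by linarith)
  have i2 := I_bound hμ h2y h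
  have p1 : 0 ≤ ∫ x in (-2:ℝ)..2, |vD μ x y| := intervalIntegral.integral_nonneg (by norm_num) fun _ _ => abs_nonneg _
  have p2 : 0 ≤ ∫ x in (-2:ℝ)..2, |vD μ x (2*y)| := intervalIntegral.integral_nonneg (by norm_num) fun _ _ => abs_nonneg _
  generalize (∫ x in (-2:ℝ)..2, |vD μ x y|) = A at *
  generalize (∫ x in (-2:ℝ)..2, |vD μ x (2*y)|) = B at *
  generalize (∫ x in (-2:ℝ)..2, vD μ x y^2) = I1 at *
  generalize (∫ x in (-2:ℝ)..2, vD μ x (2*y)^2) = I2 at *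
  rw [← sq_abs ((∫ x, x^2 ∂μ) - 1)]
  have p3 := abs_nonneg ((∫ x, x^2 ∂μ) - 1)
  generalize |(∫ x, x^2 ∂μ) - 1| = ξ at *
  have hπ := Real.pi_gt_d2
  have q1 : 2/Real.pi ≤ 0.637 := by rw [div_le_iff₀ Real.pi_pos]; linarith
  have q2 : 1/Real.pi ≤ 0.3185 := by rw [div_le_iff₀ Real.pi_pos]; linarith
  have key2 : W1m μ semicircle ≤ 1.274 * A + 0.637 * B + 48 * y + ξ/4 := by
    have := mul_le_mul_of_nonneg_right q1 p1
    have := mul_le_mul_of_nonneg_right q2 p2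
    linarith
  have key3 : W1m μ semicircle^2 ≤ 4 * ((1.274 * A)^2 + (0.637*B)^2 + (48*y)^2 + (ξ/4)^2) := by
    refine (pow_le_pow_left₀ hw key2 2).trans ?_
    nlinarith [sq_nonneg (1.274 * A - 0.637 * B), sq_nonneg (1.274 * A - 48*y), sq_nonneg (1.274 * A - ξ/4), sq_nonneg (0.637 * B - 48*y), sq_nonneg (0.637 * B - ξ/4),
      sq_nonneg (48*y - ξ/4)]
  have r1 := Rm_nonneg (μ := μ) hy (by linarith)
  have r2 := Rm_nonneg (μ := μ) h2y h
  nlinarith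

end Det

open MeasureTheory ProbabilityTheory Matrix
open scoped Matrix ENNReal
set_option linter.unusedSectionVars false

section Exp1
open scoped Matrix.Norms.Frobenius NNReal

lemma esd_nice {k : ℕ} (hk : 0 < k) {X : Matrix (Fin k) (Fin k) ℂ} (hX : X.IsHermitian) : NiceM (esd X) := by
  have hk' : (k : ℝ≥0∞) ≠ 0 := by exact_mod_cast hk.ne'
  refine ⟨⟨?_⟩, fun {f} hf => ?_⟩
  · rw [esd, dif_pos hX]
    simp [ENNReal.inv_mul_cancel hk' (ENNReal.natCast_ne_top k)]
  · rw [esd, dif_pos hX]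
    refine Integrable.smul_measure ?_ (by simp [hk'])
    rw [integrable_finsetSum_measure]
    intro i _
    exact integrable_dirac (by simp)

lemma esd_sq {k : ℕ} {X : Matrix (Fin k) (Fin k) ℂ} (hX : X.IsHermitian) : ∫ x, x^2 ∂(esd X) = ‖X‖^2 / k := by
  rw [integral_esd hX]
  have hUm : (hX.eigenvectorUnitary : Matrix (Fin k) (Fin k) ℂ) ∈ unitaryGroup (Fin k) ℂ := hX.eigenvectorUnitary.2
  set U : Matrix (Fin k) (Fin k) ℂ := (hX.eigenvectorUnitary : Matrix (Fin k) (Fin k) ℂ) with hU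
  have hXs : X = U * diagonal (fun i => (hX.eigenvalues i : ℂ)) * star U := by
    have := hX.spectral_theorem
    rw [Unitary.conjStarAlgAut_apply] at this
    exact this
  have e : ‖X‖ = ‖diagonal (fun i => (hX.eigenvalues i : ℂ))‖ := by
    conv_lhs => rw [hXs]
    rw [Matrix.mul_assoc, frob_unitary_mul hUm, ← Matrix.frobenius_norm_conjTranspose, Matrix.conjTranspose_mul, star_eq_conjTranspose,
      Matrix.conjTranspose_conjTranspose, frob_unitary_mul hUm, Matrix.frobenius_norm_conjTranspose]
  have e2 := dM_norm (fun i => hX.eigenvalues i)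
  rw [dM, ← e, s2] at e2
  rw [e2]; field_simp

lemma W1_lip {k : ℕ} (hk : 0 < k) {X Y : Matrix (Fin k) (Fin k) ℂ} (hX : X.IsHermitian) (hY : Y.IsHermitian) :
    W1m (esd X) semicircle ≤ W1m (esd Y) semicircle + ‖X - Y‖ / Real.sqrt k := by
  refine W1m_le fun f hf => ?_
  have h1 := le_W1m (esd_nice hk hY) hf
  have hk' : (0:ℝ) < k := by exact_mod_cast hk
  have h2 : |(∫ x, f x ∂(esd X)) - ∫ x, f x ∂(esd Y)| ≤ ‖X - Y‖ / Real.sqrt k := by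
    rw [integral_esd hX, integral_esd hY, ← mul_sub, abs_mul, abs_of_pos (by positivity)]
    have := hoffman_wielandt hX hY (f := f) (fun s t => by simpa [Real.dist_eq] using hf.dist_le_mul s t)
    rw [Fintype.card_fin] at this
    have hs := Real.sqrt_pos.2 hk'
    calc _ ≤ (k:ℝ)⁻¹ * (Real.sqrt k * ‖X - Y‖) := by gcongr
      _ = _ := by
        have := Real.mul_self_sqrt hk'.le
        rw [inv_mul_eq_div, div_eq_div_iff (by positivity) (by positivity)]
        calc _ = (Real.sqrt k * Real.sqrt k) * ‖X - Y‖ := by ring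
          _ = _ := by rw [this]; ring
  have := abs_add_le ((∫ x, f x ∂(esd X)) - ∫ x, f x ∂(esd Y)) ((∫ x, f x ∂(esd Y)) - ∫ x, f x ∂semicircle)
  rw [sub_add_sub_cancel] at this
  linarith

lemma W1_lip_abs {k : ℕ} (hk : 0 < k) {X Y : Matrix (Fin k) (Fin k) ℂ} (hX : X.IsHermitian) (hY : Y.IsHermitian) :
    |W1m (esd X) semicircle - W1m (esd Y) semicircle| ≤ ‖X - Y‖ / Real.sqrt k := by
  have h1 := W1_lip hk hX hY
  have h2 := W1_lip hk hY hX
  rw [norm_sub_rev] at h2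
  rw [abs_le]; constructor <;> linarith

lemma W1_le_norm {k : ℕ} (hk : 0 < k) {X : Matrix (Fin k) (Fin k) ℂ} (hX : X.IsHermitian) :
    W1m (esd X) semicircle ≤ 1 + ‖X‖ / Real.sqrt k := by
  have h0 : (0 : Matrix (Fin k) (Fin k) ℂ).IsHermitian := Matrix.isHermitian_zero
  have h1 := W1_lip hk hX h0
  rw [sub_zero] at h1
  have hk' : (0:ℝ) < k := by exact_mod_cast hk
  have h2 : W1m (esd (0 : Matrix (Fin k) (Fin k) ℂ)) semicircle ≤ 1 := by
    refine W1m_le fun f hf => ?_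
    have e : ∫ x, f x ∂(esd (0 : Matrix (Fin k) (Fin k) ℂ)) = f 0 := by
      rw [integral_esd h0]
      have : ∀ i, h0.eigenvalues i = 0 := by
        have := (h0.eigenvalues_eq_zero_iff).2 rfl
        intro i; rw [this]; rfl
      simp [this]
      field_simp
    rw [e]
    have e2 : f 0 - ∫ x, f x ∂semicircle = ∫ x, (f 0 - f x) ∂semicircle := by
      rw [integral_sub (integrable_const _) (sc_integrable hf.continuous)]; simp
    rw [e2]
    have hc := hf.continuous
    calc _ ≤ ∫ x, |f 0 - f x| ∂semicircle := abs_integral_le_integral_abs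
      _ ≤ ∫ x, (1/2 + (1/2) * x^2) ∂semicircle := by
        refine integral_mono (sc_integrable (by fun_prop)) (sc_integrable (by fun_prop)) fun x => ?_
        have := hf.dist_le_mul 0 x
        simp [Real.dist_eq] at this
        have h3 : |x|^2 = x^2 := sq_abs x
        change |f 0 - f x| ≤ 1/2 + (1/2) * x^2
        nlinarith [sq_nonneg (|x| - 1)]
      _ = 1 := by
        rw [integral_add (integrable_const _) (sc_integrable (by fun_prop)), integral_const_mul, sc_sq]; simp; norm_num
  linarith

variable {N : Type} [Fintype N] [DecidableEq N]

lemma IsHaarU.integrable_prod_ab {ν : Measure (Matrix N N ℂ)} (hν : IsHaarU ν)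
    {f : ℝ × Matrix N N ℂ → ℝ} (hf : Continuous f) (a b : ℝ) :
    Integrable f ((volume.restrict (Set.Ioc a b)).prod ν) := by
  have := hν.prob
  have hK : IsCompact (Set.Icc a b ×ˢ (Matrix.unitaryGroup N ℂ : Set (Matrix N N ℂ))) :=
    isCompact_Icc.prod isCompact_unitaryGroup
  obtain ⟨M, hM⟩ := hK.exists_bound_of_continuousOn hf.continuousOn
  refine Integrable.of_bound hf.aestronglyMeasurable M ?_
  have h1 : ∀ᵐ p ∂((volume.restrict (Set.Ioc a b)).prod ν), p.1 ∈ Set.Ioc a b :=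
    Measure.quasiMeasurePreserving_fst.ae (ae_restrict_mem measurableSet_Ioc)
  have h2 : ∀ᵐ p ∂((volume.restrict (Set.Ioc a b)).prod ν), p.2 ∈ Matrix.unitaryGroup N ℂ :=
    Measure.quasiMeasurePreserving_snd.ae hν.unit
  filter_upwards [h1, h2] with p hp1 hp2
  exact hM p ⟨⟨hp1.1.le, hp1.2⟩, hp2⟩

lemma IsHaarU.E_int_le {ν : Measure (Matrix N N ℂ)} (hν : IsHaarU ν)
    {f : ℝ × Matrix N N ℂ → ℝ} (hf : Continuous f) {a b : ℝ} (hab : a ≤ b) {c : ℝ → ℝ} (hc : IntervalIntegrable c volume a b)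
    (h : ∀ t ∈ Set.Icc a b, ∫ W, f (t, W) ∂ν ≤ c t) :
    ∫ W, (∫ t in a..b, f (t, W)) ∂ν ≤ ∫ t in a..b, c t := by
  have := hν.prob
  simp only [intervalIntegral.integral_of_le hab]
  have hi := hν.integrable_prod_ab hf a b
  rw [← integral_integral_swap (f := fun t W => f (t, W)) hi]
  refine setIntegral_mono_on ?_ ((intervalIntegrable_iff_integrableOn_Ioc_of_le hab).1 hc) measurableSet_Ioc fun t ht => h t ⟨ht.1.le, ht.2⟩
  exact hi.integral_prod_left

end Exp1

open MeasureTheory ProbabilityTheory Matrix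
open scoped Matrix ENNReal
set_option linter.unusedSectionVars false

section Exp2
open scoped Matrix.Norms.Frobenius NNReal
variable {n k : ℕ} {d : Fin n → ℝ} {a : Fin k → Fin n} {ρ : ℝ}

/-- the Wasserstein distance as a function of the unitary -/
noncomputable def wM (d : Fin n → ℝ) (a : Fin k → Fin n) (W : Matrix (Fin n) (Fin n) ℂ) : ℝ := W1m (esd (XM d a W)) semicircle

lemma wM_nonneg (W) : 0 ≤ wM d a W := W1m_nonneg

lemma continuous_wM (hk : 0 < k) : Continuous (wM d a) := by
  have hk' : (0:ℝ) < k := by exact_mod_cast hk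
  rw [continuous_iff_continuousAt]
  intro W
  have hX := continuous_XM d a
  rw [ContinuousAt, tendsto_iff_dist_tendsto_zero]
  have h0 : Filter.Tendsto (fun W' => ‖XM d a W' - XM d a W‖ / Real.sqrt k) (nhds W) (nhds 0) := by
    have c : Continuous (fun W' => ‖XM d a W' - XM d a W‖ / Real.sqrt k) := by fun_prop
    have := c.tendsto W
    simpa using this
  refine squeeze_zero (fun _ => dist_nonneg) (fun W' => ?_) h0
  rw [Real.dist_eq]
  exact W1_lip_abs hk (XM_herm d a W') (XM_herm d a W)

/-- clamped transform difference -/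
noncomputable def Sc (d : Fin n → ℝ) (a : Fin k → Fin n) (b : ℝ) (W : Matrix (Fin n) (Fin n) ℂ) (x t : ℝ) : ℂ :=
  mm ⟨x, max t b⟩ (XM d a W) - stj semicircle ⟨x, max t b⟩

lemma Sc_eq {b t : ℝ} (hb : 0 < b) (ht : b ≤ t) (W : Matrix (Fin n) (Fin n) ℂ) (x : ℝ) :
    SD (esd (XM d a W)) ⟨x, t⟩ = Sc d a b W x t := by
  rw [SD, Sc, max_eq_left ht, stj_esd (XM_herm d a W) (z := ⟨x,t⟩) (hb.trans_le ht).ne', mm]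

lemma continuous_Sc {b : ℝ} (hb : 0 < b) {α : Type} [TopologicalSpace α] {W : α → Matrix (Fin n) (Fin n) ℂ} {x t : α → ℝ}
    (hW : Continuous W) (hx : Continuous x) (ht : Continuous t) : Continuous fun p => Sc d a b (W p) (x p) (t p) := by
  have hz : Continuous fun p => (⟨x p, max (t p) b⟩ : ℂ) := by
    have : (fun p => (⟨x p, max (t p) b⟩ : ℂ)) = fun p => (x p : ℂ) + ((max (t p) b : ℝ) : ℂ) * Complex.I := by
      funext p; exact Complex.mk_eq_add_mul_I _ _
    rw [this]; fun_prop
  have hp : ∀ p, 0 < (⟨x p, max (t p) b⟩ : ℂ).im := fun p => lt_max_of_lt_right hb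
  unfold Sc
  refine Continuous.sub ?_ ?_
  · exact continuous_mm ((continuous_XM d a).comp hW) hz (fun p => XM_herm d a (W p)) (fun p => (hp p).ne')
  · rw [continuous_iff_continuousAt]
    intro p
    exact ContinuousAt.comp (f := fun p => (⟨x p, max (t p) b⟩ : ℂ)) (g := stj semicircle) (hasDerivAt_stj (hp p)).continuousAt hz.continuousAt

/-- clamped version of `Psi` -/
lemma Psi_eq {y : ℝ} (hy : 0 < y) (hy5 : y ≤ 50) (W : Matrix (Fin n) (Fin n) ℂ) (x : ℝ) (p : ℕ) :
    Psi (esd (XM d a W)) x y p = ∫ s in y..50, s^p * ‖Sc d a y W x s‖^2 := by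
  rw [Psi]
  refine intervalIntegral.integral_congr fun s hs => ?_
  rw [Set.uIcc_of_le hy5] at hs
  simp only [Sc_eq hy hs.1]

lemma Phi_eq {y : ℝ} (hy : 0 < y) (hy5 : y ≤ 50) (W : Matrix (Fin n) (Fin n) ℂ) :
    (∫ t in y..50, t * ∫ x in (-2:ℝ)..2, ‖SD (esd (XM d a W)) ⟨x, t⟩‖ ^ 2) = ∫ t in y..50, t * ∫ x in (-2:ℝ)..2, ‖Sc d a y W x t‖ ^ 2 := by
  refine intervalIntegral.integral_congr fun s hs => ?_
  rw [Set.uIcc_of_le hy5] at hs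
  simp only [Sc_eq hy hs.1]

lemma cont_Psi {y : ℝ} (hy : 0 < y) (x : ℝ) (p : ℕ) : Continuous fun W : Matrix (Fin n) (Fin n) ℂ => ∫ s in y..50, s^p * ‖Sc d a y W x s‖^2 := by
  refine intervalIntegral.continuous_parametric_intervalIntegral_of_continuous' (f := fun W s => s^p * ‖Sc d a y W x s‖^2) ?_ _ _
  have := continuous_Sc (d := d) (a := a) hy (continuous_fst : Continuous fun q : Matrix (Fin n) (Fin n) ℂ × ℝ => q.1) (continuous_const (y := x)) continuous_snd
  unfold Function.uncurry
  fun_prop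

lemma cont_inner {y : ℝ} (hy : 0 < y) : Continuous fun q : ℝ × Matrix (Fin n) (Fin n) ℂ => q.1 * ∫ x in (-2:ℝ)..2, ‖Sc d a y q.2 x q.1‖^2 := by
  refine continuous_fst.mul ?_
  refine intervalIntegral.continuous_parametric_intervalIntegral_of_continuous' (f := fun (q : ℝ × Matrix (Fin n) (Fin n) ℂ) x => ‖Sc d a y q.2 x q.1‖^2) ?_ _ _
  have := continuous_Sc (d := d) (a := a) hy (W := fun q : (ℝ × Matrix (Fin n) (Fin n) ℂ) × ℝ => q.1.2) (x := fun q => q.2) (t := fun q => q.1.1)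
    (by fun_prop) (by fun_prop) (by fun_prop)
  unfold Function.uncurry
  fun_prop

lemma cont_Phi {y : ℝ} (hy : 0 < y) : Continuous fun W : Matrix (Fin n) (Fin n) ℂ => ∫ t in y..50, t * ∫ x in (-2:ℝ)..2, ‖Sc d a y W x t‖ ^ 2 := by
  refine intervalIntegral.continuous_parametric_intervalIntegral_of_continuous' (f := fun (W : Matrix (Fin n) (Fin n) ℂ) t => t * ∫ x in (-2:ℝ)..2, ‖Sc d a y W x t‖ ^ 2) ?_ _ _
  have := (cont_inner (d := d) (a := a) hy).comp (continuous_swap : Continuous (Prod.swap : Matrix (Fin n) (Fin n) ℂ × ℝ → _))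
  exact this

lemma Rm_eq {y : ℝ} (hy : 0 < y) (hy5 : y ≤ 50) (W : Matrix (Fin n) (Fin n) ℂ) : Rm (esd (XM d a W)) y =
    2 * (∫ t in y..50, t * ∫ x in (-2:ℝ)..2, ‖Sc d a y W x t‖ ^ 2) +
    (2 * ((5 + Real.log (50/y) / 2) * (∫ s in y..50, s^2 * ‖Sc d a y W 2 s‖^2) + 25 * (∫ s in y..50, s^1 * ‖Sc d a y W 2 s‖^2)) +
     2 * ((5 + Real.log (50/y) / 2) * (∫ s in y..50, s^2 * ‖Sc d a y W (-2) s‖^2) + 25 * (∫ s in y..50, s^1 * ‖Sc d a y W (-2) s‖^2))) := by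
  rw [Rm, Phi_eq hy hy5, Psi_eq hy hy5, Psi_eq hy hy5, Psi_eq hy hy5, Psi_eq hy hy5]

lemma cont_Rm {y : ℝ} (hy : 0 < y) (hy5 : y ≤ 50) : Continuous fun W : Matrix (Fin n) (Fin n) ℂ => Rm (esd (XM d a W)) y := by
  simp only [Rm_eq hy hy5]
  have := cont_Phi (d := d) (a := a) hy
  have := fun x p => cont_Psi (d := d) (a := a) hy x p
  fun_prop

lemma int_five {α : Type*} [MeasurableSpace α] {μ : Measure α} {f0 f1 f2 f3 f4 : α → ℝ} {c e : ℝ}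
    (h0 : Integrable f0 μ) (h1 : Integrable f1 μ) (h2 : Integrable f2 μ) (h3 : Integrable f3 μ) (h4 : Integrable f4 μ) :
    ∫ w, (2 * f0 w + (2 * (c * f1 w + e * f2 w) + 2 * (c * f3 w + e * f4 w))) ∂μ =
      2 * (∫ w, f0 w ∂μ) + (2 * (c * (∫ w, f1 w ∂μ) + e * ∫ w, f2 w ∂μ) + 2 * (c * (∫ w, f3 w ∂μ) + e * ∫ w, f4 w ∂μ)) := by
  have p0 : Integrable (fun w => 2 * f0 w) μ := h0.const_mul _
  have p1 : Integrable (fun w => c * f1 w) μ := h1.const_mul _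
  have p2 : Integrable (fun w => e * f2 w) μ := h2.const_mul _
  have p3 : Integrable (fun w => c * f3 w) μ := h3.const_mul _
  have p4 : Integrable (fun w => e * f4 w) μ := h4.const_mul _
  have p12 : Integrable (fun w => 2 * (c * f1 w + e * f2 w)) μ := (p1.add p2).const_mul _
  have p34 : Integrable (fun w => 2 * (c * f3 w + e * f4 w)) μ := (p3.add p4).const_mul _
  have pp : Integrable (fun w => 2 * (c * f1 w + e * f2 w) + 2 * (c * f3 w + e * f4 w)) μ := p12.add p34
  rw [integral_add p0 pp, integral_add p12 p34, integral_const_mul, integral_const_mul, integral_const_mul, integral_add p1 p2,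
    integral_add p3 p4, integral_const_mul, integral_const_mul, integral_const_mul, integral_const_mul]

lemma E_Rm {ν : Measure (Matrix (Fin n) (Fin n) ℂ)} (hν : IsHaarU ν) {K y : ℝ} (hK0 : 0 ≤ K) (hy : 0 < y) (hy5 : y ≤ 50)
    (hK : ∀ x t : ℝ, |x| ≤ 2 → y ≤ t → t ≤ 50 → ∫ W, ‖mm ⟨x, t⟩ (XM d a W) - stj semicircle ⟨x, t⟩‖^2 ∂ν ≤ K / t^2) :
    ∫ W, Rm (esd (XM d a W)) y ∂ν ≤ K * (208 * Real.log (50/y) + 1000) := by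
  have := hν.prob
  have hlog : 0 ≤ Real.log (50/y) := Real.log_nonneg (by rw [le_div_iff₀ hy]; linarith)
  have hK' : ∀ x t : ℝ, |x| ≤ 2 → y ≤ t → t ≤ 50 → ∫ W, ‖Sc d a y W x t‖^2 ∂ν ≤ K / t^2 := by
    intro x t hx h1 h2
    have := hK x t hx h1 h2
    simp only [Sc, max_eq_left h1]
    exact this
  have pos : ∀ t ∈ Set.Icc y 50, 0 < t := fun t ht => hy.trans_le ht.1
  have iinv : ∀ c : ℝ, IntervalIntegrable (fun t : ℝ => c * t⁻¹) volume y 50 := fun c => by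
    refine ContinuousOn.intervalIntegrable ?_
    refine continuousOn_const.mul (ContinuousOn.inv₀ continuousOn_id fun s hs => (uIcc_sub_Ioi hy hy5 hs).ne')
  have vinv : ∀ c : ℝ, ∫ t in y..50, c * t⁻¹ = c * Real.log (50/y) := fun c => by
    rw [intervalIntegral.integral_const_mul, integral_inv_of_pos hy (by norm_num)]
  have b2 : ∀ x : ℝ, |x| ≤ 2 → ∫ W, (∫ s in y..50, s^2 * ‖Sc d a y W x s‖^2) ∂ν ≤ 50 * K := by
    intro x hx
    have cS := continuous_Sc (d := d) (a := a) hy (W := fun q : ℝ × Matrix (Fin n) (Fin n) ℂ => q.2) (x := fun q => x) (t := fun q => q.1)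
      (by fun_prop) (by fun_prop) (by fun_prop)
    have := hν.E_int_le (f := fun q => q.1^2 * ‖Sc d a y q.2 x q.1‖^2) (by fun_prop) hy5 (c := fun _ => K) (by simp) (fun t ht => by
      have h3 := hK' x t hx ht.1 ht.2
      have h4 := pos t ht
      simp only
      rw [integral_const_mul]
      rw [le_div_iff₀ (by positivity)] at h3
      linarith)
    refine this.trans ?_
    rw [intervalIntegral.integral_const, smul_eq_mul]
    nlinarith
  have b1 : ∀ x : ℝ, |x| ≤ 2 → ∫ W, (∫ s in y..50, s^1 * ‖Sc d a y W x s‖^2) ∂ν ≤ K * Real.log (50/y) := by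
    intro x hx
    have cS := continuous_Sc (d := d) (a := a) hy (W := fun q : ℝ × Matrix (Fin n) (Fin n) ℂ => q.2) (x := fun q => x) (t := fun q => q.1)
      (by fun_prop) (by fun_prop) (by fun_prop)
    have := hν.E_int_le (f := fun q => q.1^1 * ‖Sc d a y q.2 x q.1‖^2) (by fun_prop) hy5 (iinv K) (fun t ht => by
      have h3 := hK' x t hx ht.1 ht.2
      have h4 := pos t ht
      simp only
      rw [integral_const_mul]
      calc _ ≤ t^1 * (K / t^2) := by gcongr
        _ = _ := by field_simp)
    rw [vinv] at this
    exact this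
  have b0 : ∫ W, (∫ t in y..50, t * ∫ x in (-2:ℝ)..2, ‖Sc d a y W x t‖ ^ 2) ∂ν ≤ 4 * K * Real.log (50/y) := by
    have := hν.E_int_le (f := fun q => q.1 * ∫ x in (-2:ℝ)..2, ‖Sc d a y q.2 x q.1‖^2) (cont_inner hy) hy5 (iinv (4*K)) (fun t ht => by
      have h4 := pos t ht
      simp only
      rw [integral_const_mul]
      have cS := continuous_Sc (d := d) (a := a) hy (W := fun q : ℝ × Matrix (Fin n) (Fin n) ℂ => q.2) (x := fun q => q.1) (t := fun q => t)
        (by fun_prop) (by fun_prop) (by fun_prop)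
      have h5 := hν.E_int_le (f := fun q => ‖Sc d a y q.2 q.1 t‖^2) (by fun_prop) (show (-2:ℝ) ≤ 2 by norm_num) (c := fun _ => K / t^2) (by simp) (fun x hx => by
        exact hK' x t (abs_le.2 hx) ht.1 ht.2)
      rw [intervalIntegral.integral_const, smul_eq_mul] at h5
      calc _ ≤ t * ((2 - (-2)) * (K / t^2)) := mul_le_mul_of_nonneg_left h5 h4.le
        _ = _ := by field_simp; ring)
    rw [vinv] at this
    exact this
  have c0 := hν.integrable (cont_Phi (d := d) (a := a) hy)
  have cp := fun x p => hν.integrable (cont_Psi (d := d) (a := a) hy x p)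
  simp only [Rm_eq hy hy5]
  rw [int_five c0 (cp 2 2) (cp 2 1) (cp (-2) 2) (cp (-2) 1)]
  have := b2 2 (by norm_num); have := b2 (-2) (by norm_num)
  have := b1 2 (by norm_num); have := b1 (-2) (by norm_num)
  have q1 := mul_le_mul_of_nonneg_left (b2 2 (by norm_num)) (show 0 ≤ 5 + Real.log (50/y)/2 by positivity)
  have q2 := mul_le_mul_of_nonneg_left (b2 (-2) (by norm_num)) (show 0 ≤ 5 + Real.log (50/y)/2 by positivity)
  nlinarith

lemma Setup.wM_sq (h : Setup d a ρ) {ν : Measure (Matrix (Fin n) (Fin n) ℂ)} (hν : IsHaarU ν) {K : ℝ} (hK0 : 0 ≤ K)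
    (hK : ∀ x t : ℝ, |x| ≤ 2 → 1/(k:ℝ) ≤ t → t ≤ 50 → ∫ W, ‖mm ⟨x, t⟩ (XM d a W) - stj semicircle ⟨x, t⟩‖^2 ∂ν ≤ K / t^2) :
    ∫ W, wM d a W^2 ∂ν ≤ 68 * (K * (208 * Real.log (50*k) + 1000)) + 18432/(k:ℝ)^2 + (∫ W, xiM d a W^2 ∂ν)/2 := by
  have := hν.prob
  have hk0 := h.kpos
  have hk1 : 0 < k := by exact_mod_cast hk0
  have hk2 := h.k2
  obtain ⟨y, hy⟩ : ∃ y : ℝ, y = 1/(k:ℝ) := ⟨_, rfl⟩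
  rw [← hy] at hK
  have hy0 : 0 < y := by rw [hy]; positivity
  have hy1 : y ≤ 1 := by rw [hy, div_le_one hk0]; linarith
  have r1 := E_Rm hν hK0 hy0 (by linarith) hK
  have r2 := E_Rm hν hK0 (y := 2*y) (by linarith) (by linarith) (fun x t hx h1 h2 => hK x t hx (by linarith) h2)
  have hl : Real.log (50/(2*y)) ≤ Real.log (50/y) := by
    apply Real.log_le_log (by positivity)
    gcongr; linarith
  have r2' : ∫ W, Rm (esd (XM d a W)) (2*y) ∂ν ≤ K * (208 * Real.log (50/y) + 1000) := by
    refine r2.trans ?_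
    gcongr
  have e5 : 50/y = 50*k := by rw [hy]; field_simp
  have i1 := hν.integrable (cont_Rm (d := d) (a := a) hy0 (by linarith))
  have i2 := hν.integrable (cont_Rm (d := d) (a := a) (y := 2*y) (by linarith) (by linarith))
  have cw := continuous_wM (d := d) (a := a) hk1
  have ix : Integrable (fun W => xiM d a W^2) ν := hν.integrable (by fun_prop)
  have hd : ∀ W, wM d a W^2 ≤ 54 * Rm (esd (XM d a W)) y + 14 * Rm (esd (XM d a W)) (2*y) + 18432 * y^2 + xiM d a W^2/2 := by
    intro W
    have := W1_det (esd_nice hk1 (XM_herm d a W)) hy0 (by linarith)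
    rw [esd_sq (XM_herm d a W)] at this
    exact this
  have := integral_mono (hν.integrable (by fun_prop)) ((((i1.const_mul 54).add (i2.const_mul 14)).add (integrable_const _)).add (ix.div_const 2)) hd
  refine this.trans ?_
  rw [integral_add' (((i1.const_mul 54).add (i2.const_mul 14)).add (integrable_const _)) (ix.div_const 2),
    integral_add' ((i1.const_mul 54).add (i2.const_mul 14)) (integrable_const _), integral_add' (i1.const_mul 54) (i2.const_mul 14), integral_const_mul, integral_const_mul,
    integral_div, integral_const]
  simp only [probReal_univ, one_smul]
  rw [e5] at r1 r2'
  have e6 : 18432 * y^2 = 18432/(k:ℝ)^2 := by rw [hy]; field_simp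
  rw [e6]
  linarith

end Exp2

open MeasureTheory ProbabilityTheory Matrix
open scoped Matrix ENNReal
set_option linter.unusedSectionVars false

section Mean
open scoped Matrix.Norms.Frobenius NNReal
variable {n k : ℕ} {d : Fin n → ℝ} {a : Fin k → Fin n} {ρ : ℝ}

lemma Setup.nq (h : Setup d a ρ) : 1 ≤ n * (ρ^2/s2 d) := by
  have := h.nr2; have := h.s2pos
  rw [← mul_div_assoc, le_div_iff₀ this]; linarith

lemma int_sq_le {α : Type*} [MeasurableSpace α] {μ : Measure α} [IsProbabilityMeasure μ] {f : α → ℝ}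
    (h1 : Integrable f μ) (h2 : Integrable (fun x => f x^2) μ) : (∫ x, f x ∂μ)^2 ≤ ∫ x, f x^2 ∂μ := by
  set E0 := ∫ x, f x ∂μ with hE0
  have : 0 ≤ ∫ x, (f x - E0)^2 ∂μ := integral_nonneg fun x => sq_nonneg _
  have e : ∀ x, (f x - E0)^2 = (f x^2 - 2 * E0 * f x) + E0^2 := fun x => by ring
  simp only [e] at this
  have p1 : Integrable (fun x => 2 * E0 * f x) μ := h1.const_mul _
  have p2 : Integrable (fun x => f x^2 - 2 * E0 * f x) μ := h2.sub p1
  rw [integral_add p2 (integrable_const _), integral_sub h2 p1, integral_const_mul, ← hE0] at this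
  simp only [integral_const, probReal_univ, one_smul] at this
  nlinarith

lemma Setup.mean_le_two (h : Setup d a ρ) {ν : Measure (Matrix (Fin n) (Fin n) ℂ)} (hν : IsHaarU ν) :
    ∫ W, wM d a W ∂ν ≤ 2 := by
  have := hν.prob
  have hk := h.kpos
  have hk1 : 0 < k := by exact_mod_cast hk
  have cw := continuous_wM (d := d) (a := a) hk1
  have cX := continuous_XM d a
  have h1 : ∫ W, wM d a W ∂ν ≤ ∫ W, (1 + ‖XM d a W‖ / Real.sqrt k) ∂ν :=
    integral_mono (hν.integrable cw) (hν.integrable (by fun_prop)) fun W => W1_le_norm hk1 (XM_herm d a W)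
  rw [integral_add (integrable_const _) (hν.integrable (by fun_prop)), integral_div] at h1
  simp only [integral_const, probReal_univ, one_smul] at h1
  have h2 : ∫ W, ‖XM d a W‖ ∂ν ≤ Real.sqrt k := by
    apply Real.le_sqrt_of_sq_le
    exact (int_sq_le (hν.integrable (by fun_prop)) (hν.integrable (by fun_prop))).trans (h.XM_moment hν)
  have h3 : (∫ W, ‖XM d a W‖ ∂ν) / Real.sqrt k ≤ 1 := by
    rw [div_le_one (Real.sqrt_pos.2 hk)]; exact h2
  linarith

/-- constant for the second-moment bound -/
noncomputable def Cms : ℝ := 100000 * Cstab + 20000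

lemma Cstab_pos : 0 < Cstab := by unfold Cstab; positivity
lemma Cms_pos : 0 < Cms := by have := Cstab_pos; unfold Cms; positivity

lemma Setup.mean_sq (h : Setup d a ρ) {ν : Measure (Matrix (Fin n) (Fin n) ℂ)} (hν : IsHaarU ν) (hk : (10:ℝ)^6 ≤ k)
    (hβ : (k:ℝ)^4 * n * (ρ^2/s2 d)^2 ≤ 1/81) :
    ∫ W, wM d a W^2 ∂ν ≤ Cms * Real.log k * (1/(k:ℝ)^2 + (k:ℝ)^3 * n * (ρ^2/s2 d)^2) := by
  have hk0 := h.kpos; have hn := h.npos; have hs := h.s2pos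
  have hq := h.nq
  have hkn := h.kn
  obtain ⟨q, hqd⟩ : ∃ q, q = ρ^2/s2 d := ⟨_, rfl⟩
  have hxi := h.xi_moment hν
  have hq0 : 0 ≤ q := by rw [hqd]; positivity
  have hst := fun x t hx h1 h2 => h.stab hν (x := x) (η := t) hk (by
    rw [← hqd] at hq hβ
    have : (1:ℝ) ≤ (n * q)^2 := one_le_pow₀ hq
    have h4 : (k:ℝ)^4 * 1 ≤ (k:ℝ)^4 * (n*q)^2 := by gcongr
    have h5 : n * ((k:ℝ)^4 * n * q^2) ≤ n * (1/81) := by gcongr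
    linarith [show n * ((k:ℝ)^4 * n * q^2) = (k:ℝ)^4 * (n*q)^2 by ring]) (by linarith) hx h1 h2
  have hC := Cstab_pos
  have hS : 0 ≤ 1/(k:ℝ)^2 + (k:ℝ)^3 * n * (ρ^2/s2 d)^2 := by positivity
  have hw := h.wM_sq hν (K := Cstab * (1/(k:ℝ)^2 + (k:ℝ)^3 * n * (ρ^2/s2 d)^2)) (by positivity) hst
  rw [← hqd] at hq hβ hxi hS hw ⊢
  refine hw.trans ?_
  have hl1 : 1 ≤ Real.log k := by
    rw [Real.le_log_iff_exp_le hk0]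
    have := Real.exp_one_lt_d9
    linarith
  have hl2 : Real.log (50*k) ≤ 2 * Real.log k := by
    rw [Real.log_mul (by norm_num) hk0.ne']
    have : Real.log 50 ≤ Real.log k := Real.log_le_log (by norm_num) (by linarith)
    linarith
  have hkn2 : ((k:ℝ)/n)^2 ≤ 1/(k:ℝ)^2 := by
    have h81 : (k:ℝ)^2 ≤ n := by
      have : (1:ℝ) ≤ (n * q)^2 := one_le_pow₀ hq
      have h4 : (k:ℝ)^4 * 1 ≤ (k:ℝ)^4 * (n*q)^2 := by gcongr
      have h5 : n * ((k:ℝ)^4 * n * q^2) ≤ n * (1/81) := by gcongr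
      have h6 : (k:ℝ)^2 ≤ (k:ℝ)^4 := pow_le_pow_right₀ (by linarith) (by norm_num)
      linarith [show n * ((k:ℝ)^4 * n * q^2) = (k:ℝ)^4 * (n*q)^2 by ring]
    rw [div_pow, div_le_div_iff₀ (by positivity) (by positivity)]
    nlinarith [pow_pos hk0 2]
  have hkq : k * q ≤ (k:ℝ)^3 * n * q^2 := by
    have h1 : (1:ℝ) ≤ k^2 := one_le_pow₀ (by linarith)
    have h2 : 1 * 1 ≤ (k:ℝ)^2 * (n*q) := mul_le_mul h1 hq (by norm_num) (by positivity)
    have h3 : (k*q) * 1 ≤ (k*q) * ((k:ℝ)^2 * (n*q)) := by gcongr; linarith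
    linarith [show (k*q) * ((k:ℝ)^2 * (n*q)) = (k:ℝ)^3 * n * q^2 by ring]
  obtain ⟨S, hSd⟩ : ∃ S, S = 1/(k:ℝ)^2 + (k:ℝ)^3 * n * q^2 := ⟨_, rfl⟩
  have hS1 : 1/(k:ℝ)^2 ≤ S := by rw [hSd]; have : 0 ≤ (k:ℝ)^3 * n * q^2 := by positivity
                                 linarith
  have hS2 : (k:ℝ)^3 * n * q^2 ≤ S := by rw [hSd]; have : 0 ≤ 1/(k:ℝ)^2 := by positivity
                                         linarith
  rw [← hSd] at hS ⊢
  have e1 : 18432/(k:ℝ)^2 ≤ 18432 * S := by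
    rw [show 18432/(k:ℝ)^2 = 18432 * (1/(k:ℝ)^2) by ring]; gcongr
  have e2 : (∫ W, xiM d a W^2 ∂ν) ≤ 480 * S := by linarith
  have e3 : 68 * (Cstab * S * (208 * Real.log (50*k) + 1000)) ≤ 68 * (Cstab * S * (1416 * Real.log k)) := by
    gcongr; linarith
  have e4 : S ≤ S * Real.log k := le_mul_of_one_le_right hS hl1
  have e5 : 0 ≤ Cstab * (S * Real.log k) := by positivity
  unfold Cms
  nlinarith

theorem mean_bound : ∃ C : ℝ, 0 < C ∧ ∀ (n k : ℕ) (d : Fin n → ℝ) (a : Fin k → Fin n) (ρ : ℝ), Setup d a ρ →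
    ∀ ν : Measure (Matrix (Fin n) (Fin n) ℂ), IsHaarU ν →
    ∫ W, wM d a W ∂ν ≤ 18 * (k:ℝ)^2 * Real.sqrt n * (ρ^2/s2 d) + C * Real.sqrt (Real.log k) / k := by
  have hCp := Cms_pos
  obtain ⟨k0, hk0⟩ : ∃ k0 : ℝ, ∀ x ≥ k0, Cms * Real.log x ≤ 324 * x := by
    have := (Real.isLittleO_log_id_atTop.def (c := 324 / Cms) (by positivity))
    obtain ⟨k0, hk0⟩ := Filter.eventually_atTop.1 this
    refine ⟨max k0 1, fun x hx => ?_⟩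
    have h1 := hk0 x (le_trans (le_max_left _ _) hx)
    have hx1 : 1 ≤ x := le_trans (le_max_right _ _) hx
    rw [Real.norm_eq_abs, id, Real.norm_eq_abs, abs_of_nonneg (Real.log_nonneg hx1), abs_of_nonneg (by linarith)] at h1
    calc _ ≤ Cms * (324 / Cms * x) := by gcongr
      _ = _ := by field_simp
  set k1 := max k0 (10^6) with hk1
  have hk1p : 0 < k1 := lt_of_lt_of_le (by norm_num) (le_max_right _ _)
  have hl2 : 0 < Real.sqrt (Real.log 2) := Real.sqrt_pos.2 (Real.log_pos (by norm_num))
  refine ⟨Real.sqrt Cms + 2 * k1 / Real.sqrt (Real.log 2), by positivity, ?_⟩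
  intro n k d a ρ h ν hν
  have := hν.prob
  have hk := h.kpos; have hn := h.npos; have hs := h.s2pos; have hk2 := h.k2
  have hkn : 0 < k := by exact_mod_cast hk
  have h2 := h.mean_le_two hν
  obtain ⟨q, hq⟩ : ∃ q, q = ρ^2/s2 d := ⟨_, rfl⟩
  have hq0 : 0 ≤ q := by rw [hq]; positivity
  obtain ⟨β, hβ⟩ : ∃ β, β = (k:ℝ)^2 * Real.sqrt n * q := ⟨_, rfl⟩
  have hβ0 : 0 ≤ β := by rw [hβ]; positivity
  have hβ2 : β^2 = (k:ℝ)^4 * n * q^2 := by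
    rw [hβ, mul_pow, mul_pow, Real.sq_sqrt hn.le]; ring
  rw [← hq, show 18 * (k:ℝ)^2 * Real.sqrt n * q = 18 * β by rw [hβ]; ring]
  have hlk : 0 ≤ Real.log k := Real.log_nonneg (by linarith)
  have hs0 := Real.sqrt_nonneg (Real.log k)
  rw [add_mul, add_div]
  have t1 : 0 ≤ Real.sqrt Cms * Real.sqrt (Real.log k) / k := by positivity
  have t2 : 0 ≤ 2 * k1 / Real.sqrt (Real.log 2) * Real.sqrt (Real.log k) / k := by positivity
  by_cases hb : 1/9 < β
  · linarith
  by_cases hkk : (k:ℝ) < k1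
  · have : 2 ≤ 2 * k1 / Real.sqrt (Real.log 2) * Real.sqrt (Real.log k) / k := by
      rw [le_div_iff₀ hk, div_mul_eq_mul_div, le_div_iff₀ hl2]
      have : Real.sqrt (Real.log 2) ≤ Real.sqrt (Real.log k) := Real.sqrt_le_sqrt (Real.log_le_log (by norm_num) hk2)
      have := mul_le_mul hkk.le this hl2.le hk1p.le
      linarith
    linarith
  push Not at hb hkk
  have hms := h.mean_sq hν ((le_max_right _ _).trans hkk) (by rw [← hq, ← hβ2]; nlinarith)
  have hkl := hk0 k ((le_max_left _ _).trans hkk)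
  have cw := continuous_wM (d := d) (a := a) hkn
  have hE := (int_sq_le (hν.integrable cw) (hν.integrable (by fun_prop))).trans hms
  have key : ∫ W, wM d a W ∂ν ≤ Real.sqrt Cms * Real.sqrt (Real.log k) / k + 18 * β := by
    refine (abs_le_of_sq_le_sq' (hE.trans ?_) (by positivity)).2
    rw [← hq]
    have e1 : (Real.sqrt Cms * Real.sqrt (Real.log k) / k)^2 = Cms * Real.log k * (1/(k:ℝ)^2) := by
      rw [div_pow, mul_pow, Real.sq_sqrt hCp.le, Real.sq_sqrt hlk]; ring
    have e2 : Cms * Real.log k * ((k:ℝ)^3 * n * q^2) ≤ 324 * β^2 := by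
      rw [hβ2]
      calc _ ≤ 324 * k * ((k:ℝ)^3 * n * q^2) := by gcongr
        _ = _ := by ring
    have e3 : 0 ≤ Real.sqrt Cms * Real.sqrt (Real.log k) / k * β := by positivity
    nlinarith
  linarith
end Mean

open MeasureTheory ProbabilityTheory Matrix
open scoped Matrix ENNReal
set_option linter.unusedSectionVars false

section Fin1
open scoped Matrix.Norms.Frobenius NNReal
variable {n k : ℕ} {d : Fin n → ℝ} {a : Fin k → Fin n} {ρ : ℝ}

lemma stiefel_norm {V : Matrix (Fin k) (Fin n) ℂ} (hV : V * Vᴴ = 1) : ‖V‖ = Real.sqrt k := by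
  have : ‖V‖^2 = k := by rw [frob_sq_trace, hV]; simp
  rw [← this, Real.sqrt_sq (norm_nonneg _)]

lemma Setup.XM_le (h : Setup d a ρ) {W : Matrix (Fin n) (Fin n) ℂ} (hW : W ∈ unitaryGroup (Fin n) ℂ) :
    ‖XM d a W‖ ≤ c0 k d * (ρ * Real.sqrt k) := by
  have hV := sel_stiefel h.ha hW
  rw [XM, norm_smul, Complex.norm_real, Real.norm_eq_abs, abs_of_pos h.c0pos, cB_eq]
  refine mul_le_mul_of_nonneg_left ?_ h.c0pos.le
  refine (mul_stiefel_le hV _).trans ((mul_dM_le h.bd h.rho_nonneg _).trans ?_)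
  rw [stiefel_norm hV]

lemma Setup.small (h : Setup d a ρ) (hn9 : n < 9 * k) {W : Matrix (Fin n) (Fin n) ℂ} (hW : W ∈ unitaryGroup (Fin n) ℂ) :
    wM d a W ≤ 18 * (k:ℝ)^2 * Real.sqrt n * (ρ^2/s2 d) := by
  have hk := h.kpos; have hn := h.npos; have hs := h.s2pos; have hk2 := h.k2; have hρ := h.rhopos
  have hkn : 0 < k := by exact_mod_cast hk
  have hsk := Real.sqrt_pos.2 hk
  have h1 : wM d a W ≤ _ := W1_le_norm hkn (XM_herm d a W)
  have h2 : ‖XM d a W‖ / Real.sqrt k ≤ c0 k d * ρ := by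
    rw [div_le_iff₀ hsk]; have := h.XM_le hW; linarith
  obtain ⟨r, hr⟩ : ∃ r, r = ρ / Real.sqrt (s2 d) := ⟨_, rfl⟩
  have hss := Real.sqrt_pos.2 hs
  have hr0 : 0 < r := by rw [hr]; positivity
  have hr2 : r^2 = ρ^2/s2 d := by rw [hr, div_pow, Real.sq_sqrt hs.le]
  have hq := h.nq
  rw [← hr2] at hq ⊢
  have hn9' : (n:ℝ) < 9 * k := by exact_mod_cast hn9
  have h3 : c0 k d * ρ ≤ 9 * k * r := by
    have e : c0 k d * ρ = Real.sqrt ((n:ℝ)^2-1) / Real.sqrt k * r := by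
      rw [c0, hr]; field_simp
    rw [e]
    gcongr
    rw [div_le_iff₀ hsk]
    have h4 : Real.sqrt ((n:ℝ)^2-1) ≤ n := by
      rw [Real.sqrt_le_left hn.le]; linarith
    have h5 : 1 ≤ Real.sqrt k := by rw [Real.one_le_sqrt]; linarith
    nlinarith
  obtain ⟨m, hm⟩ : ∃ m, m = Real.sqrt n := ⟨_, rfl⟩
  have hm2 : m^2 = n := by rw [hm, Real.sq_sqrt hn.le]
  have hm0 : 0 < m := by rw [hm]; exact Real.sqrt_pos.2 hn
  rw [← hm]
  have hmr : 1 ≤ m * r := by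
    have : 1 ≤ (m*r)^2 := by rw [mul_pow, hm2]; exact hq
    nlinarith [mul_pos hm0 hr0]
  have hm9 : m ≤ 9 * k := by nlinarith
  have h6 : 1 ≤ 9 * k * r := by nlinarith
  have h7 : 18 * (k:ℝ)^2 * r * 1 ≤ 18 * (k:ℝ)^2 * r * (m * r) := by gcongr
  have h8 : 2 * (k * r) ≤ k * (k * r) := by gcongr
  nlinarith

lemma Setup.tail (h : Setup d a ρ) {ν : Measure (Matrix (Fin n) (Fin n) ℂ)} (hν : IsHaarU ν) (hc : 9 * k ≤ n) {t : ℝ} (ht : 0 < t) :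
    ν {W | (∫ W', wM d a W' ∂ν) + t ≤ wM d a W} ≤ ENNReal.ofReal (Real.exp (-((n : ℝ) * t ^ 2 / 12) /
            (2 * (Real.sqrt ((n : ℝ) ^ 2 - 1) / k) * (ρ / Real.sqrt (s2 d))) ^ 2)) := by
  have hk := h.kpos; have hn := h.npos; have hs := h.s2pos; have hρ := h.rhopos; have hc0 := h.c0pos
  have hkn : 0 < k := by exact_mod_cast hk
  have := hν.prob
  have hsk := Real.sqrt_pos.2 hk
  have hss := Real.sqrt_pos.2 hs
  have hkk : Real.sqrt k * Real.sqrt k = k := Real.mul_self_sqrt hk.le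
  let F : Matrix (Fin k) (Fin n) ℂ → ℝ := fun V => W1m (esd (((c0 k d : ℝ) : ℂ) • (V * dM d * Vᴴ))) semicircle
  have hherm : ∀ V : Matrix (Fin k) (Fin n) ℂ, (((c0 k d : ℝ) : ℂ) • (V * dM d * Vᴴ)).IsHermitian := by
    intro V
    unfold Matrix.IsHermitian
    rw [Matrix.conjTranspose_smul, Matrix.conjTranspose_mul, Matrix.conjTranspose_mul, (dM_herm d).eq, Matrix.conjTranspose_conjTranspose]
    simp [Matrix.mul_assoc]
  let L : ℝ≥0 := ⟨c0 k d * (2 * ρ) / Real.sqrt k, by positivity⟩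
  have hL : (L:ℝ) = c0 k d * (2 * ρ) / Real.sqrt k := rfl
  have hL2 : (L:ℝ) = 2 * (Real.sqrt ((n : ℝ) ^ 2 - 1) / k) * (ρ / Real.sqrt (s2 d)) := by
    rw [hL, c0, show Real.sqrt ((n : ℝ) ^ 2 - 1) / (k:ℝ) = Real.sqrt ((n : ℝ) ^ 2 - 1) / (Real.sqrt k * Real.sqrt k) by rw [hkk]]; field_simp
  have hFL : LipschitzOnWith L F {V | V * Vᴴ = 1} := by
    refine LipschitzOnWith.of_dist_le_mul fun V hV V' hV' => ?_
    rw [Real.dist_eq, dist_eq_norm, hL]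
    refine (W1_lip_abs hkn (hherm V) (hherm V')).trans ?_
    rw [← smul_sub, norm_smul, Complex.norm_real, Real.norm_eq_abs, abs_of_pos hc0]
    have := stiefel_lip h.bd h.rho_nonneg hV hV'
    rw [div_mul_eq_mul_div]
    refine div_le_div_of_nonneg_right ?_ hsk.le
    calc _ ≤ c0 k d * (2 * ρ * ‖V - V'‖) := mul_le_mul_of_nonneg_left this hc0.le
      _ = _ := by ring
  obtain ⟨G, hG, hGF⟩ := hFL.extend_real
  have hae : ∀ᵐ W ∂ν, G (selM a * W) = wM d a W := by
    filter_upwards [hν.unit] with W hW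
    rw [← hGF (sel_stiefel h.ha hW)]
    simp only [F, wM, XM]
    rw [cB_eq]
  have hLpos : 0 < L := by
    rw [← NNReal.coe_pos, hL]; positivity
  have main := conc_tail hν hLpos hG h.ha (by simpa using hc) (by simpa using (by exact_mod_cast hn : 0 < n)) ht
  rw [integral_congr_ae hae, hL2, Fintype.card_fin] at main
  refine le_trans (le_of_eq ?_) main
  apply measure_congr
  filter_upwards [hae] with W hW
  apply propext
  change _ ≤ wM d a W ↔ _ ≤ G (selM a * W)
  rw [hW]

lemma map_haar {Ω : Type*} [MeasurableSpace Ω] (P : Measure Ω) [IsProbabilityMeasure P]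
    (U : Ω → Matrix (Fin n) (Fin n) ℂ) (hU : Measurable U) (hu : ∀ ω, U ω ∈ Matrix.unitaryGroup (Fin n) ℂ)
    (hi : ∀ V ∈ Matrix.unitaryGroup (Fin n) ℂ, Measure.map (fun ω => V * U ω) P = Measure.map U P) :
    IsHaarU (Measure.map U P) where
  prob := Measure.isProbabilityMeasure_map hU.aemeasurable
  unit := by
    exact (ae_map_iff (p := fun W => W ∈ Matrix.unitaryGroup (Fin n) ℂ) hU.aemeasurable isCompact_unitaryGroup.isClosed.measurableSet).2 (Filter.Eventually.of_forall hu)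
  inv V hV := by
    have hm : Measurable (fun W : Matrix (Fin n) (Fin n) ℂ => V * W) := (by fun_prop : Continuous (fun W : Matrix (Fin n) (Fin n) ℂ => V * W)).measurable
    rw [Measure.map_map hm hU]
    exact hi V hV

lemma opNormR_bd (Λ : Matrix (Fin n) (Fin n) ℝ) (i : Fin n) : |Λ i i| ≤ opNormR Λ := by
  have h := (Matrix.toEuclideanCLM (𝕜 := ℝ) Λ).le_opNorm ((WithLp.toLp 2 (Pi.single i (1:ℝ)) : EuclideanSpace ℝ (Fin n)))
  have h0 : ‖(WithLp.toLp 2 (Pi.single i (1:ℝ)) : EuclideanSpace ℝ (Fin n))‖ = 1 := by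
    rw [PiLp.norm_toLp_single, norm_one]
  rw [h0, mul_one] at h
  have h2 := (PiLp.norm_apply_le (Matrix.toEuclideanCLM (𝕜 := ℝ) Λ ((WithLp.toLp 2 (Pi.single i (1:ℝ)) : EuclideanSpace ℝ (Fin n)))) i).trans h
  rw [Real.norm_eq_abs] at h2
  rw [Matrix.toEuclideanCLM_toLp] at h2
  simpa [opNormR] using h2

lemma hsNormR_eq {Λ : Matrix (Fin n) (Fin n) ℝ} (hd : Λ.IsDiag) : hsNormR Λ = Real.sqrt (s2 fun i => Λ i i) := by
  rw [hsNormR, s2]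
  congr 1
  rw [Matrix.trace]
  refine Finset.sum_congr rfl fun i _ => ?_
  rw [Matrix.diag_apply, Matrix.mul_apply, Finset.sum_eq_single i]
  · simp [pow_two]
  · intro j _ hj
    rw [hd (Ne.symm hj), zero_mul]
  · simp

end Fin1

theorem stmt10 :
    ∃ C : ℝ, 0 < C ∧
      ∀ (n k : ℕ) (_ : k ≤ n) (_ : 2 ≤ k)
        (Λ : Matrix (Fin n) (Fin n) ℝ) (_ : Λ.IsDiag) (_ : Λ ≠ 0)
        (_ : Λ.trace = 0)
        (Ω : Type u) [MeasurableSpace Ω] (P : Measure Ω) [IsProbabilityMeasure P]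
        -- U is Haar distributed on the unitary group:
        (U : Ω → Matrix (Fin n) (Fin n) ℂ) (_ : Measurable U)
        (_ : ∀ ω, U ω ∈ Matrix.unitaryGroup (Fin n) ℂ)
        (_ : ∀ V ∈ Matrix.unitaryGroup (Fin n) ℂ,
          Measure.map (fun ω => V * U ω) P = Measure.map U P)
        (t : ℝ) (_ : 0 < t),
        P {ω |
            18 * k ^ 2 * Real.sqrt n * ((opNormR Λ) ^ 2 / (hsNormR Λ) ^ 2) +
              C * Real.sqrt (Real.log k) / k + t ≤
            W1m (esd ((Real.sqrt k)⁻¹ •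
              (Real.sqrt ((n : ℝ) ^ 2 - 1) / hsNormR Λ) •
                ((U ω * Λ.map (fun x => (x : ℂ)) * (U ω)ᴴ).submatrix
                  (Fin.castLE ‹k ≤ n›) (Fin.castLE ‹k ≤ n›)))) semicircle} ≤
          ENNReal.ofReal (Real.exp (-((n : ℝ) * t ^ 2 / 12) /
            (2 * (Real.sqrt ((n : ℝ) ^ 2 - 1) / k) * (opNormR Λ / hsNormR Λ)) ^ 2)) := by
  obtain ⟨C, hC, hmean⟩ := mean_bound
  refine ⟨C, hC, ?_⟩
  intro n k hkn hk2 Λ hd hne htr Ω _ P _ U hU hu hi t ht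
  set d : Fin n → ℝ := fun i => Λ i i with hdd
  have hdiag : Λ = diagonal d := by
    ext i j
    by_cases hij : i = j
    · subst hij; simp [hdd]
    · rw [hd hij, diagonal_apply_ne _ hij]
  have hset : Setup d (Fin.castLE hkn) (opNormR Λ) :=
    { ha := Fin.castLE_injective hkn
      sum0 := htr
      pos := by
        refine lt_of_le_of_ne (Finset.sum_nonneg fun i _ => sq_nonneg _) fun h0 => hne ?_
        have h1 := (Finset.sum_eq_zero_iff_of_nonneg (fun i _ => sq_nonneg (d i))).1 h0.symm
        rw [hdiag]
        ext i j
        by_cases hij : i = j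
        · subst hij
          have := h1 i (Finset.mem_univ _)
          rw [diagonal_apply_eq]
          simpa using this
        · rw [diagonal_apply_ne _ hij]; rfl
      bd := opNormR_bd Λ
      hk := hk2
      hkn := hkn }
  have hs := hset.s2pos
  have hhs : hsNormR Λ = Real.sqrt (s2 d) := hsNormR_eq hd
  have hhs2 : hsNormR Λ ^ 2 = s2 d := by rw [hhs, Real.sq_sqrt hs.le]
  have hX : ∀ ω, (Real.sqrt k)⁻¹ • (Real.sqrt ((n : ℝ) ^ 2 - 1) / hsNormR Λ) •
      ((U ω * Λ.map (fun x => (x : ℂ)) * (U ω)ᴴ).submatrix (Fin.castLE hkn) (Fin.castLE hkn)) = XM d (Fin.castLE hkn) (U ω) := by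
    intro ω
    have hmap : Λ.map (fun x => (x : ℂ)) = dM d := by
      conv_lhs => rw [hdiag]
      rw [dM, Matrix.diagonal_map (by simp)]
    have hsub : (U ω * dM d * (U ω)ᴴ).submatrix (Fin.castLE hkn) (Fin.castLE hkn) = cB (Fin.castLE hkn) (dM d) (U ω) := by
      rw [cB_eq, selM_mul]
      rfl
    rw [hmap, hsub, XM, c0, hhs, smul_smul]
    ext i j
    simp only [Matrix.smul_apply, Complex.real_smul, smul_eq_mul]
    congr 2
    field_simp
  have hν := map_haar P U hU hu hi
  simp only [hX, hhs2]
  have hb := hmean n k d (Fin.castLE hkn) (opNormR Λ) hset _ hν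
  have hk0 := hset.kpos
  rcases lt_or_ge n (9 * k) with hlt | hge
  · have hemp : {ω | 18 * (k:ℝ) ^ 2 * Real.sqrt n * ((opNormR Λ) ^ 2 / s2 d) + C * Real.sqrt (Real.log k) / k + t ≤
        W1m (esd (XM d (Fin.castLE hkn) (U ω))) semicircle} = ∅ := by
      refine Set.eq_empty_iff_forall_notMem.2 fun ω hω => ?_
      have h1 := hset.small hlt (hu ω)
      have h2 : _ ≤ wM d (Fin.castLE hkn) (U ω) := hω
      have h3 : 0 ≤ C * Real.sqrt (Real.log k) / k := by positivity
      linarith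
    rw [hemp, measure_empty]
    exact zero_le
  · have htail := hset.tail hν hge ht
    rw [hhs]
    refine le_trans ?_ htail
    refine le_trans (measure_mono ?_) (Measure.le_map_apply hU.aemeasurable _)
    intro ω hω
    have h2 : _ ≤ wM d (Fin.castLE hkn) (U ω) := hω
    change _ ≤ wM d (Fin.castLE hkn) (U ω)
    linarith
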